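/- For every function w : ℕ → ℝ with w(x) → +∞ as x → +∞, there exist a set B of natural numbers and a constant C > 0 such that B(x) ≤ C·w(x)·log x for all sufficiently large x, and the sumset B + 𝒫 = {b + p : b ∈ B, p ∈ 𝒫} has lower asymptotic density 1, i.e., liminf_{x→∞} |{n ≤ x : n ∈ B + 𝒫}| / x = 1. -/

import Mathlib

open Real Filter

/-- The counting function of a set `A ⊆ ℕ`: `A(x) = |A ∩ [1, x]|`. -/
noncomputable def countFn (A : Set ℕ) (x : ℝ) : ℕ :=
  Set.ncard {a : ℕ | a ∈ A ∧ 1 ≤ a ∧ (a : ℝ) ≤ x}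

namespace PrimeComplement

open scoped ArithmeticFunction.vonMangoldt ArithmeticFunction.Moebius ArithmeticFunction.zeta
open Finset

/-- The partial sums of `Λ(n)/n`. -/
noncomputable def lamSum (x : ℝ) : ℝ := ∑ n ∈ Ioc 0 ⌊x⌋₊, Λ n / n

lemma lamSum_nat_bounds {N : ℕ} (hN : N ≠ 0) :
    log N - 1 ≤ lamSum N ∧ lamSum N ≤ log N + (log 4 + 4) := by
  have hNpos : (0 : ℝ) < N := by positivity
  have hfac : log (N.factorial : ℝ) = ∑ d ∈ Ioc 0 N, Λ d * ((N / d : ℕ) : ℝ) := by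
    rw [← ArithmeticFunction.sum_Ioc_mul_zeta_eq_sum, ArithmeticFunction.vonMangoldt_mul_zeta]
    simp only [ArithmeticFunction.log_apply]
    rw [← Finset.prod_Ico_id_eq_factorial, Nat.cast_prod, Real.log_prod]
    · rfl
    intro i hi
    have := (mem_Ioc.1 hi).1
    positivity
  have hlow : (N : ℝ) * log N - N ≤ log (N.factorial : ℝ) := by
    have := Stirling.le_log_factorial_stirling hN
    have h1 : 0 ≤ log (N : ℝ) := log_natCast_nonneg N
    have h2 : 0 ≤ log (2 * π) := log_nonneg (by nlinarith [Real.two_le_pi])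
    linarith
  have hup : log (N.factorial : ℝ) ≤ N * log N := by
    rw [← Real.log_pow]
    apply log_le_log (by positivity)
    exact_mod_cast Nat.factorial_le_pow N
  have hpsi : ∑ d ∈ Ioc 0 N, Λ d ≤ (log 4 + 4) * N := by
    have := Chebyshev.psi_le_const_mul_self (x := (N : ℝ)) hNpos.le
    simpa [Chebyshev.psi] using this
  have hs : lamSum N * N = ∑ d ∈ Ioc 0 N, Λ d * ((N : ℝ) / d) := by
    simp only [lamSum, Nat.floor_natCast, Finset.sum_mul]
    exact sum_congr rfl fun i _ => by ring
  constructor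
  · have : log (N.factorial : ℝ) ≤ lamSum N * N := by
      rw [hs, hfac]
      exact sum_le_sum fun i _ => mul_le_mul_of_nonneg_left Nat.cast_div_le
        ArithmeticFunction.vonMangoldt_nonneg
    have h3 : (log N - 1) * N ≤ lamSum N * N := by linarith
    exact le_of_mul_le_mul_right h3 hNpos
  · have : lamSum N * N ≤ log (N.factorial : ℝ) + ∑ d ∈ Ioc 0 N, Λ d := by
      rw [hs, hfac, ← sum_add_distrib]
      refine sum_le_sum fun i hi => ?_
      have hi0 : 0 < i := (mem_Ioc.1 hi).1
      have : (N : ℝ) / i ≤ ((N / i : ℕ) : ℝ) + 1 := by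
        rw [← Nat.floor_div_eq_div (K := ℝ)]
        exact (Nat.lt_floor_add_one _).le
      nlinarith [ArithmeticFunction.vonMangoldt_nonneg (n := i)]
    have h3 : lamSum N * N ≤ (log N + (log 4 + 4)) * N := by linarith
    exact le_of_mul_le_mul_right h3 hNpos

/-- The constant in Mertens' first theorem. -/
noncomputable def mertensC : ℝ := log 4 + 4

lemma mertensC_pos : 4 ≤ mertensC := by
  unfold mertensC
  have : 0 ≤ log 4 := log_nonneg (by norm_num)
  linarith

/-- Mertens' first theorem. -/
lemma abs_lamSum_sub_log_le {x : ℝ} (hx : 1 ≤ x) : |lamSum x - log x| ≤ mertensC := by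
  have hN : ⌊x⌋₊ ≠ 0 := by
    have := Nat.le_floor (α := ℝ) (n := 1) (a := x) (by simpa using hx)
    omega
  have h := lamSum_nat_bounds hN
  have he : lamSum x = lamSum (⌊x⌋₊ : ℕ) := by simp [lamSum]
  have hf : (⌊x⌋₊ : ℝ) ≤ x := Nat.floor_le (by linarith)
  have hpos : (0 : ℝ) < ⌊x⌋₊ := by positivity
  have h1 : log (⌊x⌋₊ : ℝ) ≤ log x := log_le_log hpos hf
  have h2 : log x ≤ log (⌊x⌋₊ : ℝ) + log 2 := by
    rw [← log_mul (by positivity) (by norm_num)]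
    apply log_le_log (by linarith)
    have := Nat.lt_floor_add_one x
    have : (1 : ℝ) ≤ ⌊x⌋₊ := by exact_mod_cast Nat.one_le_iff_ne_zero.2 hN
    linarith
  have h3 : log 2 ≤ 1 := by linarith [Real.log_two_lt_d9]
  have := mertensC_pos
  rw [abs_le, he]
  unfold mertensC at *
  constructor <;> linarith

lemma lamSum_nonneg (x : ℝ) : 0 ≤ lamSum x :=
  sum_nonneg fun _ _ => div_nonneg ArithmeticFunction.vonMangoldt_nonneg (Nat.cast_nonneg _)

/-- The constant bounding sums of reciprocals of primes over `[N, N ^ 2)`. -/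
noncomputable def recipC : ℝ := 2 + 2 * mertensC

lemma sum_recip_primes_le {N : ℕ} (hN : 2 ≤ N) :
    ∑ p ∈ (Ico N (N ^ 2)).filter Nat.Prime, (1 : ℝ) / p ≤ recipC := by
  have hN' : (2 : ℝ) ≤ N := by exact_mod_cast hN
  have hl2 : 1 / 2 ≤ log 2 := by linarith [Real.log_two_gt_d9]
  have hl : 1 / 2 ≤ log N := hl2.trans (log_le_log (by norm_num) hN')
  have h1 : ∑ p ∈ (Ico N (N ^ 2)).filter Nat.Prime, (1 : ℝ) / p * log N
      ≤ lamSum ((N ^ 2 : ℕ) : ℝ) := by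
    unfold lamSum
    rw [Nat.floor_natCast]
    refine (sum_le_sum (g := fun p : ℕ => Λ p / p) fun p hp => ?_).trans
      (sum_le_sum_of_subset_of_nonneg ?_ ?_)
    · simp only [mem_filter, mem_Ico] at hp
      rw [ArithmeticFunction.vonMangoldt_apply_prime hp.2, one_div_mul_eq_div]
      have : log (N : ℝ) ≤ log p := log_le_log (by positivity) (by exact_mod_cast hp.1.1)
      gcongr
    · intro p hp
      simp only [mem_filter, mem_Ico, mem_Ioc] at hp ⊢
      exact ⟨hp.2.pos, hp.1.2.le⟩
    · exact fun _ _ _ => div_nonneg ArithmeticFunction.vonMangoldt_nonneg (Nat.cast_nonneg _)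
  have h2 := (abs_le.1 (abs_lamSum_sub_log_le (x := ((N ^ 2 : ℕ) : ℝ))
    (by push_cast; nlinarith))).2
  have h3 : log ((N ^ 2 : ℕ) : ℝ) = 2 * log N := by push_cast; rw [log_pow]; norm_num
  rw [← sum_mul] at h1
  rw [h3] at h2
  have h4 := mertensC_pos
  have : (∑ p ∈ (Ico N (N ^ 2)).filter Nat.Prime, (1 : ℝ) / p) * log N ≤ recipC * log N := by
    unfold recipC
    nlinarith
  exact le_of_mul_le_mul_right this (by linarith)

/-- `n` has no prime factor below `y`. -/
def Rough (y n : ℕ) : Prop := ∀ p, p.Prime → p < y → ¬ p ∣ n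

noncomputable instance (y : ℕ) : DecidablePred (Rough y) := Classical.decPred _

lemma Rough.of_dvd {y n d : ℕ} (h : Rough y n) (hd : d ∣ n) : Rough y d :=
  fun p hp hpy hpd => h p hp hpy (hpd.trans hd)

lemma Rough.mul_iff {y m n : ℕ} : Rough y (m * n) ↔ Rough y m ∧ Rough y n := by
  constructor
  · exact fun h => ⟨h.of_dvd (dvd_mul_right _ _), h.of_dvd (dvd_mul_left _ _)⟩
  · rintro ⟨h1, h2⟩ p hp hpy hd
    rcases hp.dvd_mul.1 hd with h | h
    · exact h1 p hp hpy h
    · exact h2 p hp hpy h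

/-- Sums of `Λ(n) g(n)` over `n` with a small prime factor are controlled by prime powers. -/
lemma sum_vonMangoldt_not_rough_le (y N K : ℕ) (hK : N < 2 ^ (K + 1)) (g : ℕ → ℝ)
    (hg : ∀ n, 0 ≤ g n) :
    ∑ n ∈ (Ioc 0 N).filter (fun n => ¬ Rough y n), Λ n * g n ≤
      ∑ p ∈ (range y).filter Nat.Prime, ∑ k ∈ Icc 1 K,
        if p ^ k ≤ N then log p * g (p ^ k) else 0 := by
  rw [← sum_product', ← sum_filter]
  have hsub : ∑ n ∈ (Ioc 0 N).filter (fun n => ¬ Rough y n), Λ n * g n =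
      ∑ n ∈ ((Ioc 0 N).filter (fun n => ¬ Rough y n)).filter IsPrimePow, Λ n * g n := by
    symm
    apply sum_filter_of_ne
    intro n _ hn
    exact ArithmeticFunction.vonMangoldt_ne_zero_iff.1 (left_ne_zero_of_mul hn)
  rw [hsub]
  set T := ((range y).filter Nat.Prime ×ˢ Icc 1 K).filter (fun x : ℕ × ℕ => x.1 ^ x.2 ≤ N) with hT
  have himg : ((Ioc 0 N).filter (fun n => ¬ Rough y n)).filter IsPrimePow ⊆
      T.image (fun x : ℕ × ℕ => x.1 ^ x.2) := by
    intro n hn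
    simp only [mem_filter, mem_Ioc] at hn
    obtain ⟨⟨⟨hn0, hnN⟩, hr⟩, hpp⟩ := hn
    obtain ⟨p, k, hp, hk, rfl⟩ := (isPrimePow_nat_iff n).1 hpp
    simp only [Rough, not_forall, not_not] at hr
    obtain ⟨q, hq, hqy, hqd⟩ := hr
    have : q = p := (Nat.prime_dvd_prime_iff_eq hq hp).1 (hq.dvd_of_dvd_pow hqd)
    subst this
    have hkK : k < K + 1 := by
      have : 2 ^ k ≤ q ^ k := Nat.pow_le_pow_left hq.two_le k
      exact (Nat.pow_lt_pow_iff_right (a := 2) (by norm_num)).1 (by omega)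
    refine mem_image.2 ⟨(q, k), ?_, rfl⟩
    simp only [hT, mem_filter, mem_product, mem_range, mem_Icc]
    exact ⟨⟨⟨hqy, hq⟩, hk, by omega⟩, hnN⟩
  have hnn : ∀ n, 0 ≤ Λ n * g n := fun n =>
    mul_nonneg ArithmeticFunction.vonMangoldt_nonneg (hg n)
  refine (sum_le_sum_of_subset_of_nonneg himg fun _ _ _ => hnn _).trans ?_
  refine (sum_image_le_of_nonneg fun _ _ => hnn _).trans (le_of_eq ?_)
  refine sum_congr rfl fun x hx => ?_
  simp only [hT, mem_filter, mem_product, mem_Icc] at hx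
  rw [ArithmeticFunction.vonMangoldt_apply_pow (by omega),
    ArithmeticFunction.vonMangoldt_apply_prime hx.1.1.2]

lemma sum_vonMangoldt_not_rough_le_log {y N : ℕ} (hN : N ≠ 0) (hy : 1 ≤ y) :
    ∑ n ∈ (Ioc 0 N).filter (fun n => ¬ Rough y n), Λ n ≤ 2 * y * log y * log N := by
  have h := sum_vonMangoldt_not_rough_le y N (Nat.log 2 N)
    (Nat.lt_pow_succ_log_self (by norm_num) N) (fun _ => 1) (fun _ => zero_le_one)
  simp only [mul_one] at h
  refine h.trans ?_
  have hK : (Nat.log 2 N : ℝ) ≤ 2 * log N := by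
    have h1 : ((2 : ℝ) ^ (Nat.log 2 N)) ≤ N := by exact_mod_cast Nat.pow_log_le_self 2 hN
    have h2 := log_le_log (by positivity) h1
    rw [log_pow] at h2
    nlinarith [Real.log_two_gt_d9, Nat.cast_nonneg (α := ℝ) (Nat.log 2 N)]
  have hly : 0 ≤ log (y : ℝ) := log_natCast_nonneg y
  calc _ ≤ ∑ p ∈ (range y).filter Nat.Prime, ∑ k ∈ Icc 1 (Nat.log 2 N), log (y : ℝ) := by
        refine sum_le_sum fun p hp => sum_le_sum fun k _ => ?_
        simp only [mem_filter, mem_range] at hp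
        split_ifs
        · exact log_le_log (by exact_mod_cast hp.2.pos) (by exact_mod_cast hp.1.le)
        · exact hly
    _ = ((range y).filter Nat.Prime).card * (Nat.log 2 N * log y) := by simp
    _ ≤ y * (2 * log N * log y) := by
        have : (((range y).filter Nat.Prime).card : ℝ) ≤ y := by
          exact_mod_cast (card_filter_le _ _).trans (card_range y).le
        gcongr
    _ = _ := by ring

lemma sum_vonMangoldt_div_not_rough_le {y N : ℕ} (hy : 1 ≤ y) :
    ∑ n ∈ (Ioc 0 N).filter (fun n => ¬ Rough y n), Λ n / n ≤ 2 * (log y + mertensC) := by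
  have h := sum_vonMangoldt_not_rough_le y N (Nat.log 2 N)
    (Nat.lt_pow_succ_log_self (by norm_num) N) (fun n => 1 / (n : ℝ))
    (fun n => by positivity)
  simp only [mul_one_div] at h
  refine h.trans ?_
  have hm := (abs_le.1 (abs_lamSum_sub_log_le (x := (y : ℝ)) (by exact_mod_cast hy))).2
  have hle : ∑ p ∈ (range y).filter Nat.Prime, log p / p ≤ lamSum y := by
    unfold lamSum
    rw [Nat.floor_natCast]
    refine (sum_le_sum (g := fun p : ℕ => Λ p / p) fun p hp => ?_).trans
      (sum_le_sum_of_subset_of_nonneg ?_ ?_)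
    · simp only [mem_filter] at hp
      rw [ArithmeticFunction.vonMangoldt_apply_prime hp.2]
    · intro p hp
      simp only [mem_filter, mem_range, mem_Ioc] at hp ⊢
      exact ⟨hp.2.pos, hp.1.le⟩
    · exact fun _ _ _ => div_nonneg ArithmeticFunction.vonMangoldt_nonneg (Nat.cast_nonneg _)
  have : ∑ p ∈ (range y).filter Nat.Prime, ∑ k ∈ Icc 1 (Nat.log 2 N),
        (if p ^ k ≤ N then log p / ((p ^ k : ℕ) : ℝ) else 0) ≤
      ∑ p ∈ (range y).filter Nat.Prime, 2 * (log p / p) := by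
    refine sum_le_sum fun p hp => ?_
    simp only [mem_filter, mem_range] at hp
    have hp2 : (2 : ℝ) ≤ p := by exact_mod_cast hp.2.two_le
    have hlp : 0 ≤ log (p : ℝ) := log_natCast_nonneg p
    have key : ∀ K : ℕ, ∑ k ∈ Icc 1 K, log p / ((p ^ k : ℕ) : ℝ) ≤
        2 * (log p / p) - 2 * (log p / p) * (1 / 2) ^ K := by
      intro K
      induction K with
      | zero => simp
      | succ K ih =>
        rw [sum_Icc_succ_top (by omega)]
        have : log p / ((p ^ (K + 1) : ℕ) : ℝ) ≤ log p / p * (1 / 2) ^ K := by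
          push_cast
          rw [pow_succ, mul_comm, ← div_div, div_eq_mul_inv (log (p : ℝ) / p), one_div, inv_pow]
          gcongr
        have hps : ((1 : ℝ) / 2) ^ (K + 1) = (1 / 2) ^ K * (1 / 2) := pow_succ _ _
        rw [hps]
        linarith
    refine (sum_le_sum (g := fun k => log p / ((p ^ k : ℕ) : ℝ)) fun k _ => ?_).trans
      ((key _).trans ?_)
    · split_ifs
      · exact le_rfl
      · positivity
    · have : 0 ≤ 2 * (log p / p) * (1 / 2 : ℝ) ^ (Nat.log 2 N) := by positivity
      linarith
  refine this.trans ?_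
  rw [← mul_sum]
  linarith

/-- The multiplicative function `n ↦ 1 / n`. -/
noncomputable def recipHom : ℕ →* ℝ where
  toFun n := 1 / (n : ℝ)
  map_one' := by simp
  map_mul' a b := by push_cast; rw [one_div_mul_one_div]

lemma log_le_prod_primesBelow (N : ℕ) (hN : N ≠ 0) :
    log N ≤ ∏ p ∈ N.primesBelow, (1 - 1 / (p : ℝ))⁻¹ := by
  obtain ⟨M, rfl⟩ := Nat.exists_eq_succ_of_ne_zero hN
  have h := EulerProduct.summable_and_hasSum_smoothNumbers_prod_primesBelow_geometric
    (f := recipHom) (fun {p} hp => by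
      have : (1 : ℝ) < p := by exact_mod_cast hp.one_lt
      simp only [recipHom, MonoidHom.coe_mk, OneHom.coe_mk, norm_div, norm_one,
        RCLike.norm_natCast]
      rw [div_lt_one (by linarith)]
      exact this) (M + 1)
  have hS : (harmonic M : ℝ) = ∑ n ∈ (Ioc 0 M).attach, recipHom n := by
    rw [sum_attach (Ioc 0 M) (fun n => recipHom n), harmonic_eq_sum_Icc]
    push_cast
    refine sum_congr rfl fun i _ => ?_
    simp [recipHom]
  refine (log_add_one_le_harmonic M).trans ?_ |>.trans' (by push_cast; rfl)
  rw [hS]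
  have hm : ∀ n ∈ Ioc 0 M, n ∈ (M + 1).smoothNumbers := fun n hn =>
    Nat.mem_smoothNumbers_of_lt (mem_Ioc.1 hn).1 (by have := (mem_Ioc.1 hn).2; omega)
  have := sum_le_hasSum ((Ioc 0 M).attach.map ⟨fun n => (⟨n.1, hm _ n.2⟩ : (M+1).smoothNumbers),
    fun a b hab => Subtype.ext (congrArg (fun z : (M + 1).smoothNumbers => z.1) hab)⟩) (fun i _ => by
      simp only [recipHom, MonoidHom.coe_mk, OneHom.coe_mk]; positivity) h.2
  rw [sum_map] at this
  exact this

lemma Rough.coprime_of_lt {y n d : ℕ} (h : Rough y n) (hd : 0 < d) (hdy : d < y) :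
    Nat.Coprime n d := by
  refine Nat.Coprime.symm (Nat.coprime_of_dvd fun p hp hpd hpn => ?_)
  exact h p hp ((Nat.le_of_dvd hd hpd).trans_lt hdy) hpn

lemma sum_rough_recip_le (y Z : ℕ) (hy : y ≠ 0) :
    (∑ e ∈ (Ioc 0 Z).filter (Rough y), 1 / (e : ℝ)) * log y ≤ 1 + log (Z * y) := by
  obtain ⟨M, rfl⟩ := Nat.exists_eq_succ_of_ne_zero hy
  have h1 : log ((M + 1 : ℕ) : ℝ) ≤ ∑ s ∈ Ioc 0 M, 1 / (s : ℝ) := by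
    have := log_add_one_le_harmonic M
    rw [harmonic_eq_sum_Icc] at this
    push_cast at this ⊢
    refine this.trans (le_of_eq (sum_congr rfl fun i _ => by simp))
  have h2 : ∑ n ∈ Ioc 0 (Z * (M + 1)), 1 / (n : ℝ) ≤ 1 + log (Z * (M + 1 : ℕ)) := by
    have := harmonic_le_one_add_log (Z * (M + 1))
    rw [harmonic_eq_sum_Icc] at this
    push_cast at this ⊢
    refine this.trans' (le_of_eq (sum_congr rfl fun i _ => by simp))
  refine (mul_le_mul_of_nonneg_left h1 (sum_nonneg fun _ _ => by positivity)).trans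
    (le_trans ?_ h2)
  rw [sum_mul_sum, ← sum_product']
  have hinj : Set.InjOn (fun x : ℕ × ℕ => x.1 * x.2)
      ((Ioc 0 Z).filter (Rough (M + 1)) ×ˢ Ioc 0 M : Finset (ℕ × ℕ)) := by
    have key : ∀ a b c d : ℕ, Rough (M + 1) a → 0 < d → d ≤ M → a * b = c * d → a ∣ c := by
      intro a b c d ha hd hdM h
      refine (ha.coprime_of_lt hd (by omega)).dvd_of_dvd_mul_right (h ▸ dvd_mul_right a b)
    rintro ⟨a, b⟩ hab ⟨c, d⟩ hcd h
    simp only [coe_product, coe_filter, Set.mem_prod, Set.mem_ofPred_eq, mem_Ioc, coe_Ioc,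
      Set.mem_Ioc] at hab hcd h
    have hac : a = c := Nat.dvd_antisymm
      (key a b c d hab.1.2 hcd.2.1 hcd.2.2 h)
      (key c d a b hcd.1.2 hab.2.1 hab.2.2 h.symm)
    subst hac
    have := Nat.eq_of_mul_eq_mul_left hab.1.1.1 h
    rw [this]
  calc _ = ∑ x ∈ ((Ioc 0 Z).filter (Rough (M + 1)) ×ˢ Ioc 0 M).image
        (fun x : ℕ × ℕ => x.1 * x.2), 1 / (x : ℝ) := by
        rw [sum_image hinj]
        refine sum_congr rfl fun x _ => ?_
        push_cast; rw [one_div_mul_one_div]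
    _ ≤ _ := by
        refine sum_le_sum_of_subset_of_nonneg ?_ fun _ _ _ => by positivity
        intro n hn
        simp only [mem_image, mem_product, mem_filter, mem_Ioc, Prod.exists] at hn ⊢
        obtain ⟨a, b, ⟨⟨⟨ha, haZ⟩, -⟩, hb, hbM⟩, rfl⟩ := hn
        exact ⟨by positivity, Nat.mul_le_mul haZ (by omega)⟩

/-- Selberg's function `Λ₂ = Λ log + Λ * Λ`. -/
noncomputable def lam2 : ArithmeticFunction ℝ :=
  ArithmeticFunction.pmul Λ ArithmeticFunction.log + Λ * Λ

lemma lam2_apply (n : ℕ) :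
    lam2 n = Λ n * log n + ∑ x ∈ n.divisorsAntidiagonal, Λ x.1 * Λ x.2 := by
  simp [lam2, ArithmeticFunction.mul_apply]

lemma lam2_nonneg (n : ℕ) : 0 ≤ lam2 n := by
  rw [lam2_apply]
  exact add_nonneg (mul_nonneg ArithmeticFunction.vonMangoldt_nonneg (log_natCast_nonneg n))
    (sum_nonneg fun _ _ => mul_nonneg ArithmeticFunction.vonMangoldt_nonneg
      ArithmeticFunction.vonMangoldt_nonneg)

lemma vonMangoldt_mul_log_le_lam2 (n : ℕ) : Λ n * log n ≤ lam2 n := by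
  rw [lam2_apply]
  exact le_add_of_nonneg_right
    (sum_nonneg fun _ _ => mul_nonneg ArithmeticFunction.vonMangoldt_nonneg
      ArithmeticFunction.vonMangoldt_nonneg)

lemma lam2_mul_zeta :
    lam2 * (ζ : ArithmeticFunction ℝ) = ArithmeticFunction.pmul ArithmeticFunction.log
      ArithmeticFunction.log := by
  rw [lam2, add_mul, mul_assoc, ArithmeticFunction.vonMangoldt_mul_zeta]
  ext n
  rw [ArithmeticFunction.add_apply, ArithmeticFunction.mul_apply, ArithmeticFunction.mul_apply,
    ← sum_add_distrib, ArithmeticFunction.pmul_apply]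
  have : ∀ x ∈ n.divisorsAntidiagonal,
      (ArithmeticFunction.pmul Λ ArithmeticFunction.log) x.1 * (ζ : ArithmeticFunction ℝ) x.2 +
        Λ x.1 * ArithmeticFunction.log x.2 = Λ x.1 * log n := by
    intro x hx
    obtain ⟨h1, h2⟩ := Nat.mem_divisorsAntidiagonal.1 hx
    have hx1 : x.1 ≠ 0 := by rintro h; simp [h] at h1; omega
    have hx2 : x.2 ≠ 0 := by rintro h; simp [h] at h1; omega
    rw [← h1]
    push_cast
    rw [log_mul (by positivity) (by positivity)]
    simp [ArithmeticFunction.natCoe_apply, ArithmeticFunction.zeta_apply, hx2]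
    ring
  rw [sum_congr rfl this, Nat.sum_divisorsAntidiagonal (fun i _ => Λ i * log n), ← sum_mul,
    ArithmeticFunction.vonMangoldt_sum]
  simp

lemma moebius_sum_log_sq {n : ℕ} (L : ℝ) (hn : 1 < n) :
    ∑ d ∈ n.divisors, (μ d : ℝ) * (L - log d) ^ 2 =
      lam2 n + 2 * (L - log n) * Λ n := by
  have h1 : ∑ x ∈ n.divisorsAntidiagonal, (μ x.1 : ℝ) * log x.2 ^ 2 = lam2 n := by
    have : lam2 = (μ : ArithmeticFunction ℝ) *
        ArithmeticFunction.pmul ArithmeticFunction.log ArithmeticFunction.log := by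
      rw [← lam2_mul_zeta, mul_comm lam2, ← mul_assoc, ArithmeticFunction.coe_moebius_mul_coe_zeta,
        one_mul]
    rw [this, ArithmeticFunction.mul_apply]
    refine sum_congr rfl fun x _ => ?_
    simp [ArithmeticFunction.intCoe_apply, sq]
  have h2 : ∑ x ∈ n.divisorsAntidiagonal, (μ x.1 : ℝ) * log x.2 = Λ n := by
    rw [← ArithmeticFunction.moebius_mul_log_eq_vonMangoldt, ArithmeticFunction.mul_apply]
    refine sum_congr rfl fun x _ => ?_
    simp [ArithmeticFunction.intCoe_apply]
  have h3 : ∑ x ∈ n.divisorsAntidiagonal, (μ x.1 : ℝ) = 0 := by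
    have := congrArg (fun f : ArithmeticFunction ℝ => f n)
      (ArithmeticFunction.coe_moebius_mul_coe_zeta (R := ℝ))
    simp only [ArithmeticFunction.mul_apply, ArithmeticFunction.one_apply, hn.ne', if_false] at this
    rw [← this]
    refine sum_congr rfl fun x hx => ?_
    obtain ⟨h1, h2⟩ := Nat.mem_divisorsAntidiagonal.1 hx
    have hx2 : x.2 ≠ 0 := by rintro h; simp [h] at h1; omega
    simp [ArithmeticFunction.natCoe_apply, ArithmeticFunction.zeta_apply, hx2,
      ArithmeticFunction.intCoe_apply]
  rw [← Nat.sum_divisorsAntidiagonal (fun d _ => (μ d : ℝ) * (L - log d) ^ 2)]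
  have : ∀ x ∈ n.divisorsAntidiagonal, (μ x.1 : ℝ) * (L - log x.1) ^ 2 =
      (L - log n) ^ 2 * (μ x.1 : ℝ) + 2 * (L - log n) * ((μ x.1 : ℝ) * log x.2)
        + (μ x.1 : ℝ) * log x.2 ^ 2 := by
    intro x hx
    obtain ⟨h1, h2⟩ := Nat.mem_divisorsAntidiagonal.1 hx
    have hx1 : x.1 ≠ 0 := by rintro h; simp [h] at h1; omega
    have hx2 : x.2 ≠ 0 := by rintro h; simp [h] at h1; omega
    rw [← h1]
    push_cast
    rw [log_mul (by positivity) (by positivity)]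
    ring
  rw [sum_congr rfl this, sum_add_distrib, sum_add_distrib, ← mul_sum, ← mul_sum, h1, h2, h3]
  ring

/-- `n ↦ f n / n` as an arithmetic function. -/
noncomputable def divId (f : ArithmeticFunction ℝ) : ArithmeticFunction ℝ := ⟨fun n => f n / n, by simp⟩

lemma divId_apply (f : ArithmeticFunction ℝ) (n : ℕ) : divId f n = f n / n := rfl

lemma divId_mul (f g : ArithmeticFunction ℝ) : divId (f * g) = divId f * divId g := by
  ext n
  simp only [divId_apply, ArithmeticFunction.mul_apply, sum_div]
  refine sum_congr rfl fun x hx => ?_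
  rw [← (Nat.mem_divisorsAntidiagonal.1 hx).1]
  push_cast
  rw [div_mul_div_comm]

/-- `∑_{n ≤ x} (f * Λ)(n) / n`. -/
lemma sum_mul_vonMangoldt_div (f : ArithmeticFunction ℝ) (x : ℝ) :
    ∑ n ∈ Ioc 0 ⌊x⌋₊, (f * Λ) n / n = ∑ d ∈ Ioc 0 ⌊x⌋₊, f d / d * lamSum (x / d) := by
  have := ArithmeticFunction.sum_Ioc_mul_eq_sum_sum (divId f) (divId Λ) ⌊x⌋₊
  rw [← divId_mul] at this
  simp only [divId_apply] at this
  rw [this]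
  refine sum_congr rfl fun d _ => ?_
  rw [lamSum, Nat.floor_div_natCast]

lemma abs_sum_lam2_div_sub_le {X : ℝ} (hX : 1 ≤ X) :
    |∑ n ∈ Ioc 0 ⌊X⌋₊, lam2 n / n - log X ^ 2| ≤ 2 * mertensC * log X + mertensC ^ 2 := by
  have hC := mertensC_pos
  have hm := abs_lamSum_sub_log_le hX
  have hlX : 0 ≤ log X := log_nonneg hX
  have h1 : ∑ n ∈ Ioc 0 ⌊X⌋₊, lam2 n / n =
      ∑ d ∈ Ioc 0 ⌊X⌋₊, Λ d / d * (log d + lamSum (X / d)) := by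
    simp only [lam2, ArithmeticFunction.add_apply, add_div, sum_add_distrib,
      sum_mul_vonMangoldt_div, mul_add]
    congr 1
    refine sum_congr rfl fun d _ => ?_
    simp only [ArithmeticFunction.pmul_apply, ArithmeticFunction.log_apply]
    ring
  have h2 : |∑ n ∈ Ioc 0 ⌊X⌋₊, lam2 n / n - lamSum X * log X| ≤ lamSum X * mertensC := by
    rw [h1, lamSum, sum_mul, sum_mul, ← sum_sub_distrib]
    refine (abs_sum_le_sum_abs _ _).trans (sum_le_sum fun d hd => ?_)
    obtain ⟨hd0, hdX⟩ := mem_Ioc.1 hd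
    have hd0' : (0 : ℝ) < d := by exact_mod_cast hd0
    have hdX' : (d : ℝ) ≤ X := (Nat.le_floor_iff (by linarith)).1 hdX
    have := abs_lamSum_sub_log_le (x := X / d) (by rwa [one_le_div hd0'])
    rw [log_div (by linarith) (by linarith)] at this
    rw [← mul_sub, abs_mul, abs_of_nonneg (div_nonneg ArithmeticFunction.vonMangoldt_nonneg
      hd0'.le)]
    refine mul_le_mul_of_nonneg_left ?_ (div_nonneg ArithmeticFunction.vonMangoldt_nonneg hd0'.le)
    rwa [show log d + lamSum (X / d) - log X = lamSum (X / d) - (log X - log d) by ring]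
  rw [abs_le] at *
  constructor <;> nlinarith

lemma lamSum_sub_le {u x R : ℝ} (hu : 0 < u) (hR : 0 ≤ R) (hx : x ≤ u * exp R) :
    lamSum x - lamSum u ≤ R + 2 * mertensC := by
  have hC := mertensC_pos
  rcases lt_or_ge x 1 with h | h
  · have : lamSum x = 0 := by simp [lamSum, Nat.floor_eq_zero.2 h]
    linarith [lamSum_nonneg u]
  · have h1 := abs_lamSum_sub_log_le h
    have hl : log x ≤ log u + R := by
      rw [show log u + R = log (u * exp R) by rw [log_mul hu.ne' (exp_pos _).ne', log_exp]]
      exact log_le_log (by linarith) hx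
    rw [abs_le] at h1
    rcases lt_or_ge u 1 with h' | h'
    · have := log_nonpos hu.le h'.le
      linarith [lamSum_nonneg u]
    · have h2 := abs_le.1 (abs_lamSum_sub_log_le h')
      linarith

lemma sum_lam2_not_rough_le {u X R : ℝ} {y : ℕ} (hy : 1 ≤ y) (hu : 0 < u) (huX : u ≤ X)
    (hX1 : 1 ≤ X) (hR : 0 ≤ R) (hX : X ≤ u * exp R) :
    ∑ n ∈ (Ioc ⌊u⌋₊ ⌊X⌋₊).filter (fun n => ¬ Rough y n), lam2 n / n ≤
      2 * y * log y * log X ^ 2 / u + 4 * (log y + mertensC) * (R + 2 * mertensC) := by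
  have hnn : ∀ n, 0 ≤ Λ n := fun n => ArithmeticFunction.vonMangoldt_nonneg
  have hXne : ⌊X⌋₊ ≠ 0 := (Nat.floor_pos.2 hX1).ne'
  have hlX : 0 ≤ log X := log_nonneg hX1
  have hly : 0 ≤ log (y : ℝ) := log_natCast_nonneg y
  let f : ArithmeticFunction ℝ := ⟨fun n => if Rough y n then 0 else Λ n, by simp⟩
  have hf : ∀ n, f n = if Rough y n then 0 else Λ n := fun n => rfl
  have hf0 : ∀ n, 0 ≤ f n := fun n => by rw [hf]; split_ifs <;> simp [hnn]
  have hlfl : log (⌊X⌋₊ : ℝ) ≤ log X := log_le_log (by positivity) (Nat.floor_le (by linarith))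
  have hfsum : ∑ d ∈ Ioc 0 ⌊X⌋₊, f d / d ≤ 2 * (log y + mertensC) := by
    refine (le_of_eq ?_).trans (sum_vonMangoldt_div_not_rough_le (N := ⌊X⌋₊) hy)
    rw [sum_filter]
    refine sum_congr rfl fun n _ => ?_
    rw [hf]; split_ifs <;> simp_all
  have hpt : ∀ n ∈ (Ioc ⌊u⌋₊ ⌊X⌋₊).filter (fun n => ¬ Rough y n), lam2 n / n ≤
      Λ n * log X / u + 2 * ((f * Λ) n / n) := by
    intro n hn
    simp only [mem_filter, mem_Ioc] at hn
    obtain ⟨⟨hn1, hn2⟩, hr⟩ := hn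
    have hn1' : u < n := (Nat.floor_lt hu.le).1 hn1
    have hn2' : (n : ℝ) ≤ X := (Nat.le_floor_iff (by linarith)).1 hn2
    have hn0 : (0 : ℝ) < n := by linarith
    rw [lam2_apply, add_div]
    refine add_le_add ?_ ?_
    · have : log (n : ℝ) ≤ log X := log_le_log hn0 hn2'
      have := hnn n
      gcongr
    · rw [← mul_div_assoc]
      refine div_le_div_of_nonneg_right ?_ hn0.le
      have hswap : (f * Λ) n = ∑ x ∈ n.divisorsAntidiagonal, f x.2 * Λ x.1 := by
        conv_lhs => rw [ArithmeticFunction.mul_apply, ← Nat.map_swap_divisorsAntidiagonal, sum_map]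
        rfl
      rw [two_mul]
      nth_rewrite 2 [hswap]
      rw [ArithmeticFunction.mul_apply, ← sum_add_distrib]
      refine sum_le_sum fun x hx => ?_
      obtain ⟨h1, h2⟩ := Nat.mem_divisorsAntidiagonal.1 hx
      rw [hf, hf]
      by_cases hx1 : Rough y x.1
      · by_cases hx2 : Rough y x.2
        · exact absurd (h1 ▸ Rough.mul_iff.2 ⟨hx1, hx2⟩) hr
        · simp [hx1, hx2, mul_comm]
      · have : 0 ≤ (if Rough y x.2 then 0 else Λ x.2) * Λ x.1 :=
          mul_nonneg (by split_ifs <;> simp [hnn]) (hnn _)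
        simp only [hx1, if_false]
        linarith
  refine (sum_le_sum hpt).trans ?_
  rw [sum_add_distrib, ← mul_sum, ← sum_div, ← sum_mul]
  refine add_le_add ?_ ?_
  · have h1 : ∑ n ∈ (Ioc ⌊u⌋₊ ⌊X⌋₊).filter (fun n => ¬ Rough y n), Λ n ≤
        2 * y * log y * log X := by
      refine (sum_le_sum_of_subset_of_nonneg (filter_subset_filter _
        (Ioc_subset_Ioc_left (Nat.zero_le _))) fun _ _ _ => hnn _).trans ?_
      refine (sum_vonMangoldt_not_rough_le_log hXne hy).trans ?_
      gcongr
    calc _ ≤ (2 * y * log y * log X) * log X / u := by gcongr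
      _ = _ := by ring
  · have h2 : ∑ n ∈ (Ioc ⌊u⌋₊ ⌊X⌋₊).filter (fun n => ¬ Rough y n), (f * Λ) n / n ≤
        ∑ n ∈ Ioc ⌊u⌋₊ ⌊X⌋₊, (f * Λ) n / n := by
      refine sum_le_sum_of_subset_of_nonneg (filter_subset _ _) fun n _ _ => ?_
      rw [ArithmeticFunction.mul_apply]
      exact div_nonneg (sum_nonneg fun x _ => mul_nonneg (hf0 _) (hnn _)) (Nat.cast_nonneg _)
    have h3 : ∑ n ∈ Ioc ⌊u⌋₊ ⌊X⌋₊, (f * Λ) n / n =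
        ∑ d ∈ Ioc 0 ⌊X⌋₊, f d / d * lamSum (X / d) - ∑ d ∈ Ioc 0 ⌊u⌋₊, f d / d * lamSum (u / d) := by
      rw [← sum_mul_vonMangoldt_div, ← sum_mul_vonMangoldt_div,
        ← sum_Ioc_consecutive _ (Nat.zero_le _) (Nat.floor_mono huX)]
      ring
    have h4 : ∑ d ∈ Ioc 0 ⌊u⌋₊, f d / d * lamSum (u / d) =
        ∑ d ∈ Ioc 0 ⌊X⌋₊, f d / d * lamSum (u / d) := by
      refine sum_subset (Ioc_subset_Ioc_right (Nat.floor_mono huX)) fun d hd hd' => ?_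
      simp only [mem_Ioc] at hd hd'
      have hd0 : (0 : ℝ) < d := by exact_mod_cast hd.1
      have : u < d := (Nat.floor_lt hu.le).1 (by omega)
      have : lamSum (u / d) = 0 := by
        simp [lamSum, Nat.floor_eq_zero.2 ((div_lt_one hd0).2 this)]
      rw [this, mul_zero]
    have h5 : ∑ n ∈ Ioc ⌊u⌋₊ ⌊X⌋₊, (f * Λ) n / n ≤
        (∑ d ∈ Ioc 0 ⌊X⌋₊, f d / d) * (R + 2 * mertensC) := by
      rw [h3, h4, ← sum_sub_distrib, sum_mul]
      refine sum_le_sum fun d hd => ?_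
      have hd0 : (0 : ℝ) < d := by exact_mod_cast (mem_Ioc.1 hd).1
      rw [← mul_sub]
      refine mul_le_mul_of_nonneg_left (lamSum_sub_le (div_pos hu hd0) hR ?_)
        (div_nonneg (hf0 d) hd0.le)
      rw [div_mul_eq_mul_div]
      gcongr
    have h6 := mul_le_mul_of_nonneg_right hfsum (a := R + 2 * mertensC)
      (by linarith [mertensC_pos])
    linarith

/-- Elementary symmetric sums of `x` over a finite set. -/
noncomputable def esym (S : Finset ℕ) (x : ℕ → ℝ) (r : ℕ) : ℝ :=
  ∑ t ∈ S.powersetCard r, ∏ p ∈ t, x p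

/-- Truncated inclusion-exclusion sums. -/
noncomputable def bonf (S : Finset ℕ) (x : ℕ → ℝ) (r : ℕ) : ℝ :=
  ∑ j ∈ range (r + 1), (-1) ^ j * esym S x j

lemma esym_zero (S : Finset ℕ) (x : ℕ → ℝ) : esym S x 0 = 1 := by simp [esym]

lemma esym_empty_succ (x : ℕ → ℝ) (r : ℕ) : esym ∅ x (r + 1) = 0 := by
  rw [esym, powersetCard_eq_empty.2 (by simp), sum_empty]

lemma esym_insert {S : Finset ℕ} {q : ℕ} (hq : q ∉ S) (x : ℕ → ℝ) (r : ℕ) :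
    esym (insert q S) x (r + 1) = esym S x (r + 1) + x q * esym S x r := by
  unfold esym
  rw [powersetCard_succ_insert hq, sum_union, sum_image, mul_sum]
  · congr 1
    refine sum_congr rfl fun t ht => prod_insert fun h => hq ((mem_powersetCard.1 ht).1 h)
  · intro a ha b hb hab
    have ha' : q ∉ a := fun h => hq ((mem_powersetCard.1 ha).1 h)
    have hb' : q ∉ b := fun h => hq ((mem_powersetCard.1 hb).1 h)
    rw [← erase_insert ha', ← erase_insert hb', hab]
  · rw [disjoint_left]
    intro a ha hb
    obtain ⟨b, -, rfl⟩ := mem_image.1 hb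
    exact hq ((mem_powersetCard.1 ha).1 (mem_insert_self q b))

lemma esym_nonneg {S : Finset ℕ} {x : ℕ → ℝ} (hx : ∀ p ∈ S, 0 ≤ x p) (r : ℕ) :
    0 ≤ esym S x r :=
  sum_nonneg fun _ ht => prod_nonneg fun p hp => hx p ((mem_powersetCard.1 ht).1 hp)

lemma bonf_insert_succ {S : Finset ℕ} {q : ℕ} (hq : q ∉ S) (x : ℕ → ℝ) (r : ℕ) :
    bonf (insert q S) x (r + 1) = bonf S x (r + 1) - x q * bonf S x r := by
  unfold bonf
  rw [sum_range_succ', sum_range_succ' (n := r + 1) (f := fun j => (-1) ^ j * esym S x j), mul_sum]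
  simp only [esym_zero, esym_insert hq, mul_add, sum_add_distrib]
  have : ∑ j ∈ range (r + 1), (-1 : ℝ) ^ (j + 1) * (x q * esym S x j) =
      - ∑ j ∈ range (r + 1), x q * ((-1) ^ j * esym S x j) := by
    rw [← sum_neg_distrib]
    exact sum_congr rfl fun j _ => by ring
  rw [this]
  ring

/-- The Bonferroni inequalities, for numbers in `[0, 1]`. -/
lemma bonf_bounds (S : Finset ℕ) (x : ℕ → ℝ) (hx : ∀ p ∈ S, 0 ≤ x p ∧ x p ≤ 1) (r : ℕ) :
    0 ≤ (-1) ^ r * (bonf S x r - ∏ p ∈ S, (1 - x p)) ∧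
      (-1) ^ r * (bonf S x r - ∏ p ∈ S, (1 - x p)) ≤ esym S x (r + 1) := by
  induction S using Finset.induction_on generalizing r with
  | empty =>
    have hb : bonf ∅ x r = 1 := by
      unfold bonf
      rw [sum_range_succ']
      simp [esym_zero, esym_empty_succ]
    simp [hb, esym_nonneg]
  | insert q S hq ih =>
    have hxS : ∀ p ∈ S, 0 ≤ x p ∧ x p ≤ 1 := fun p hp => hx p (mem_insert_of_mem hp)
    have hxq := hx q (mem_insert_self q S)
    have ih := ih hxS
    have hV0 : 0 ≤ ∏ p ∈ S, (1 - x p) := prod_nonneg fun p hp => by linarith [(hxS p hp).2]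
    have hV1 : ∏ p ∈ S, (1 - x p) ≤ 1 :=
      prod_le_one (fun p hp => by linarith [(hxS p hp).2]) fun p hp => by linarith [(hxS p hp).1]
    rw [prod_insert hq, esym_insert hq]
    cases r with
    | zero =>
      have h0 := ih 0
      have hb : ∀ S, bonf S x 0 = 1 := by simp [bonf, esym]
      simp only [hb, pow_zero, one_mul, esym_zero, zero_add] at h0 ⊢
      constructor <;> nlinarith [h0.1, h0.2]
    | succ r =>
      rw [bonf_insert_succ hq]
      have h1 := ih (r + 1)
      have h2 := ih r
      have e : (-1) ^ (r + 1) * (bonf S x (r + 1) - x q * bonf S x r -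
          (1 - x q) * ∏ p ∈ S, (1 - x p)) = (-1) ^ (r + 1) * (bonf S x (r + 1) -
          ∏ p ∈ S, (1 - x p)) + x q * ((-1) ^ r * (bonf S x r - ∏ p ∈ S, (1 - x p))) := by
        ring
      rw [e]
      exact ⟨add_nonneg h1.1 (mul_nonneg hxq.1 h2.1),
        add_le_add h1.2 (mul_le_mul_of_nonneg_left h2.2 hxq.1)⟩

lemma esym_le_pow_div_factorial (S : Finset ℕ) (x : ℕ → ℝ) (hx : ∀ p ∈ S, 0 ≤ x p) (r : ℕ) :
    esym S x r ≤ (∑ p ∈ S, x p) ^ r / r.factorial := by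
  induction S using Finset.induction_on generalizing r with
  | empty =>
    cases r with
    | zero => simp [esym]
    | succ r => simp [esym_empty_succ]
  | insert q S hq ih =>
    have hxS : ∀ p ∈ S, 0 ≤ x p := fun p hp => hx p (mem_insert_of_mem hp)
    have hxq := hx q (mem_insert_self q S)
    have ih := ih hxS
    cases r with
    | zero => simp [esym]
    | succ r =>
      rw [esym_insert hq, sum_insert hq]
      set s := ∑ p ∈ S, x p with hs
      have hs0 : 0 ≤ s := sum_nonneg hxS
      have h1 := ih (r + 1)
      have h2 := mul_le_mul_of_nonneg_left (ih r) hxq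
      have key : ∀ n : ℕ, s ^ (n + 1) + (n + 1) * (x q * s ^ n) ≤ (x q + s) ^ (n + 1) := by
        intro n
        induction n with
        | zero => simp [add_comm]
        | succ n ihn =>
          have h3 := mul_le_mul_of_nonneg_left ihn (add_nonneg hxq hs0)
          have h4 : 0 ≤ (n + 1) * (x q * x q * s ^ n) := by positivity
          rw [pow_succ' (x q + s)]
          refine le_trans ?_ h3
          push_cast
          have e1 : s ^ (n + 1 + 1) = s * (s * s ^ n) := by ring
          have e2 : s ^ (n + 1) = s * s ^ n := by ring
          rw [e1, e2]
          nlinarith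
      have hf : (((r + 1).factorial : ℕ) : ℝ) = (r + 1) * r.factorial := by
        rw [Nat.factorial_succ]; push_cast; ring
      have hf0 : (0 : ℝ) < r.factorial := by positivity
      have : s ^ (r + 1) / (r + 1).factorial + x q * (s ^ r / r.factorial) =
          (s ^ (r + 1) + (r + 1) * (x q * s ^ r)) / (r + 1).factorial := by
        rw [hf]; field_simp
      calc _ ≤ s ^ (r + 1) / (r + 1).factorial + x q * (s ^ r / r.factorial) := add_le_add h1 h2
        _ ≤ _ := by rw [this]; gcongr; exact key r

/-- The indicator of divisibility. -/
noncomputable def ind (n p : ℕ) : ℝ := if p ∣ n then 1 else 0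

lemma ind_mem (n p : ℕ) : 0 ≤ ind n p ∧ ind n p ≤ 1 := by
  unfold ind; split_ifs <;> norm_num

lemma prod_ind {S : Finset ℕ} (hS : ∀ p ∈ S, p.Prime) (n : ℕ) :
    ∏ p ∈ S, ind n p = if (∏ p ∈ S, p) ∣ n then 1 else 0 := by
  unfold ind
  rw [Finset.prod_ite_zero]
  have : (∀ p ∈ S, p ∣ n) ↔ (∏ p ∈ S, p) ∣ n :=
    ⟨fun h => Finset.prod_primes_dvd n (fun p hp => (hS p hp).prime) h,
      fun h p hp => (Finset.dvd_prod_of_mem (fun p => p) hp).trans h⟩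
  simp [this]

lemma abs_sum_dvd_sub_le {d : ℕ} (hd : 0 < d) {u v : ℝ} (hu : 0 ≤ u) (huv : u ≤ v) :
    |∑ n ∈ Ioc ⌊u⌋₊ ⌊v⌋₊, (if d ∣ n then (1 : ℝ) else 0) - (v - u) * (1 / d)| ≤ 1 := by
  have hd' : (0 : ℝ) < d := by exact_mod_cast hd
  have h : ∀ w : ℝ, ∑ n ∈ Ioc 0 ⌊w⌋₊, (if d ∣ n then (1 : ℝ) else 0) = ⌊w / d⌋₊ := by
    intro w
    rw [Nat.floor_div_natCast, ← sum_filter, sum_const, Nat.Ioc_filter_dvd_card_eq_div]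
    simp
  have h2 : ∑ n ∈ Ioc ⌊u⌋₊ ⌊v⌋₊, (if d ∣ n then (1 : ℝ) else 0) = ⌊v / d⌋₊ - ⌊u / d⌋₊ := by
    rw [← h, ← h, ← sum_Ioc_consecutive _ (Nat.zero_le _) (Nat.floor_mono huv)]
    ring
  have a1 := Nat.floor_le (div_nonneg hu hd'.le)
  have a2 := Nat.lt_floor_add_one (u / d)
  have a3 := Nat.floor_le (div_nonneg (hu.trans huv) hd'.le)
  have a4 := Nat.lt_floor_add_one (v / d)
  rw [h2, abs_le, mul_one_div, sub_div]
  constructor <;> linarith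

/-- Interval sums of products of block sums of divisibility indicators. -/
lemma abs_sum_prod_block_le {ι : Type*} [Fintype ι] [DecidableEq ι] (P : ι → Finset ℕ)
    (hP : ∀ i, ∀ p ∈ P i, p.Prime) (hdisj : ∀ i j, i ≠ j → Disjoint (P i) (P j))
    (T : ι → Finset (Finset ℕ)) (hT : ∀ i, ∀ t ∈ T i, t ⊆ P i) (c : ι → Finset ℕ → ℝ)
    (hc : ∀ i t, |c i t| ≤ 1) {u v : ℝ} (hu : 0 ≤ u) (huv : u ≤ v) :
    |∑ n ∈ Ioc ⌊u⌋₊ ⌊v⌋₊, ∏ i, ∑ t ∈ T i, c i t * ∏ p ∈ t, ind n p -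
      (v - u) * ∏ i, ∑ t ∈ T i, c i t * ∏ p ∈ t, (1 / (p : ℝ))| ≤ ∏ i, ((T i).card : ℝ) := by
  simp only [Finset.prod_univ_sum, prod_mul_distrib]
  rw [sum_comm, mul_sum, ← sum_sub_distrib]
  have hcard : ∏ i, ((T i).card : ℝ) = ∑ τ ∈ Fintype.piFinset T, (1 : ℝ) := by
    simp [Fintype.card_piFinset]
  rw [hcard]
  refine (abs_sum_le_sum_abs _ _).trans (sum_le_sum fun τ hτ => ?_)
  rw [Fintype.mem_piFinset] at hτ
  have hd : ∀ f : ℕ → ℝ, ∏ i, ∏ p ∈ τ i, f p = ∏ p ∈ univ.biUnion τ, f p := by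
    intro f
    rw [prod_biUnion]
    intro i _ j _ hij
    exact (hdisj i j hij).mono (hT i _ (hτ i)) (hT j _ (hτ j))
  have hpr : ∀ p ∈ univ.biUnion τ, p.Prime := by
    intro p hp
    obtain ⟨i, -, hi⟩ := mem_biUnion.1 hp
    exact hP i p (hT i _ (hτ i) hi)
  have hpos : 0 < ∏ p ∈ univ.biUnion τ, p := prod_pos fun p hp => (hpr p hp).pos
  simp only [hd, prod_ind hpr]
  have hmean : ∏ p ∈ univ.biUnion τ, (1 / (p : ℝ)) = 1 / ((∏ p ∈ univ.biUnion τ, p : ℕ) : ℝ) := by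
    push_cast; simp
  rw [hmean, ← mul_sum, mul_left_comm, ← mul_sub, abs_mul]
  refine mul_le_one₀ ?_ (abs_nonneg _) (abs_sum_dvd_sub_le hpos hu huv)
  rw [abs_prod]
  exact prod_le_one (fun _ _ => abs_nonneg _) fun i _ => hc i _

/-- The primes in `[2 ^ 2 ^ i, 2 ^ 2 ^ (i + 1))`. -/
def block (i : ℕ) : Finset ℕ := (Ico (2 ^ 2 ^ i) (2 ^ 2 ^ (i + 1))).filter Nat.Prime

/-- The sets used in a truncated inclusion-exclusion. -/
def smallSubsets (S : Finset ℕ) (r : ℕ) : Finset (Finset ℕ) :=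
  (range (r + 1)).biUnion fun j => S.powersetCard j

lemma bonf_eq_sum (S : Finset ℕ) (x : ℕ → ℝ) (r : ℕ) :
    bonf S x r = ∑ t ∈ smallSubsets S r, (-1 : ℝ) ^ t.card * ∏ p ∈ t, x p := by
  rw [smallSubsets, sum_biUnion, bonf]
  · refine sum_congr rfl fun j _ => ?_
    rw [esym, mul_sum]
    exact sum_congr rfl fun t ht => by rw [(mem_powersetCard.1 ht).2]
  · intro i _ j _ hij
    exact S.pairwise_disjoint_powersetCard hij

lemma card_smallSubsets_le (S : Finset ℕ) (r : ℕ) : (smallSubsets S r).card ≤ (S.card + 1) ^ r := by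
  rw [smallSubsets, card_biUnion (fun i _ j _ hij => S.pairwise_disjoint_powersetCard hij),
    add_pow]
  refine sum_le_sum fun j hj => ?_
  rw [card_powersetCard, one_pow, mul_one]
  refine (Nat.choose_le_pow _ _).trans ?_
  exact Nat.le_mul_of_pos_right _ (Nat.choose_pos (by simp at hj; omega))

lemma card_block_lt (i : ℕ) : (block i).card + 1 ≤ 2 ^ 2 ^ (i + 1) := by
  have h1 : (block i).card ≤ 2 ^ 2 ^ (i + 1) - 2 ^ 2 ^ i :=
    (card_filter_le _ _).trans (Nat.card_Ico _ _).le
  have h2 : 2 ^ 2 ^ i ≤ 2 ^ 2 ^ (i + 1) :=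
    Nat.pow_le_pow_right (by norm_num) (Nat.pow_le_pow_right (by norm_num) (by omega))
  have h3 : 1 ≤ 2 ^ 2 ^ i := Nat.one_le_two_pow
  omega

lemma mem_block {i p : ℕ} : p ∈ block i ↔ (2 ^ 2 ^ i ≤ p ∧ p < 2 ^ 2 ^ (i + 1)) ∧ p.Prime := by
  simp [block]

lemma block_disjoint {i j : ℕ} (h : i ≠ j) : Disjoint (block i) (block j) := by
  have key : ∀ a b : ℕ, a < b → Disjoint (block a) (block b) := by
    intro a b hab
    rw [disjoint_left]
    intro p hp hq
    rw [mem_block] at hp hq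
    have : 2 ^ 2 ^ (a + 1) ≤ 2 ^ 2 ^ b :=
      Nat.pow_le_pow_right (by norm_num) (Nat.pow_le_pow_right (by norm_num) (by omega))
    omega
  rcases lt_or_gt_of_ne h with h | h
  · exact key _ _ h
  · exact (key _ _ h).symm

lemma exists_mem_block {k p : ℕ} (hp : p.Prime) (hpk : p < 2 ^ 2 ^ k) : ∃ i < k, p ∈ block i := by
  induction k with
  | zero => simp at hpk; exact absurd hp.two_le (by omega)
  | succ k ih =>
    rcases lt_or_ge p (2 ^ 2 ^ k) with h | h
    · obtain ⟨i, hi, hm⟩ := ih h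
      exact ⟨i, by omega, hm⟩
    · exact ⟨k, by omega, mem_block.2 ⟨⟨h, hpk⟩, hp⟩⟩

lemma lt_of_mem_block {k i p : ℕ} (hi : i < k) (hp : p ∈ block i) : p < 2 ^ 2 ^ k := by
  have : 2 ^ 2 ^ (i + 1) ≤ 2 ^ 2 ^ k :=
    Nat.pow_le_pow_right (by norm_num) (Nat.pow_le_pow_right (by norm_num) (by omega))
  have := (mem_block.1 hp).1.2
  omega

lemma primesBelow_eq_biUnion (k : ℕ) :
    (2 ^ 2 ^ k).primesBelow = (univ : Finset (Fin k)).biUnion fun i => block i := by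
  ext p
  simp only [Nat.mem_primesBelow, mem_biUnion, mem_univ, true_and]
  constructor
  · rintro ⟨h1, h2⟩
    obtain ⟨i, hi, hm⟩ := exists_mem_block h2 h1
    exact ⟨⟨i, hi⟩, hm⟩
  · rintro ⟨i, hi⟩
    exact ⟨lt_of_mem_block i.2 hi, (mem_block.1 hi).2⟩

lemma sum_block_recip_le (i : ℕ) : ∑ p ∈ block i, 1 / (p : ℝ) ≤ recipC := by
  have := sum_recip_primes_le (N := 2 ^ 2 ^ i)
    (by calc 2 = 2 ^ 2 ^ 0 := by norm_num
          _ ≤ 2 ^ 2 ^ i := Nat.pow_le_pow_right (by norm_num) (Nat.pow_le_pow_right (by norm_num) (by omega)))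
  rwa [← pow_mul, ← pow_succ] at this

/-- The Mertens product over a block. -/
noncomputable def blockV (i : ℕ) : ℝ := ∏ p ∈ block i, (1 - 1 / (p : ℝ))

lemma exp_le_blockV (i : ℕ) : exp (-(2 * recipC)) ≤ blockV i := by
  calc exp (-(2 * recipC)) ≤ exp (∑ p ∈ block i, -(2 * (1 / (p : ℝ)))) := by
        rw [sum_neg_distrib, ← mul_sum]
        have := sum_block_recip_le i
        gcongr
    _ = ∏ p ∈ block i, exp (-(2 * (1 / (p : ℝ)))) := exp_sum _ _
    _ ≤ blockV i := by
        refine prod_le_prod (fun _ _ => (exp_pos _).le) fun p hp => ?_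
        have hp2 : (2 : ℝ) ≤ p := by exact_mod_cast (mem_block.1 hp).2.two_le
        have hx : 1 / (p : ℝ) ≤ 1 / 2 := one_div_le_one_div_of_le (by norm_num) hp2
        have hx0 : 0 < 1 / (p : ℝ) := by positivity
        set x := 1 / (p : ℝ)
        rw [exp_neg]
        refine inv_le_of_inv_le₀ (by linarith) ?_
        have h1 := add_one_le_exp (2 * x)
        refine le_trans ?_ h1
        rw [inv_le_iff_one_le_mul₀ (by linarith)]
        nlinarith

lemma blockV_pos (i : ℕ) : 0 < blockV i := (exp_pos _).trans_le (exp_le_blockV i)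

lemma prod_blockV_le (k : ℕ) :
    ∏ i : Fin k, blockV i ≤ 1 / log ((2 ^ 2 ^ k : ℕ) : ℝ) := by
  have h := log_le_prod_primesBelow (2 ^ 2 ^ k) (by positivity)
  have hl : 0 < log ((2 ^ 2 ^ k : ℕ) : ℝ) := by
    push_cast; rw [log_pow]; push_cast
    have := Real.log_two_gt_d9
    positivity
  rw [primesBelow_eq_biUnion, prod_biUnion, ] at h
  · have e : ∏ x : Fin k, ∏ i ∈ block x, (1 - 1 / (i : ℝ))⁻¹ = (∏ i : Fin k, blockV i)⁻¹ := by
      rw [← prod_inv_distrib]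
      refine prod_congr rfl fun i _ => ?_
      rw [blockV, prod_inv_distrib]
    rw [e] at h
    rw [one_div]
    exact le_inv_of_le_inv₀ hl h
  · intro i _ j _ hij
    exact block_disjoint (fun h => hij (Fin.ext h))

/-- The truncation parameter of a block. -/
def truncP (b k i : ℕ) : ℕ := b + (k - 1 - i)

lemma sum_mul_truncP_le (b k : ℕ) :
    ∑ i : Fin k, 2 ^ ((i : ℕ) + 1) * (2 * truncP b k i + 1) ≤ 2 ^ k * (4 * b + 6) := by
  induction k generalizing b with
  | zero => simp
  | succ k ih =>
    rw [Fin.sum_univ_castSucc]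
    have e : ∀ i : Fin k, 2 ^ (((Fin.castSucc i : Fin (k + 1)) : ℕ) + 1) *
        (2 * truncP b (k + 1) (Fin.castSucc i : Fin (k + 1)) + 1) =
        2 ^ ((i : ℕ) + 1) * (2 * truncP (b + 1) k i + 1) := by
      intro i
      have h : truncP b (k + 1) i = truncP (b + 1) k i := by
        have := i.2
        simp only [truncP]
        omega
      rw [Fin.val_castSucc, h]
    rw [sum_congr rfl fun i _ => e i, Fin.val_last]
    have e2 : truncP b (k + 1) k = b := by simp [truncP]
    rw [e2]
    have := ih (b + 1)
    have h3 : 2 ^ (k + 1) * (4 * b + 6) = 2 ^ k * (4 * (b + 1) + 6) + 2 ^ (k + 1) * (2 * b + 1) := by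
      ring
    omega

lemma prod_pow_truncP_le (b k : ℕ) :
    ∏ i : Fin k, (2 ^ 2 ^ ((i : ℕ) + 1)) ^ (2 * truncP b k i + 1) ≤ (2 ^ 2 ^ k) ^ (4 * b + 6) := by
  simp only [← pow_mul]
  rw [prod_pow_eq_pow_sum]
  exact Nat.pow_le_pow_right (by norm_num) (sum_mul_truncP_le b k)

lemma sum_pow_truncP_le (b k : ℕ) :
    ∑ i : Fin k, (1 / 16 : ℝ) ^ truncP b k i ≤ 2 * (1 / 16) ^ b := by
  have : ∀ b, ∑ i : Fin k, (1 / 16 : ℝ) ^ truncP b k i ≤ 2 * (1 / 16) ^ b := by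
    induction k with
    | zero => intro b; simp
    | succ k ih =>
      intro b
      rw [Fin.sum_univ_castSucc]
      have e : ∀ i : Fin k, truncP b (k + 1) (Fin.castSucc i : Fin (k + 1)) = truncP (b + 1) k i := by
        intro i
        have := i.2
        simp only [truncP, Fin.val_castSucc]
        omega
      simp only [e, Fin.val_last]
      have e2 : truncP b (k + 1) k = b := by simp [truncP]
      rw [e2]
      have := ih (b + 1)
      rw [pow_succ] at this
      have h0 : (0 : ℝ) < (1 / 16) ^ b := by positivity
      linarith
  exact this b

/-- The upper-bound sieve weight. -/
noncomputable def sieveW (b k n : ℕ) : ℝ := ∏ i : Fin k, bonf (block i) (ind n) (2 * truncP b k i)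

/-- The mean value of the block sums. -/
noncomputable def blockM (b k i : ℕ) : ℝ :=
  bonf (block i) (fun p => 1 / (p : ℝ)) (2 * truncP b k i)

lemma recip_mem {i p : ℕ} (hp : p ∈ block i) : 0 ≤ 1 / (p : ℝ) ∧ 1 / (p : ℝ) ≤ 1 := by
  have hp1 : (1 : ℝ) ≤ p := by exact_mod_cast (mem_block.1 hp).2.one_lt.le
  exact ⟨by positivity, (div_le_one (by linarith)).2 hp1⟩

lemma bonf_block_ind_bounds (b k i n : ℕ) :
    0 ≤ bonf (block i) (ind n) (2 * truncP b k i) ∧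
    bonf (block i) (ind n) (2 * truncP b k i) ≤
      ∏ p ∈ block i, (1 - ind n p) + esym (block i) (ind n) (2 * truncP b k i + 1) := by
  have h := bonf_bounds (block i) (ind n) (fun p _ => ind_mem n p) (2 * truncP b k i)
  rw [pow_mul, neg_one_sq, one_pow, one_mul] at h
  have : 0 ≤ ∏ p ∈ block i, (1 - ind n p) :=
    prod_nonneg fun p _ => by linarith [(ind_mem n p).2]
  exact ⟨by linarith [h.1], by linarith [h.2]⟩

lemma blockM_bounds (b k i : ℕ) :
    blockV i ≤ blockM b k i ∧ blockM b k i ≤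
      blockV i + esym (block i) (fun p => 1 / (p : ℝ)) (2 * truncP b k i + 1) := by
  have h := bonf_bounds (block i) (fun p => 1 / (p : ℝ)) (fun p hp => recip_mem hp)
    (2 * truncP b k i)
  rw [pow_mul, neg_one_sq, one_pow, one_mul] at h
  unfold blockM blockV
  exact ⟨by linarith [h.1], by linarith [h.2]⟩

lemma sieveW_nonneg (b k n : ℕ) : 0 ≤ sieveW b k n :=
  prod_nonneg fun _ _ => (bonf_block_ind_bounds _ _ _ _).1

lemma sieveW_rough_mul {b k d : ℕ} (hd : Rough (2 ^ 2 ^ k) d) (n : ℕ) :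
    sieveW b k (d * n) = sieveW b k n := by
  unfold sieveW
  refine prod_congr rfl fun i _ => ?_
  rw [bonf_eq_sum, bonf_eq_sum]
  refine sum_congr rfl fun t ht => ?_
  congr 1
  refine prod_congr rfl fun p hp => ?_
  obtain ⟨j, -, hj⟩ := mem_biUnion.1 ht
  have hpb := (mem_powersetCard.1 hj).1 hp
  have hpp := (mem_block.1 hpb).2
  unfold ind
  have : p ∣ d * n ↔ p ∣ n :=
    ⟨fun h => (hpp.dvd_mul.1 h).resolve_left (hd p hpp (lt_of_mem_block i.2 hpb)),
      fun h => h.mul_left d⟩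
  simp [this]

lemma sieveW_rough {b k n : ℕ} (hn : Rough (2 ^ 2 ^ k) n) : sieveW b k n = 1 := by
  refine prod_eq_one fun i _ => ?_
  have h0 : ∀ p ∈ block i, ind n p = 0 := fun p hp => by
    have := hn p (mem_block.1 hp).2 (lt_of_mem_block i.2 hp)
    simp [ind, this]
  have h1 : ∀ j, esym (block i) (ind n) (j + 1) = 0 := by
    intro j
    refine sum_eq_zero fun t ht => ?_
    obtain ⟨hts, htc⟩ := mem_powersetCard.1 ht
    obtain ⟨p, hp⟩ := card_pos.1 (by omega : 0 < t.card)
    exact prod_eq_zero hp (h0 p (hts hp))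
  rw [bonf, sum_range_succ']
  simp [h1, esym_zero]

/-- The part of the sieve weight in which block `i` overflows. -/
noncomputable def overW (b k : ℕ) (i : Fin k) (n : ℕ) : ℝ :=
  esym (block i) (ind n) (2 * truncP b k i + 1) *
    ∏ j ∈ univ.erase i, bonf (block j) (ind n) (2 * truncP b k j)

lemma overW_nonneg (b k : ℕ) (i : Fin k) (n : ℕ) : 0 ≤ overW b k i n :=
  mul_nonneg (esym_nonneg (fun p _ => (ind_mem n p).1) _)
    (prod_nonneg fun _ _ => (bonf_block_ind_bounds _ _ _ _).1)

lemma sieveW_sub_le (b k n : ℕ) :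
    sieveW b k n - (if Rough (2 ^ 2 ^ k) n then 1 else 0) ≤ ∑ i, overW b k i n := by
  split_ifs with h
  · rw [sieveW_rough h, sub_self]
    exact sum_nonneg fun i _ => overW_nonneg b k i n
  · simp only [Rough, not_forall, not_not] at h
    obtain ⟨p, hp, hpk, hpn⟩ := h
    obtain ⟨i, hi, hm⟩ := exists_mem_block hp hpk
    rw [sub_zero]
    refine le_trans ?_ (single_le_sum (fun i _ => overW_nonneg b k i n) (mem_univ ⟨i, hi⟩))
    rw [sieveW, ← mul_prod_erase univ _ (mem_univ (⟨i, hi⟩ : Fin k)), overW]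
    refine mul_le_mul_of_nonneg_right ?_ (prod_nonneg fun _ _ => (bonf_block_ind_bounds _ _ _ _).1)
    have h1 := (bonf_block_ind_bounds b k i n).2
    rw [prod_eq_zero hm (by simp [ind, hpn]), zero_add] at h1
    exact h1

lemma prod_card_le (b k : ℕ) (c : Fin k → ℕ)
    (hc : ∀ i, c i ≤ (2 ^ 2 ^ ((i : ℕ) + 1)) ^ (2 * truncP b k i + 1)) :
    ∏ i, (c i : ℝ) ≤ ((2 ^ 2 ^ k : ℕ) : ℝ) ^ (4 * b + 6) := by
  exact_mod_cast (prod_le_prod' fun i _ => hc i).trans (prod_pow_truncP_le b k)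

lemma card_smallSubsets_block_le (b k i : ℕ) :
    (smallSubsets (block i) (2 * truncP b k i)).card ≤
      (2 ^ 2 ^ (i + 1)) ^ (2 * truncP b k i + 1) :=
  (card_smallSubsets_le _ _).trans ((Nat.pow_le_pow_left (card_block_lt i) _).trans
    (Nat.pow_le_pow_right (by positivity) (by omega)))

lemma subset_of_mem_smallSubsets {S t : Finset ℕ} {r : ℕ} (h : t ∈ smallSubsets S r) : t ⊆ S := by
  obtain ⟨j, -, hj⟩ := mem_biUnion.1 h
  exact (mem_powersetCard.1 hj).1

lemma abs_sum_sieveW_sub_le (b k : ℕ) {u v : ℝ} (hu : 0 ≤ u) (huv : u ≤ v) :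
    |∑ n ∈ Ioc ⌊u⌋₊ ⌊v⌋₊, sieveW b k n - (v - u) * ∏ i : Fin k, blockM b k i| ≤
      ((2 ^ 2 ^ k : ℕ) : ℝ) ^ (4 * b + 6) := by
  simp only [sieveW, blockM, bonf_eq_sum]
  refine (abs_sum_prod_block_le (fun i : Fin k => block i) (fun i p hp => (mem_block.1 hp).2)
    (fun i j hij => block_disjoint fun h => hij (Fin.ext h))
    (fun i => smallSubsets (block i) (2 * truncP b k i)) (fun i t ht => subset_of_mem_smallSubsets ht)
    (fun i t => (-1) ^ t.card) (fun i t => by simp) hu huv).trans ?_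
  exact prod_card_le b k _ fun i => card_smallSubsets_block_le b k i

lemma sum_overW_le (b k : ℕ) (i : Fin k) {u v : ℝ} (hu : 0 ≤ u) (huv : u ≤ v) :
    ∑ n ∈ Ioc ⌊u⌋₊ ⌊v⌋₊, overW b k i n ≤
      (v - u) * (esym (block i) (fun p => 1 / (p : ℝ)) (2 * truncP b k i + 1) *
        ∏ j ∈ univ.erase i, blockM b k j) + ((2 ^ 2 ^ k : ℕ) : ℝ) ^ (4 * b + 6) := by
  have h := abs_sum_prod_block_le (fun i : Fin k => block i) (fun i p hp => (mem_block.1 hp).2)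
    (fun i j hij => block_disjoint fun h => hij (Fin.ext h))
    (fun j => if j = i then (block j).powersetCard (2 * truncP b k j + 1) else
      smallSubsets (block j) (2 * truncP b k j))
    (fun j t ht => by
      split_ifs at ht with hji
      · exact (mem_powersetCard.1 ht).1
      · exact subset_of_mem_smallSubsets ht)
    (fun j t => if j = i then 1 else (-1) ^ t.card) (fun j t => by split_ifs <;> simp) hu huv
  have hx : ∀ x : ℕ → ℝ, ∏ j : Fin k, ∑ t ∈ (if j = i then (block j).powersetCard (2 * truncP b k j + 1)
      else smallSubsets (block j) (2 * truncP b k j)), (if j = i then 1 else (-1) ^ t.card) *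
        ∏ p ∈ t, x p = esym (block i) x (2 * truncP b k i + 1) *
          ∏ j ∈ univ.erase i, bonf (block j) x (2 * truncP b k j) := by
    intro x
    rw [← mul_prod_erase univ _ (mem_univ i)]
    congr 1
    · simp [esym]
    · refine prod_congr rfl fun j hj => ?_
      have := ne_of_mem_erase hj
      simp only [this, if_false, bonf_eq_sum]
  simp only [hx] at h
  have hc := prod_card_le b k (fun j => (if j = i then (block j).powersetCard (2 * truncP b k j + 1)
      else smallSubsets (block j) (2 * truncP b k j)).card) (fun j => by
    split_ifs
    · rw [card_powersetCard]
      exact (Nat.choose_le_pow _ _).trans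
        (Nat.pow_le_pow_left (by have := card_block_lt j; omega) _)
    · exact card_smallSubsets_block_le b k j)
  have := (abs_le.1 (h.trans hc)).2
  unfold overW blockM
  linarith

lemma exists_trunc_bound : ∃ b₀ : ℕ, ∀ c ≥ b₀,
    exp (2 * recipC) * (recipC ^ (2 * c + 1) / (2 * c + 1).factorial) ≤ (1 / 16 : ℝ) ^ c := by
  have h := FloorSemiring.tendsto_pow_div_factorial_atTop (4 * recipC)
  have h2 := (h.const_mul (exp (2 * recipC))).eventually (eventually_le_nhds (b := 1) (by simp))
  obtain ⟨N, hN⟩ := eventually_atTop.1 h2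
  refine ⟨N, fun c hc => ?_⟩
  have h3 := hN (2 * c + 1) (by omega)
  rw [mul_pow] at h3
  have e : (4 : ℝ) ^ (2 * c + 1) = 4 * 16 ^ c := by
    rw [pow_succ, pow_mul]; norm_num [mul_comm]
  have hp : (0 : ℝ) < 16 ^ c := by positivity
  have h4 : exp (2 * recipC) * (recipC ^ (2 * c + 1) / (2 * c + 1).factorial) * (4 * 16 ^ c) ≤ 1 := by
    rw [← e]; refine le_trans (le_of_eq ?_) h3; ring
  have h5 : (1 / 16 : ℝ) ^ c = 1 / 16 ^ c := by rw [div_pow, one_pow]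
  rw [h5, le_div_iff₀ hp]
  by_contra hcon
  push Not at hcon
  nlinarith

/-- The fundamental lemma of the sieve, with a crude level of distribution. -/
lemma exists_sieve_bounds : ∃ C : ℝ, 1 ≤ C ∧ ∃ b₀ : ℕ, ∀ b ≥ b₀, ∀ k : ℕ, ∃ m : ℝ, 0 ≤ m ∧
    m ≤ C / log ((2 ^ 2 ^ k : ℕ) : ℝ) ∧ ∀ u v : ℝ, 0 ≤ u → u ≤ v →
    |∑ n ∈ Ioc ⌊u⌋₊ ⌊v⌋₊, sieveW b k n - (v - u) * m| ≤ ((2 ^ 2 ^ k : ℕ) : ℝ) ^ (4 * b + 7) ∧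
    ∑ n ∈ Ioc ⌊u⌋₊ ⌊v⌋₊, (sieveW b k n - if Rough (2 ^ 2 ^ k) n then 1 else 0) ≤
      C * (1 / 16) ^ b * (v - u) / log ((2 ^ 2 ^ k : ℕ) : ℝ) +
        ((2 ^ 2 ^ k : ℕ) : ℝ) ^ (4 * b + 7) := by
  obtain ⟨b₀, hb₀⟩ := exists_trunc_bound
  have he2 : 1 ≤ exp 2 := one_le_exp (by norm_num)
  refine ⟨2 * exp 2, by linarith, b₀, fun b hb k => ?_⟩
  set y : ℕ := 2 ^ 2 ^ k with hy
  set V : ℝ := ∏ i : Fin k, blockV i with hV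
  set q : Fin k → ℝ := fun i => (1 / 16 : ℝ) ^ truncP b k i with hq
  have hl : 0 < log (y : ℝ) := by
    refine log_pos ?_
    have : 1 < y := Nat.one_lt_pow (by positivity) (by norm_num)
    exact_mod_cast this
  have hq0 : ∀ i, 0 ≤ q i := fun i => by positivity
  have hV0 : ∀ i : Fin k, 0 < blockV i := fun i => blockV_pos i
  have hE : ∀ i : Fin k, esym (block i) (fun p => 1 / (p : ℝ)) (2 * truncP b k i + 1) ≤
      blockV i * q i := by
    intro i
    have h1 := esym_le_pow_div_factorial (block i) (fun p => 1 / (p : ℝ))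
      (fun p hp => (recip_mem hp).1) (2 * truncP b k i + 1)
    have h2 := hb₀ (truncP b k i) (by unfold truncP; omega)
    have h3 : (∑ p ∈ block i, 1 / (p : ℝ)) ^ (2 * truncP b k i + 1) ≤
        recipC ^ (2 * truncP b k i + 1) :=
      pow_le_pow_left₀ (sum_nonneg fun p hp => (recip_mem hp).1) (sum_block_recip_le i) _
    have h4 := exp_le_blockV i
    refine h1.trans ((div_le_div_of_nonneg_right h3 (by positivity)).trans ?_)
    calc _ = exp (-(2 * recipC)) * (exp (2 * recipC) * (recipC ^ (2 * truncP b k i + 1) /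
            (2 * truncP b k i + 1).factorial)) := by
          rw [← mul_assoc, ← exp_add]; simp
      _ ≤ blockV i * q i := mul_le_mul h4 h2 (by
          have : 0 ≤ recipC := (sum_nonneg fun p hp => (recip_mem hp).1).trans
            (sum_block_recip_le 0)
          positivity) (hV0 i).le
  have hM0 : ∀ i : Fin k, 0 ≤ blockM b k i := fun i => (hV0 i).le.trans (blockM_bounds b k i).1
  have hM : ∀ i : Fin k, blockM b k i ≤ blockV i * exp (q i) := by
    intro i
    have h1 := (blockM_bounds b k i).2
    have h2 := add_one_le_exp (q i)
    nlinarith [hE i, hV0 i]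
  have hqs : ∀ s : Finset (Fin k), ∑ i ∈ s, q i ≤ 2 := by
    intro s
    refine (sum_le_sum_of_subset_of_nonneg (subset_univ s) fun i _ _ => hq0 i).trans ?_
    refine (sum_pow_truncP_le b k).trans ?_
    have : (1 / 16 : ℝ) ^ b ≤ 1 := pow_le_one₀ (by norm_num) (by norm_num)
    linarith
  have hprod : ∀ s : Finset (Fin k), ∏ i ∈ s, blockM b k i ≤ (∏ i ∈ s, blockV i) * exp 2 := by
    intro s
    calc _ ≤ ∏ i ∈ s, (blockV i * exp (q i)) := prod_le_prod (fun i _ => hM0 i) fun i _ => hM i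
      _ = (∏ i ∈ s, blockV i) * exp (∑ i ∈ s, q i) := by rw [prod_mul_distrib, exp_sum]
      _ ≤ _ := by
        have : 0 ≤ ∏ i ∈ s, blockV i := prod_nonneg fun i _ => (hV0 i).le
        have := hqs s
        gcongr
  have hVy : V ≤ 1 / log (y : ℝ) := prod_blockV_le k
  have hVpos : 0 < V := prod_pos fun i _ => hV0 i
  have hy1 : (1 : ℝ) ≤ y := by exact_mod_cast Nat.one_le_two_pow
  have hky : (k : ℝ) ≤ y := by
    exact_mod_cast (Nat.lt_two_pow_self.trans Nat.lt_two_pow_self).le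
  refine ⟨∏ i : Fin k, blockM b k i, prod_nonneg fun i _ => hM0 i, ?_, fun u v hu huv => ⟨?_, ?_⟩⟩
  · refine (hprod univ).trans ?_
    calc V * exp 2 ≤ 1 / log (y : ℝ) * exp 2 := by gcongr
      _ ≤ 2 * exp 2 / log (y : ℝ) := by rw [one_div_mul_eq_div]; gcongr; linarith
  · exact (abs_sum_sieveW_sub_le b k hu huv).trans (pow_le_pow_right₀ hy1 (by omega))
  · calc ∑ n ∈ Ioc ⌊u⌋₊ ⌊v⌋₊, (sieveW b k n - if Rough y n then 1 else 0)
        ≤ ∑ n ∈ Ioc ⌊u⌋₊ ⌊v⌋₊, ∑ i, overW b k i n := sum_le_sum fun n _ => sieveW_sub_le b k n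
      _ = ∑ i, ∑ n ∈ Ioc ⌊u⌋₊ ⌊v⌋₊, overW b k i n := sum_comm
      _ ≤ ∑ i : Fin k, ((v - u) * (V * exp 2 * q i) + (y : ℝ) ^ (4 * b + 6)) := by
        refine sum_le_sum fun i _ => (sum_overW_le b k i hu huv).trans ?_
        have huv' : 0 ≤ v - u := by linarith
        refine add_le_add (mul_le_mul_of_nonneg_left ?_ huv') le_rfl
        calc _ ≤ blockV i * q i * ((∏ j ∈ univ.erase i, blockV j) * exp 2) :=
              mul_le_mul (hE i) (hprod _) (prod_nonneg fun i _ => hM0 i)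
                (mul_nonneg (hV0 i).le (hq0 i))
          _ = (blockV i * ∏ j ∈ univ.erase i, blockV j) * exp 2 * q i := by ring
          _ = V * exp 2 * q i := by rw [mul_prod_erase univ (fun j : Fin k => blockV j) (mem_univ i)]
      _ = (v - u) * (V * exp 2 * ∑ i, q i) + k * (y : ℝ) ^ (4 * b + 6) := by
        rw [sum_add_distrib, ← mul_sum, ← mul_sum]; simp
      _ ≤ (v - u) * (1 / log (y : ℝ) * exp 2 * (2 * (1 / 16) ^ b)) + y * (y : ℝ) ^ (4 * b + 6) := by
        have huv' : 0 ≤ v - u := by linarith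
        have := sum_pow_truncP_le b k
        have h0 : 0 ≤ ∑ i, q i := sum_nonneg fun i _ => hq0 i
        gcongr
      _ = _ := by ring

lemma sum_sum_dvd_swap (S : Finset ℕ) (hS : ∀ d ∈ S, 0 < d) (h : ℕ → ℕ → ℝ) (u v : ℝ) :
    ∑ n ∈ Ioc ⌊u⌋₊ ⌊v⌋₊, ∑ d ∈ S.filter (· ∣ n), h d n =
      ∑ d ∈ S, ∑ m ∈ Ioc ⌊u / d⌋₊ ⌊v / d⌋₊, h d (d * m) := by
  simp only [sum_filter]
  rw [sum_comm]
  refine sum_congr rfl fun d hd => ?_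
  have hd0 := hS d hd
  rw [← sum_filter]
  symm
  refine sum_bij' (fun m _ => d * m) (fun n _ => n / d) ?_ ?_ ?_ ?_ ?_
  · intro m hm
    rw [mem_Ioc, Nat.floor_div_natCast, Nat.floor_div_natCast, Nat.div_lt_iff_lt_mul hd0,
      Nat.le_div_iff_mul_le hd0] at hm
    simp only [mem_filter, mem_Ioc, dvd_mul_right, and_true]
    constructor <;> nlinarith [hm.1, hm.2]
  · intro n hn
    simp only [mem_filter, mem_Ioc] at hn
    obtain ⟨⟨h1, h2⟩, m, rfl⟩ := hn
    rw [mem_Ioc, Nat.floor_div_natCast, Nat.floor_div_natCast, Nat.div_lt_iff_lt_mul hd0,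
      Nat.le_div_iff_mul_le hd0, Nat.mul_div_cancel_left _ hd0]
    constructor <;> nlinarith
  · intro m _; exact Nat.mul_div_cancel_left _ hd0
  · intro n hn; exact Nat.mul_div_cancel' (mem_filter.1 hn).2
  · intro m _; rfl

/-- The indicator function of rough numbers. -/
noncomputable def roughI (y n : ℕ) : ℝ := if Rough y n then 1 else 0

lemma roughI_nonneg (y n : ℕ) : 0 ≤ roughI y n := by unfold roughI; split_ifs <;> norm_num

lemma roughI_le_one (y n : ℕ) : roughI y n ≤ 1 := by unfold roughI; split_ifs <;> norm_num

lemma roughI_mul {y d : ℕ} (hd : Rough y d) (n : ℕ) : roughI y (d * n) = roughI y n := by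
  simp [roughI, Rough.mul_iff, hd]

/-- The rough numbers up to `Z`. -/
noncomputable def roughS (y : ℕ) (Z : ℝ) : Finset ℕ := (Ioc 0 ⌊Z⌋₊).filter (Rough y)

lemma roughI_le_sieveW (b k n : ℕ) : roughI (2 ^ 2 ^ k) n ≤ sieveW b k n := by
  unfold roughI
  split_ifs with h
  · exact (sieveW_rough h).ge
  · exact sieveW_nonneg _ _ _

/-- The main sum of the weights attached to `lam2`. -/
noncomputable def selW (y : ℕ) (X z : ℝ) (n : ℕ) : ℝ :=
  ∑ d ∈ (roughS y (X / z)).filter (· ∣ n), (μ d : ℝ) * ((log X - log d) ^ 2 - log z ^ 2)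

lemma abs_moebius_le_one' (d : ℕ) : |(μ d : ℝ)| ≤ 1 := by
  exact_mod_cast ArithmeticFunction.abs_moebius_le_one (n := d)

lemma abs_selF_le {X z : ℝ} (hz : 1 ≤ z) {d : ℕ} (hd : 0 < d) (hdX : (d : ℝ) ≤ X / z) :
    |(μ d : ℝ) * ((log X - log d) ^ 2 - log z ^ 2)| ≤ log X ^ 2 := by
  have hd1 : (1 : ℝ) ≤ d := by exact_mod_cast hd
  have hz0 : 0 ≤ log z := log_nonneg hz
  have h1 : 0 ≤ log (d : ℝ) := log_nonneg hd1
  have hdz : (d : ℝ) * z ≤ X := (le_div_iff₀ (by linarith)).1 hdX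
  have h2 : log d + log z ≤ log X := by
    rw [← log_mul (by positivity) (by positivity)]
    exact log_le_log (by positivity) hdz
  rw [abs_mul]
  refine (mul_le_of_le_one_left (abs_nonneg _) (abs_moebius_le_one' d)).trans ?_
  rw [abs_le]
  constructor <;> nlinarith

lemma mem_roughS {y : ℕ} {Z : ℝ} (hZ : 0 ≤ Z) {d : ℕ} :
    d ∈ roughS y Z ↔ (0 < d ∧ (d : ℝ) ≤ Z) ∧ Rough y d := by
  simp [roughS, Nat.le_floor_iff hZ]

lemma card_roughS_le {y : ℕ} {Z : ℝ} (hZ : 0 ≤ Z) : ((roughS y Z).card : ℝ) ≤ Z := by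
  have : (roughS y Z).card ≤ ⌊Z⌋₊ := (card_filter_le _ _).trans (by simp)
  exact (Nat.cast_le.2 this).trans (Nat.floor_le hZ)

lemma abs_selW_le {y : ℕ} {X z : ℝ} (hX : 0 ≤ X) (hz : 1 ≤ z) (n : ℕ) :
    |selW y X z n| ≤ log X ^ 2 * ((roughS y (X / z)).filter (· ∣ n)).card := by
  unfold selW
  refine (abs_sum_le_sum_abs _ _).trans ((sum_le_card_nsmul _ _ (log X ^ 2) fun d hd => ?_).trans ?_)
  · have := ((mem_roughS (by positivity)).1 (mem_filter.1 hd).1).1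
    exact abs_selF_le hz this.1 this.2
  · rw [nsmul_eq_mul, mul_comm]

lemma abs_lam2_sub_selW_le {y : ℕ} {X z : ℝ} (hz : 1 ≤ z) {n : ℕ} (hn : 1 < n) (hnX : (n : ℝ) ≤ X)
    (hr : Rough y n) :
    |lam2 n - selW y X z n| ≤ 2 * (log X - log n) * Λ n +
      log z ^ 2 * ((roughS y z).filter (· ∣ n)).card := by
  have hn1 : (1 : ℝ) < n := by exact_mod_cast hn
  have hX0 : 0 ≤ X := by linarith
  have hfull : ∑ d ∈ n.divisors, (μ d : ℝ) * ((log X - log d) ^ 2 - log z ^ 2) =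
      lam2 n + 2 * (log X - log n) * Λ n := by
    rw [← moebius_sum_log_sq _ hn]
    have h0 : ∑ d ∈ n.divisors, (μ d : ℝ) = 0 := by
      have h := congrArg (fun f : ArithmeticFunction ℝ => f n)
        (ArithmeticFunction.coe_moebius_mul_coe_zeta (R := ℝ))
      simp only [ArithmeticFunction.coe_mul_zeta_apply,
        ArithmeticFunction.one_apply, show n ≠ 1 by omega, if_false,
        ArithmeticFunction.intCoe_apply] at h
      exact h
    simp only [mul_sub, sum_sub_distrib, ← sum_mul]
    rw [h0]; ring
  have hsplit := sum_filter_add_sum_filter_not n.divisors (fun d : ℕ => (d : ℝ) ≤ X / z)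
    (fun d => (μ d : ℝ) * ((log X - log d) ^ 2 - log z ^ 2))
  have hS : n.divisors.filter (fun d : ℕ => (d : ℝ) ≤ X / z) = (roughS y (X / z)).filter (· ∣ n) := by
    ext d
    simp only [mem_filter, Nat.mem_divisors, mem_roughS (show 0 ≤ X / z by positivity)]
    constructor
    · rintro ⟨⟨h1, h2⟩, h3⟩
      exact ⟨⟨⟨Nat.pos_of_dvd_of_pos h1 (by omega), h3⟩, hr.of_dvd h1⟩, h1⟩
    · rintro ⟨⟨⟨h1, h3⟩, h4⟩, h5⟩
      exact ⟨⟨h5, by omega⟩, h3⟩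
  rw [hS, hfull] at hsplit
  have htail : |∑ d ∈ n.divisors.filter (fun d : ℕ => ¬ (d : ℝ) ≤ X / z),
      (μ d : ℝ) * ((log X - log d) ^ 2 - log z ^ 2)| ≤
      log z ^ 2 * ((roughS y z).filter (· ∣ n)).card := by
    refine (abs_sum_le_sum_abs _ _).trans ((sum_le_card_nsmul _ _ (log z ^ 2) fun d hd => ?_).trans ?_)
    · simp only [mem_filter, Nat.mem_divisors, not_le] at hd
      obtain ⟨⟨h1, -⟩, h3⟩ := hd
      have hd0 : (1 : ℝ) ≤ d := by exact_mod_cast Nat.pos_of_dvd_of_pos h1 (by omega)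
      have hdn : (d : ℝ) ≤ n := by exact_mod_cast Nat.le_of_dvd (by omega) h1
      have h4 : log d ≤ log X := log_le_log (by linarith) (by linarith)
      have h5 : log X ≤ log d + log z := by
        rw [← log_mul (by positivity) (by positivity)]
        exact log_le_log (by linarith) ((div_lt_iff₀ (by linarith)).1 h3).le
      rw [abs_mul]
      refine (mul_le_of_le_one_left (abs_nonneg _) (abs_moebius_le_one' d)).trans ?_
      rw [abs_le]
      constructor <;> nlinarith
    · rw [nsmul_eq_mul, mul_comm]
      refine mul_le_mul_of_nonneg_left ?_ (sq_nonneg _)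
      norm_cast
      refine card_le_card_of_injOn (fun d => n / d) ?_ ?_
      · intro d hd
        simp only [coe_filter, Nat.mem_divisors, not_le, Set.mem_ofPred_eq] at hd
        obtain ⟨⟨⟨e, rfl⟩, h2⟩, h3⟩ := hd
        have hd0 : 0 < d := Nat.pos_of_ne_zero fun h => by simp [h] at h2
        simp only [coe_filter, Set.mem_ofPred_eq, mem_roughS (show 0 ≤ z by linarith)]
        rw [Nat.mul_div_cancel_left _ hd0]
        refine ⟨⟨⟨Nat.pos_of_ne_zero fun h => by simp [h] at h2, ?_⟩, hr.of_dvd (dvd_mul_left _ _)⟩,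
          dvd_mul_left _ _⟩
        rw [div_lt_iff₀ (by linarith)] at h3
        push_cast at hnX
        have hd0' : (0 : ℝ) < d := by exact_mod_cast hd0
        by_contra hcon
        push Not at hcon
        nlinarith
      · intro a ha c hc hac
        simp only [coe_filter, Nat.mem_divisors, Set.mem_ofPred_eq] at ha hc
        have h1 := Nat.div_mul_cancel ha.1.1
        have h2 := Nat.div_mul_cancel hc.1.1
        have hac : n / a = n / c := hac
        rw [hac, ← h2] at h1
        have h3 : 0 < n / c := Nat.div_pos (Nat.le_of_dvd (by omega) hc.1.1)
          (Nat.pos_of_dvd_of_pos hc.1.1 (by omega))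
        rw [Nat.mul_div_cancel _ (Nat.pos_of_dvd_of_pos hc.1.1 (by omega))] at h1
        exact Nat.eq_of_mul_eq_mul_left h3 h1
  have hl : 0 ≤ 2 * (log X - log n) * Λ n := by
    have := log_le_log (by linarith) hnX
    have h2 : 0 ≤ Λ n := ArithmeticFunction.vonMangoldt_nonneg
    have h3 : 0 ≤ log X - log n := by linarith
    positivity
  have : lam2 n - selW y X z n = -(2 * (log X - log n) * Λ n) +
      ∑ d ∈ n.divisors.filter (fun d : ℕ => ¬ (d : ℝ) ≤ X / z),
      (μ d : ℝ) * ((log X - log d) ^ 2 - log z ^ 2) := by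
    unfold selW; linarith
  rw [this]
  refine (abs_add_le _ _).trans (add_le_add ?_ htail)
  rw [abs_neg, abs_of_nonneg hl]

lemma two_le_tower (k : ℕ) : 2 ≤ 2 ^ 2 ^ k :=
  Nat.le_self_pow (by positivity) 2

lemma log_tower_pos (k : ℕ) : 0 < log ((2 ^ 2 ^ k : ℕ) : ℝ) :=
  log_pos (by exact_mod_cast two_le_tower k)

/-- The conclusions of the fundamental lemma used below. -/
def SieveBound (C : ℝ) (b k : ℕ) (m : ℝ) : Prop :=
  0 ≤ m ∧ m ≤ C / log ((2 ^ 2 ^ k : ℕ) : ℝ) ∧ ∀ u v : ℝ, 0 ≤ u → u ≤ v →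
    |∑ n ∈ Ioc ⌊u⌋₊ ⌊v⌋₊, sieveW b k n - (v - u) * m| ≤ ((2 ^ 2 ^ k : ℕ) : ℝ) ^ (4 * b + 7) ∧
    ∑ n ∈ Ioc ⌊u⌋₊ ⌊v⌋₊, (sieveW b k n - roughI (2 ^ 2 ^ k) n) ≤
      C * (1 / 16) ^ b * (v - u) / log ((2 ^ 2 ^ k : ℕ) : ℝ) + ((2 ^ 2 ^ k : ℕ) : ℝ) ^ (4 * b + 7)

lemma sum_recip_roughS_le {k : ℕ} {Z : ℝ} (hZ : 1 ≤ Z) :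
    ∑ d ∈ roughS (2 ^ 2 ^ k) Z, 1 / (d : ℝ) ≤
      (1 + log Z + log ((2 ^ 2 ^ k : ℕ) : ℝ)) / log ((2 ^ 2 ^ k : ℕ) : ℝ) := by
  have hl := log_tower_pos k
  have h := sum_rough_recip_le (2 ^ 2 ^ k) ⌊Z⌋₊ (by positivity)
  have hf : 1 ≤ ⌊Z⌋₊ := Nat.one_le_floor_iff _ |>.2 hZ
  have hf' : (1 : ℝ) ≤ ⌊Z⌋₊ := by exact_mod_cast hf
  rw [le_div_iff₀ hl]
  refine h.trans ?_
  rw [log_mul (by positivity) (by positivity), ← add_assoc]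
  gcongr
  exact Nat.floor_le (by linarith)

lemma SieveBound.sum_roughI_le {C : ℝ} {b k : ℕ} {m : ℝ} (h : SieveBound C b k m) {u v : ℝ}
    (hu : 0 ≤ u) (huv : u ≤ v) :
    ∑ n ∈ Ioc ⌊u⌋₊ ⌊v⌋₊, roughI (2 ^ 2 ^ k) n ≤
      C * (v - u) / log ((2 ^ 2 ^ k : ℕ) : ℝ) + ((2 ^ 2 ^ k : ℕ) : ℝ) ^ (4 * b + 7) := by
  have h1 := (abs_le.1 (h.2.2 u v hu huv).1).2
  have h2 : ∑ n ∈ Ioc ⌊u⌋₊ ⌊v⌋₊, roughI (2 ^ 2 ^ k) n ≤ ∑ n ∈ Ioc ⌊u⌋₊ ⌊v⌋₊, sieveW b k n :=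
    sum_le_sum fun n _ => roughI_le_sieveW b k n
  have h3 := mul_le_mul_of_nonneg_left h.2.1 (sub_nonneg.2 huv)
  have e : C * (v - u) / log ((2 ^ 2 ^ k : ℕ) : ℝ) = (v - u) * (C / log ((2 ^ 2 ^ k : ℕ) : ℝ)) := by
    ring
  rw [e]; linarith

lemma pos_of_mem_roughS {y : ℕ} {Z : ℝ} {d : ℕ} (h : d ∈ roughS y Z) : 0 < d :=
  (mem_Ioc.1 (mem_filter.1 h).1).1

lemma rough_of_mem_roughS {y : ℕ} {Z : ℝ} {d : ℕ} (h : d ∈ roughS y Z) : Rough y d :=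
  (mem_filter.1 h).2

/-- Summing an interval bound over dilations by rough numbers. -/
lemma sum_roughS_dilate_le {k : ℕ} {Z a A u v : ℝ} (hZ : 1 ≤ Z) (ha : 0 ≤ a) (hA : 0 ≤ A)
    (huv : u ≤ v) (G : ℕ → ℝ)
    (hG : ∀ d ∈ roughS (2 ^ 2 ^ k) Z, G d ≤ a * (v / d - u / d) + A) :
    ∑ d ∈ roughS (2 ^ 2 ^ k) Z, G d ≤
      a * (v - u) * ((1 + log Z + log ((2 ^ 2 ^ k : ℕ) : ℝ)) / log ((2 ^ 2 ^ k : ℕ) : ℝ)) + Z * A := by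
  calc _ ≤ ∑ d ∈ roughS (2 ^ 2 ^ k) Z, (a * (v - u) * (1 / (d : ℝ)) + A) := by
        refine sum_le_sum fun d hd => (hG d hd).trans (le_of_eq ?_)
        ring
    _ = a * (v - u) * ∑ d ∈ roughS (2 ^ 2 ^ k) Z, (1 / (d : ℝ)) + (roughS (2 ^ 2 ^ k) Z).card * A := by
        rw [sum_add_distrib, ← mul_sum]; simp
    _ ≤ _ := by
        have h1 := sum_recip_roughS_le (k := k) hZ
        have h2 := card_roughS_le (y := 2 ^ 2 ^ k) (Z := Z) (by linarith)
        have h3 : 0 ≤ v - u := sub_nonneg.2 huv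
        gcongr

lemma abs_sum_sieveW_mul_selW_le {C : ℝ} {b k : ℕ} {m : ℝ} (h : SieveBound C b k m)
    {X z u v : ℝ} (hX : 0 ≤ X) (hz : 1 ≤ z) (hu : 0 ≤ u) (huv : u ≤ v) :
    |∑ n ∈ Ioc ⌊u⌋₊ ⌊v⌋₊, sieveW b k n * selW (2 ^ 2 ^ k) X z n - (m * ∑ d ∈ roughS (2 ^ 2 ^ k) (X / z),
      (μ d : ℝ) * ((log X - log d) ^ 2 - log z ^ 2) / d) * (v - u)| ≤
      X / z * (log X ^ 2 * ((2 ^ 2 ^ k : ℕ) : ℝ) ^ (4 * b + 7)) := by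
  have hXz : 0 ≤ X / z := by positivity
  simp only [selW, mul_sum]
  rw [sum_sum_dvd_swap _ (fun d hd => pos_of_mem_roughS hd), sum_mul, ← sum_sub_distrib]
  refine (abs_sum_le_sum_abs _ _).trans ?_
  refine (sum_le_card_nsmul _ _ (log X ^ 2 * ((2 ^ 2 ^ k : ℕ) : ℝ) ^ (4 * b + 7)) fun d hd => ?_).trans ?_
  · have hd1 := pos_of_mem_roughS hd
    have hd2 := rough_of_mem_roughS hd
    have hd3 := ((mem_roughS hXz).1 hd).1.2
    have hd1' : (0 : ℝ) < d := by exact_mod_cast hd1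
    simp only [sieveW_rough_mul hd2]
    rw [← sum_mul]
    have hb := (h.2.2 (u / d) (v / d) (by positivity) (by gcongr)).1
    have hF := abs_selF_le hz hd1 hd3
    set F := (μ d : ℝ) * ((log X - log d) ^ 2 - log z ^ 2)
    rw [show (∑ n ∈ Ioc ⌊u / d⌋₊ ⌊v / d⌋₊, sieveW b k n) * F - m * (F / d) * (v - u) =
      F * (∑ n ∈ Ioc ⌊u / d⌋₊ ⌊v / d⌋₊, sieveW b k n - (v / d - u / d) * m) by ring, abs_mul]
    exact mul_le_mul hF hb (abs_nonneg _) (sq_nonneg _)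
  · rw [nsmul_eq_mul]
    have := card_roughS_le (y := 2 ^ 2 ^ k) hXz
    gcongr

lemma abs_lam2_rough_sub_le {b k : ℕ} {X z R : ℝ} (hz : 1 ≤ z) {n : ℕ} (hn : 1 < n)
    (hnX : (n : ℝ) ≤ X) (hR : log X - log n ≤ R) :
    |lam2 n * roughI (2 ^ 2 ^ k) n - sieveW b k n * selW (2 ^ 2 ^ k) X z n| ≤
      2 * R * log X * roughI (2 ^ 2 ^ k) n +
      log z ^ 2 * ∑ _ ∈ (roughS (2 ^ 2 ^ k) z).filter (· ∣ n), roughI (2 ^ 2 ^ k) n +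
      log X ^ 2 * ∑ _ ∈ (roughS (2 ^ 2 ^ k) (X / z)).filter (· ∣ n),
        (sieveW b k n - roughI (2 ^ 2 ^ k) n) := by
  have hn1 : (1 : ℝ) < n := by exact_mod_cast hn
  rw [sum_const, sum_const, nsmul_eq_mul, nsmul_eq_mul]
  by_cases hr : Rough (2 ^ 2 ^ k) n
  · rw [sieveW_rough hr]
    simp only [roughI, hr, if_true, mul_one, one_mul, sub_self, mul_zero, add_zero]
    refine (abs_lam2_sub_selW_le hz hn hnX hr).trans ?_
    have h1 : Λ n ≤ log X := ArithmeticFunction.vonMangoldt_le_log.trans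
      (log_le_log (by linarith) hnX)
    have h2 : 0 ≤ Λ n := ArithmeticFunction.vonMangoldt_nonneg
    have h3 := log_le_log (by linarith) hnX
    have h4 : (log X - log n) * Λ n ≤ R * log X :=
      mul_le_mul hR h1 h2 (by linarith)
    linarith
  · simp only [roughI, hr, if_false, mul_zero, sub_zero, zero_sub, zero_add, abs_neg]
    rw [abs_mul, abs_of_nonneg (sieveW_nonneg b k n)]
    have := mul_le_mul_of_nonneg_left (abs_selW_le (y := 2 ^ 2 ^ k) (show 0 ≤ X by linarith) hz n)
      (sieveW_nonneg b k n)
    refine this.trans (le_of_eq ?_)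
    ring

lemma abs_sum_lam2_rough_le {C : ℝ} (hC : 0 ≤ C) {b k : ℕ} {m : ℝ} (h : SieveBound C b k m)
    {X z R : ℝ} (hz : 1 ≤ z) (hzX : z ≤ X) (hR : 0 ≤ R) :
    ∃ c : ℝ, ∀ u v : ℝ, 1 ≤ u → u ≤ v → v ≤ X → log X - log u ≤ R →
    |∑ n ∈ Ioc ⌊u⌋₊ ⌊v⌋₊, lam2 n * roughI (2 ^ 2 ^ k) n - c * (v - u)| ≤
      X / z * (log X ^ 2 * ((2 ^ 2 ^ k : ℕ) : ℝ) ^ (4 * b + 7)) +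
      (2 * R * log X * (C * (v - u) / log ((2 ^ 2 ^ k : ℕ) : ℝ) +
        ((2 ^ 2 ^ k : ℕ) : ℝ) ^ (4 * b + 7)) +
      log z ^ 2 * (C / log ((2 ^ 2 ^ k : ℕ) : ℝ) * (v - u) * ((1 + log z +
        log ((2 ^ 2 ^ k : ℕ) : ℝ)) / log ((2 ^ 2 ^ k : ℕ) : ℝ)) +
        z * ((2 ^ 2 ^ k : ℕ) : ℝ) ^ (4 * b + 7)) +
      log X ^ 2 * (C * (1 / 16) ^ b / log ((2 ^ 2 ^ k : ℕ) : ℝ) * (v - u) * ((1 + log (X / z) +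
        log ((2 ^ 2 ^ k : ℕ) : ℝ)) / log ((2 ^ 2 ^ k : ℕ) : ℝ)) +
        X / z * ((2 ^ 2 ^ k : ℕ) : ℝ) ^ (4 * b + 7))) := by
  refine ⟨m * ∑ d ∈ roughS (2 ^ 2 ^ k) (X / z),
      (μ d : ℝ) * ((log X - log d) ^ 2 - log z ^ 2) / d, fun u v hu huv hvX hRu => ?_⟩
  have hl := log_tower_pos k
  have hX : 1 ≤ X := hz.trans hzX
  have hXz : 1 ≤ X / z := (one_le_div (by linarith)).2 hzX
  have hlX : 0 ≤ log X := log_nonneg hX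
  have h1 := abs_sum_sieveW_mul_selW_le h (show 0 ≤ X by linarith) hz (by linarith) huv
  have h2 : |∑ n ∈ Ioc ⌊u⌋₊ ⌊v⌋₊, lam2 n * roughI (2 ^ 2 ^ k) n -
      ∑ n ∈ Ioc ⌊u⌋₊ ⌊v⌋₊, sieveW b k n * selW (2 ^ 2 ^ k) X z n| ≤
      ∑ n ∈ Ioc ⌊u⌋₊ ⌊v⌋₊, (2 * R * log X * roughI (2 ^ 2 ^ k) n +
      log z ^ 2 * ∑ d ∈ (roughS (2 ^ 2 ^ k) z).filter (· ∣ n), roughI (2 ^ 2 ^ k) n +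
      log X ^ 2 * ∑ d ∈ (roughS (2 ^ 2 ^ k) (X / z)).filter (· ∣ n),
        (sieveW b k n - roughI (2 ^ 2 ^ k) n)) := by
    rw [← sum_sub_distrib]
    refine (abs_sum_le_sum_abs _ _).trans (sum_le_sum fun n hn => ?_)
    have hn := mem_Ioc.1 hn
    have hf : 1 ≤ ⌊u⌋₊ := Nat.one_le_floor_iff _ |>.2 hu
    have hun : u < n := (Nat.floor_lt (by linarith)).1 hn.1
    have hnv : (n : ℝ) ≤ v := (Nat.le_floor_iff (by linarith)).1 hn.2
    refine abs_lam2_rough_sub_le hz (by omega) (hnv.trans hvX) ?_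
    have := log_le_log (by linarith) hun.le
    linarith
  rw [sum_add_distrib, sum_add_distrib, ← mul_sum, ← mul_sum, ← mul_sum,
    sum_sum_dvd_swap _ (fun d hd => pos_of_mem_roughS hd),
    sum_sum_dvd_swap _ (fun d hd => pos_of_mem_roughS hd)] at h2
  have hA : 0 ≤ ((2 ^ 2 ^ k : ℕ) : ℝ) ^ (4 * b + 7) := by positivity
  have g1 := h.sum_roughI_le (show 0 ≤ u by linarith) huv
  have g2 := sum_roughS_dilate_le (k := k) hz (a := C / log ((2 ^ 2 ^ k : ℕ) : ℝ)) (by positivity)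
    hA huv (fun d => ∑ n ∈ Ioc ⌊u / d⌋₊ ⌊v / d⌋₊, roughI (2 ^ 2 ^ k) (d * n)) (fun d hd => by
      simp only [roughI_mul (rough_of_mem_roughS hd)]
      refine (h.sum_roughI_le (by positivity) (by gcongr)).trans (le_of_eq ?_)
      ring)
  have g3 := sum_roughS_dilate_le (k := k) hXz
    (a := C * (1 / 16) ^ b / log ((2 ^ 2 ^ k : ℕ) : ℝ)) (by positivity)
    hA huv (fun d => ∑ n ∈ Ioc ⌊u / d⌋₊ ⌊v / d⌋₊,
      (sieveW b k (d * n) - roughI (2 ^ 2 ^ k) (d * n))) (fun d hd => by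
      simp only [roughI_mul (rough_of_mem_roughS hd), sieveW_rough_mul (rough_of_mem_roughS hd)]
      refine (h.2.2 (u / d) (v / d) (by positivity) (by gcongr)).2.trans (le_of_eq ?_)
      ring)
  have h3 := abs_sub_le (∑ n ∈ Ioc ⌊u⌋₊ ⌊v⌋₊, lam2 n * roughI (2 ^ 2 ^ k) n)
    (∑ n ∈ Ioc ⌊u⌋₊ ⌊v⌋₊, sieveW b k n * selW (2 ^ 2 ^ k) X z n)
    ((m * ∑ d ∈ roughS (2 ^ 2 ^ k) (X / z),
      (μ d : ℝ) * ((log X - log d) ^ 2 - log z ^ 2) / d) * (v - u))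
  refine h3.trans ?_
  rw [add_comm]
  refine add_le_add h1 (h2.trans ?_)
  gcongr

/-- The exponent of the sieving level attached to the scale `X`. -/
noncomputable def kOf (b : ℕ) (X : ℝ) : ℕ := Nat.log 2 ⌊(1 / 2 : ℝ) ^ b * log X / log 2⌋₊

/-- The sieving level attached to the scale `X`. -/
noncomputable def yOf (b : ℕ) (X : ℝ) : ℕ := 2 ^ 2 ^ kOf b X

/-- The exponent governing the admissible interval lengths. -/
noncomputable def kap (b : ℕ) : ℝ := 2 * (4 * b + 7) * (1 / 2) ^ b

lemma kap_pos (b : ℕ) : 0 < kap b := by unfold kap; positivity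

lemma log_yOf_bounds {b : ℕ} {X : ℝ} (h : log 2 ≤ (1 / 2 : ℝ) ^ b * log X) :
    (1 / 2 : ℝ) ^ b * log X / 2 ≤ log (yOf b X : ℝ) ∧ log (yOf b X : ℝ) ≤ (1 / 2 : ℝ) ^ b * log X := by
  have h2 : 0 < log 2 := log_pos (by norm_num)
  set s := (1 / 2 : ℝ) ^ b * log X / log 2 with hs
  have hs1 : 1 ≤ s := (one_le_div h2).2 h
  have hfl : ⌊s⌋₊ ≠ 0 := (Nat.floor_pos.2 hs1).ne'
  have e : log (yOf b X : ℝ) = 2 ^ kOf b X * log 2 := by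
    unfold yOf; push_cast; rw [log_pow]; push_cast; rfl
  have e2 : (1 / 2 : ℝ) ^ b * log X = s * log 2 := by rw [hs]; field_simp
  have l1 : ((2 ^ kOf b X : ℕ) : ℝ) ≤ s :=
    (Nat.cast_le.2 (Nat.pow_log_le_self 2 hfl)).trans (Nat.floor_le (by linarith))
  have l2 : s < ((2 ^ (kOf b X + 1) : ℕ) : ℝ) :=
    (Nat.lt_floor_add_one s).trans_le
      (by exact_mod_cast Nat.lt_pow_succ_log_self (by norm_num) ⌊s⌋₊)
  push_cast at l1 l2
  rw [e, e2]
  rw [pow_succ] at l2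
  constructor <;> nlinarith

/-- The constant of the fundamental lemma. -/
noncomputable def sieveC : ℝ := exists_sieve_bounds.choose

lemma one_le_sieveC : 1 ≤ sieveC := exists_sieve_bounds.choose_spec.1

lemma eventually_sieveBound : ∀ᶠ b : ℕ in atTop, ∀ k, ∃ m, SieveBound sieveC b k m := by
  obtain ⟨b₀, hb₀⟩ := exists_sieve_bounds.choose_spec.2
  filter_upwards [eventually_ge_atTop b₀] with b hb k
  obtain ⟨m, h1, h2, h3⟩ := hb₀ b hb k
  exact ⟨m, h1, h2, fun u v hu huv => h3 u v hu huv⟩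

lemma tendsto_pow_mul_half (j : ℕ) : Tendsto (fun b : ℕ => (b : ℝ) ^ j * (1 / 2 : ℝ) ^ b) atTop (nhds 0) :=
  tendsto_pow_const_mul_const_pow_of_abs_lt_one j (by norm_num [abs_lt])

lemma tendsto_kap : Tendsto kap atTop (nhds 0) := by
  have h := ((tendsto_pow_mul_half 1).const_mul 8).add ((tendsto_pow_mul_half 0).const_mul 14)
  norm_num at h
  refine h.congr fun b => ?_
  unfold kap; norm_num; ring

/-- The limiting relative error in the distribution of `lam2` over rough numbers. -/
noncomputable def gErr (b : ℕ) : ℝ :=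
  4 * sieveC * (2 * (4 * b + 7)) ^ 2 * (kap b + (1 / 2) ^ b) + 4 * sieveC * (1 / 4) ^ b * (1 + (1 / 2) ^ b)

lemma tendsto_gErr : Tendsto gErr atTop (nhds 0) := by
  have h := ((((tendsto_pow_mul_half 3).const_mul (2048 * sieveC)).add
    ((tendsto_pow_mul_half 2).const_mul (11008 * sieveC))).add
    (((tendsto_pow_mul_half 1).const_mul (19712 * sieveC)).add
    ((tendsto_pow_mul_half 0).const_mul (11760 * sieveC))))
  have h2 : Tendsto (fun b : ℕ => (1 / 4 : ℝ) ^ b) atTop (nhds 0) :=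
    tendsto_pow_atTop_nhds_zero_of_lt_one (by norm_num) (by norm_num)
  have h3 : Tendsto (fun b : ℕ => (1 / 2 : ℝ) ^ b) atTop (nhds 0) :=
    tendsto_pow_atTop_nhds_zero_of_lt_one (by norm_num) (by norm_num)
  have h4 := h.add ((h2.const_mul (4 * sieveC)).mul (h3.const_add 1))
  simp only [mul_zero, add_zero, zero_mul] at h4
  refine h4.congr fun b => ?_
  unfold gErr kap; ring

lemma lam2_rough_error_le {b : ℕ} {X R : ℝ} (hR : 0 ≤ R) (hb : kap b ≤ 1 / 2)
    (hB : ∃ m, SieveBound sieveC b (kOf b X) m) (h2 : log 2 ≤ (1 / 2 : ℝ) ^ b * log X) :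
    ∃ c : ℝ, ∀ u v : ℝ, 1 ≤ u → u ≤ v → v ≤ X → log X - log u ≤ R → X ^ (1 - kap b / 4) ≤ v - u →
    |∑ n ∈ Ioc ⌊u⌋₊ ⌊v⌋₊, lam2 n * roughI (yOf b X) n - c * (v - u)| ≤
      ((2 + kap b ^ 2) * (log X * exp (-(kap b / 4 * log X))) + 2 * R * exp (-(kap b / 4 * log X)) +
      4 * R * sieveC / (1 / 2) ^ b * (log X)⁻¹ +
      4 * sieveC * (2 * (4 * b + 7)) ^ 2 * ((log X)⁻¹ + kap b + (1 / 2) ^ b) +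
      4 * sieveC * (1 / 4) ^ b * ((log X)⁻¹ + 1 + (1 / 2) ^ b)) * ((v - u) * log X) := by
  obtain ⟨m, hm⟩ := hB
  have hlog2 : 0 < log 2 := log_pos (by norm_num)
  have hδ : 0 < (1 / 2 : ℝ) ^ b := by positivity
  have hx : 0 < log X := by
    by_contra hcon
    push Not at hcon
    nlinarith [mul_nonneg hδ.le (neg_nonneg.2 hcon)]
  have hκ := kap_pos b
  by_cases hX0 : X ≤ 0
  · exact ⟨0, fun u v h1 h2 h3 => by linarith⟩
  push Not at hX0
  set x := log X with hxdef
  set κ := kap b with hκdef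
  set δ := (1 / 2 : ℝ) ^ b with hδdef
  have hXe : X = exp x := (exp_log hX0).symm
  set z := exp (κ * x) with hz
  have hz1 : 1 ≤ z := one_le_exp (by positivity)
  have hzX : z ≤ X := by
    rw [hXe]; exact exp_le_exp.2 (by nlinarith)
  obtain ⟨c, hc⟩ := abs_sum_lam2_rough_le (by linarith [one_le_sieveC]) hm hz1 hzX hR
  refine ⟨c, fun u v hu huv hvX hRu hw => (hc u v hu huv hvX hRu).trans ?_⟩
  obtain ⟨l1, l2⟩ := log_yOf_bounds h2
  change δ * x / 2 ≤ log ((2 ^ 2 ^ kOf b X : ℕ) : ℝ) at l1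
  change log ((2 ^ 2 ^ kOf b X : ℕ) : ℝ) ≤ δ * x at l2
  have hy0 : (0 : ℝ) < ((2 ^ 2 ^ kOf b X : ℕ) : ℝ) := by positivity
  set l := log ((2 ^ 2 ^ kOf b X : ℕ) : ℝ) with hl
  have hA : ((2 ^ 2 ^ kOf b X : ℕ) : ℝ) ^ (4 * b + 7) ≤ exp (κ * x / 2) := by
    have hκx : κ * x / 2 = ((4 * b + 7 : ℕ) : ℝ) * (δ * x) := by
      rw [hκdef, kap, ← hδdef]; push_cast; ring
    rw [← exp_log (pow_pos hy0 _), log_pow, hκx, ← hl]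
    gcongr
  set A := ((2 ^ 2 ^ kOf b X : ℕ) : ℝ) ^ (4 * b + 7) with hAdef
  have hA0 : 0 ≤ A := by positivity
  set w := v - u with hwdef
  set θ := exp (-(κ / 4 * x)) with hθ
  have hw1 : exp ((1 - κ / 2) * x) ≤ w * θ := by
    rw [hXe, ← exp_mul] at hw
    calc exp ((1 - κ / 2) * x) = exp (x * (1 - κ / 4)) * θ := by rw [hθ, ← exp_add]; congr 1; ring
      _ ≤ w * θ := by gcongr
  have hw0 : 0 ≤ w := sub_nonneg.2 huv
  have a1 : X / z * A ≤ w * θ := by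
    refine le_trans ?_ hw1
    calc X / z * A ≤ X / z * exp (κ * x / 2) := by gcongr
      _ = exp ((1 - κ / 2) * x) := by
        rw [hXe, hz, ← exp_sub, ← exp_add]; congr 1; ring
  have a2 : z * A ≤ w * θ := by
    refine le_trans ?_ hw1
    calc z * A ≤ z * exp (κ * x / 2) := by gcongr
      _ = exp (κ * x + κ * x / 2) := by rw [hz, ← exp_add]
      _ ≤ _ := exp_le_exp.2 (by nlinarith)
  have a3 : A ≤ w * θ := (le_mul_of_one_le_left hA0 hz1).trans a2
  have hlz : log z = κ * x := log_exp _
  have hlXz : log (X / z) ≤ x := by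
    rw [log_div hX0.ne' (by positivity), hlz]; nlinarith
  have hl0 : 0 < l := by
    refine lt_of_lt_of_le ?_ l1
    positivity
  have hinv : 1 / l ≤ 2 / (δ * x) := by
    rw [div_le_div_iff₀ hl0 (by positivity)]; linarith
  have hS := one_le_sieveC
  rw [hlz]
  have e4 : (1 / 4 : ℝ) ^ b = (1 / 16) ^ b / δ ^ 2 := by
    rw [hδdef, ← pow_mul, mul_comm b 2, pow_mul, ← div_pow]; norm_num
  have eκ : 2 * (4 * (b : ℝ) + 7) = κ / δ := by rw [hκdef, kap, ← hδdef]; field_simp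
  rw [e4, eκ]
  calc _ = x ^ 2 * (X / z * A) + 2 * R * x * A + (κ * x) ^ 2 * (z * A) + x ^ 2 * (X / z * A) +
        2 * R * x * sieveC * w * (1 / l) +
        (κ * x) ^ 2 * sieveC * w * (1 + κ * x + l) * ((1 / l) * (1 / l)) +
        x ^ 2 * (sieveC * (1 / 16) ^ b) * w * (1 + log (X / z) + l) * ((1 / l) * (1 / l)) := by
        field_simp; ring
    _ ≤ x ^ 2 * (w * θ) + 2 * R * x * (w * θ) + (κ * x) ^ 2 * (w * θ) + x ^ 2 * (w * θ) +
        2 * R * x * sieveC * w * (2 / (δ * x)) +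
        (κ * x) ^ 2 * sieveC * w * (1 + κ * x + δ * x) * ((2 / (δ * x)) * (2 / (δ * x))) +
        x ^ 2 * (sieveC * (1 / 16) ^ b) * w * (1 + x + δ * x) * ((2 / (δ * x)) * (2 / (δ * x))) := by
        gcongr
    _ = _ := by field_simp; ring

theorem eventually_lam2_rough_dist {ε : ℝ} (hε : 0 < ε) : ∀ᶠ b : ℕ in atTop, ∀ R : ℝ, 0 ≤ R →
    ∀ᶠ X : ℝ in atTop, ∃ c : ℝ, ∀ u v : ℝ, 1 ≤ u → u ≤ v → v ≤ X → log X - log u ≤ R →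
    X ^ (1 - kap b / 4) ≤ v - u →
    |∑ n ∈ Ioc ⌊u⌋₊ ⌊v⌋₊, lam2 n * roughI (yOf b X) n - c * (v - u)| ≤ ε * ((v - u) * log X) := by
  filter_upwards [eventually_sieveBound, tendsto_kap.eventually (eventually_le_nhds (b := 1 / 2)
    (by norm_num)), tendsto_gErr.eventually (eventually_lt_nhds hε)] with b hB hκ hg R hR
  have hκ0 := kap_pos b
  have hlog := tendsto_log_atTop
  have t1 : Tendsto (fun X : ℝ => (kap b / 4 * log X)) atTop atTop :=
    hlog.const_mul_atTop (by positivity)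
  have t2 : Tendsto (fun X : ℝ => exp (-(kap b / 4 * log X))) atTop (nhds 0) :=
    tendsto_exp_neg_atTop_nhds_zero.comp t1
  have t3 : Tendsto (fun X : ℝ => log X * exp (-(kap b / 4 * log X))) atTop (nhds 0) := by
    have h := ((tendsto_pow_mul_exp_neg_atTop_nhds_zero 1).comp t1).const_mul (4 / kap b)
    rw [mul_zero] at h
    refine h.congr fun X => ?_
    simp only [Function.comp, pow_one]
    field_simp
  have t4 : Tendsto (fun X : ℝ => (log X)⁻¹) atTop (nhds 0) := tendsto_inv_atTop_zero.comp hlog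
  have T : Tendsto (fun X : ℝ =>
      (2 + kap b ^ 2) * (log X * exp (-(kap b / 4 * log X))) + 2 * R * exp (-(kap b / 4 * log X)) +
      4 * R * sieveC / (1 / 2) ^ b * (log X)⁻¹ +
      4 * sieveC * (2 * (4 * b + 7)) ^ 2 * ((log X)⁻¹ + kap b + (1 / 2) ^ b) +
      4 * sieveC * (1 / 4) ^ b * ((log X)⁻¹ + 1 + (1 / 2) ^ b)) atTop (nhds (gErr b)) := by
    have := ((((t3.const_mul (2 + kap b ^ 2)).add (t2.const_mul (2 * R))).add
      (t4.const_mul (4 * R * sieveC / (1 / 2) ^ b))).add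
      (((t4.add_const (kap b)).add_const ((1 / 2) ^ b)).const_mul
        (4 * sieveC * (2 * (4 * b + 7)) ^ 2))).add
      (((t4.add_const 1).add_const ((1 / 2) ^ b)).const_mul (4 * sieveC * (1 / 4) ^ b))
    convert this using 2
    simp [gErr]
  have h2 : ∀ᶠ X : ℝ in atTop, log 2 ≤ (1 / 2 : ℝ) ^ b * log X :=
    (hlog.const_mul_atTop (show (0 : ℝ) < (1 / 2) ^ b by positivity)).eventually_ge_atTop _
  filter_upwards [T.eventually (eventually_lt_nhds hg), h2, hlog.eventually_ge_atTop 0]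
    with X hT h2 hx
  obtain ⟨c, hc⟩ := lam2_rough_error_le hR hκ (hB _) h2
  refine ⟨c, fun u v hu huv hvX hRu hw => (hc u v hu huv hvX hRu hw).trans ?_⟩
  have : 0 ≤ (v - u) * log X := mul_nonneg (sub_nonneg.2 huv) hx
  gcongr

lemma sum_div_piece_bounds {f : ℕ → ℝ} (hf : ∀ n, 0 ≤ f n) {c e u v : ℝ} (hu : 0 < u) (huv : u ≤ v)
    (h : |∑ n ∈ Ioc ⌊u⌋₊ ⌊v⌋₊, f n - c * (v - u)| ≤ e * (v - u)) :
    (c - e) * ((v - u) / v) ≤ ∑ n ∈ Ioc ⌊u⌋₊ ⌊v⌋₊, f n / n ∧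
      ∑ n ∈ Ioc ⌊u⌋₊ ⌊v⌋₊, f n / n ≤ (c + e) * ((v - u) / u) := by
  have hv : 0 < v := hu.trans_le huv
  have hn : ∀ n ∈ Ioc ⌊u⌋₊ ⌊v⌋₊, u < n ∧ (n : ℝ) ≤ v := fun n hn => by
    have hn := mem_Ioc.1 hn
    exact ⟨(Nat.floor_lt hu.le).1 hn.1, (Nat.le_floor_iff hv.le).1 hn.2⟩
  obtain ⟨h1, h2⟩ := abs_le.1 h
  constructor
  · calc (c - e) * ((v - u) / v) = ((c - e) * (v - u)) / v := by ring
      _ ≤ (∑ n ∈ Ioc ⌊u⌋₊ ⌊v⌋₊, f n) / v := by gcongr; linarith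
      _ ≤ _ := by
        rw [sum_div]
        refine sum_le_sum fun n hn' => ?_
        obtain ⟨a1, a2⟩ := hn n hn'
        have := hf n
        have : (0 : ℝ) < n := hu.trans a1
        gcongr
  · calc _ ≤ (∑ n ∈ Ioc ⌊u⌋₊ ⌊v⌋₊, f n) / u := by
          rw [sum_div]
          refine sum_le_sum fun n hn' => ?_
          obtain ⟨a1, a2⟩ := hn n hn'
          have := hf n
          gcongr
      _ ≤ ((c + e) * (v - u)) / u := by gcongr; linarith
      _ = _ := by ring

lemma sum_div_geom_bounds {f : ℕ → ℝ} (hf : ∀ n, 0 ≤ f n) {c e X τ : ℝ} (hX : 0 < X) (hτ : 0 < τ)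
    (N : ℕ) (h : ∀ j < N, |∑ n ∈ Ioc ⌊X * exp (-((j + 1 : ℕ) * τ))⌋₊ ⌊X * exp (-(j * τ))⌋₊, f n -
      c * (X * exp (-(j * τ)) - X * exp (-((j + 1 : ℕ) * τ)))| ≤
      e * (X * exp (-(j * τ)) - X * exp (-((j + 1 : ℕ) * τ)))) :
    N * ((c - e) * (1 - exp (-τ))) ≤ ∑ n ∈ Ioc ⌊X * exp (-(N * τ))⌋₊ ⌊X⌋₊, f n / n ∧
      ∑ n ∈ Ioc ⌊X * exp (-(N * τ))⌋₊ ⌊X⌋₊, f n / n ≤ N * ((c + e) * (exp τ - 1)) := by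
  induction N with
  | zero => simp
  | succ N ih =>
    obtain ⟨i1, i2⟩ := ih fun j hj => h j (by omega)
    have hexp : X * exp (-((N + 1 : ℕ) * τ)) = X * exp (-(N * τ)) * exp (-τ) := by
      rw [mul_assoc, ← exp_add]; congr 2; push_cast; ring
    have he1 : exp (-τ) ≤ 1 := exp_le_one_iff.2 (by linarith)
    have huv : X * exp (-((N + 1 : ℕ) * τ)) ≤ X * exp (-(N * τ)) := by
      rw [hexp]; exact mul_le_of_le_one_right (by positivity) he1
    have hX1 : X * exp (-(N * τ)) ≤ X :=
      mul_le_of_le_one_right hX.le (exp_le_one_iff.2 (by have : (0 : ℝ) ≤ N * τ := by positivity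
                                                         linarith))
    obtain ⟨p1, p2⟩ := sum_div_piece_bounds hf (by positivity) huv (h N (by omega))
    rw [← sum_Ioc_consecutive _ (Nat.floor_mono huv) (Nat.floor_mono hX1)]
    have q1 : (X * exp (-(N * τ)) - X * exp (-((N + 1 : ℕ) * τ))) / (X * exp (-(N * τ))) =
        1 - exp (-τ) := by
      rw [hexp]; field_simp
    have q2 : (X * exp (-(N * τ)) - X * exp (-((N + 1 : ℕ) * τ))) / (X * exp (-((N + 1 : ℕ) * τ))) =
        exp τ - 1 := by
      rw [hexp, exp_neg τ]
      have := (exp_pos τ).ne'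
      have := (exp_pos (-(N * τ))).ne'
      field_simp
    rw [q1] at p1
    rw [q2] at p2
    exact ⟨le_trans (le_of_eq (by push_cast; ring)) (add_le_add p1 i1),
      (add_le_add p2 i2).trans (le_of_eq (by push_cast; ring))⟩

/-- The logarithmic sum of `lam2` over rough numbers in a long multiplicative window. -/
lemma abs_sum_lam2_rough_div_sub_le {y : ℕ} (hy : 1 ≤ y) {X R : ℝ} (hR : 0 ≤ R) (hXR : exp R ≤ X) :
    |∑ n ∈ Ioc ⌊X * exp (-R)⌋₊ ⌊X⌋₊, lam2 n * roughI y n / n - 2 * R * log X| ≤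
      R ^ 2 + 4 * mertensC * log X + 2 * mertensC ^ 2 +
      (2 * y * log y * log X ^ 2 / (X * exp (-R)) + 4 * (log y + mertensC) * (R + 2 * mertensC)) := by
  have hX1 : 1 ≤ X := (one_le_exp hR).trans hXR
  have hX0 : 0 < X := by linarith
  have hu1 : 1 ≤ X * exp (-R) := by
    rw [exp_neg, ← div_eq_mul_inv, one_le_div (exp_pos _)]; exact hXR
  have hlu : log (X * exp (-R)) = log X - R := by
    rw [log_mul hX0.ne' (exp_pos _).ne', log_exp]; ring
  have huX : X * exp (-R) ≤ X := mul_le_of_le_one_right hX0.le (exp_le_one_iff.2 (by linarith))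
  have s1 := abs_le.1 (abs_sum_lam2_div_sub_le hX1)
  have s2 := abs_le.1 (abs_sum_lam2_div_sub_le hu1)
  rw [hlu] at s2
  have s3 := sum_lam2_not_rough_le hy (by linarith) huX hX1 hR
    (by rw [mul_assoc, ← exp_add]; simp)
  have e1 : ∑ n ∈ Ioc ⌊X * exp (-R)⌋₊ ⌊X⌋₊, lam2 n / n =
      ∑ n ∈ Ioc 0 ⌊X⌋₊, lam2 n / n - ∑ n ∈ Ioc 0 ⌊X * exp (-R)⌋₊, lam2 n / n := by
    rw [← sum_Ioc_consecutive _ (Nat.zero_le _) (Nat.floor_mono huX)]; ring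
  have e2 : ∑ n ∈ Ioc ⌊X * exp (-R)⌋₊ ⌊X⌋₊, lam2 n * roughI y n / n +
      ∑ n ∈ (Ioc ⌊X * exp (-R)⌋₊ ⌊X⌋₊).filter (¬ Rough y ·), lam2 n / n =
      ∑ n ∈ Ioc ⌊X * exp (-R)⌋₊ ⌊X⌋₊, lam2 n / n := by
    rw [← sum_filter_add_sum_filter_not (Ioc ⌊X * exp (-R)⌋₊ ⌊X⌋₊) (Rough y)
      (fun n => lam2 n / (n : ℝ))]
    congr 1
    rw [sum_filter]
    refine sum_congr rfl fun n _ => ?_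
    unfold roughI; split_ifs <;> simp
  have h0 : 0 ≤ ∑ n ∈ (Ioc ⌊X * exp (-R)⌋₊ ⌊X⌋₊).filter (¬ Rough y ·), lam2 n / n :=
    sum_nonneg fun n _ => div_nonneg (lam2_nonneg n) (Nat.cast_nonneg n)
  have hmC := mertensC_pos
  have hl : 0 ≤ log X := log_nonneg hX1
  have hlR : R ≤ log X := (le_log_iff_exp_le hX0).2 hXR
  have hR2 : mertensC * (log X - R) ≤ mertensC * log X := by nlinarith
  rw [abs_le]
  have := sq_nonneg R
  constructor <;> nlinarith

lemma abs_sub_two_mul_le {ε c x T : ℝ} {n : ℕ} (hε : 0 < ε) (hε1 : ε ≤ 1) (hx : 0 < x)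
    (hn : 16 / ε ≤ n)
    (h1 : ((n ^ 2 : ℕ) : ℝ) * ((c - ε / 4 * x) * (1 - exp (-(1 / (n : ℝ))))) ≤ T)
    (h2 : T ≤ ((n ^ 2 : ℕ) : ℝ) * ((c + ε / 4 * x) * (exp (1 / (n : ℝ)) - 1)))
    (hT : |T - 2 * n * x| ≤ ε / 16 * n * x) : |c - 2 * x| ≤ 3 / 4 * ε * x := by
  have hn0 : (16 : ℝ) ≤ n := le_trans (by rw [le_div_iff₀ hε]; linarith) hn
  have hn' : 0 < (n : ℝ) := by linarith
  set t := 1 / (n : ℝ) with ht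
  have hnt : n * t = 1 := by rw [ht]; field_simp
  have htε : t ≤ ε / 16 := by
    rw [ht, div_le_iff₀ hn']
    rw [div_le_iff₀ hε] at hn
    linarith
  have ht0 : 0 < t := by positivity
  have ht1 : |t| ≤ 1 := by rw [abs_of_pos ht0]; linarith
  have e1 := abs_le.1 (abs_exp_sub_one_sub_id_le ht1)
  have e2 := abs_le.1 (abs_exp_sub_one_sub_id_le (x := -t) (by rwa [abs_neg]))
  rw [abs_le] at hT
  set p := n * (1 - exp (-t)) with hp
  set q := n * (exp t - 1) with hq
  have nt2 : n * t ^ 2 = t := by rw [sq, ← mul_assoc, hnt, one_mul]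
  have hp1 : 1 - ε / 16 ≤ p := by
    have : n * (t - t ^ 2) ≤ p := by
      rw [hp]; exact mul_le_mul_of_nonneg_left (by nlinarith [e2.2]) hn'.le
    linarith
  have hq1 : q ≤ 1 + ε / 16 := by
    have : q ≤ n * (t + t ^ 2) := by
      rw [hq]; exact mul_le_mul_of_nonneg_left (by linarith [e1.2]) hn'.le
    linarith
  have hq0 : 0 < q := by
    have : n * (t - t ^ 2) ≤ q := by
      rw [hq]; exact mul_le_mul_of_nonneg_left (by linarith [e1.1]) hn'.le
    linarith
  have k1 : (c - ε / 4 * x) * p ≤ (2 + ε / 16) * x := by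
    refine le_of_mul_le_mul_left ?_ hn'
    calc n * ((c - ε / 4 * x) * p) = ((n ^ 2 : ℕ) : ℝ) * ((c - ε / 4 * x) * (1 - exp (-t))) := by
          rw [hp]; push_cast; ring
      _ ≤ T := h1
      _ ≤ _ := by linarith [hT.2]
  have k2 : (2 - ε / 16) * x ≤ (c + ε / 4 * x) * q := by
    refine le_of_mul_le_mul_left ?_ hn'
    calc n * ((2 - ε / 16) * x) ≤ T := by linarith [hT.1]
      _ ≤ ((n ^ 2 : ℕ) : ℝ) * ((c + ε / 4 * x) * (exp t - 1)) := h2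
      _ = _ := by rw [hq]; push_cast; ring
  have hp0 : 0 < p := by linarith
  have m1 : c - ε / 4 * x ≤ (2 + ε / 2) * x := by
    by_contra hcon
    push Not at hcon
    have : (2 + ε / 2) * x * (1 - ε / 16) < (c - ε / 4 * x) * p :=
      mul_lt_mul hcon hp1 (by linarith) (le_trans (by positivity) hcon.le)
    nlinarith [mul_pos hε hx]
  have m2 : (2 - ε / 2) * x ≤ c + ε / 4 * x := by
    by_contra hcon
    push Not at hcon
    have h0 : 0 ≤ (2 - ε / 2) * x := by
      have : 0 ≤ 2 - ε / 2 := by linarith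
      positivity
    have h1 : 0 ≤ (2 - ε / 16) * x := by
      have : 0 ≤ 2 - ε / 16 := by linarith
      positivity
    have h3 : 0 ≤ c + ε / 4 * x := nonneg_of_mul_nonneg_left (h1.trans k2) hq0
    have : (c + ε / 4 * x) * q ≤ (2 - ε / 2) * x * (1 + ε / 16) := mul_le_mul hcon.le hq1 hq0.le h0
    nlinarith [mul_pos hε hx]
  rw [abs_le]
  constructor <;> nlinarith

lemma lam2_rough_geom_bounds {y n : ℕ} {X c e κ : ℝ} (hn' : 0 < (n : ℝ)) (hXn : exp n ≤ X)
    (t1 : exp n / (1 - exp (-(1 / (n : ℝ)))) ≤ X ^ κ)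
    (hc : ∀ u v : ℝ, 1 ≤ u → u ≤ v → v ≤ X → log X - log u ≤ n → X ^ (1 - κ) ≤ v - u →
      |∑ i ∈ Ioc ⌊u⌋₊ ⌊v⌋₊, lam2 i * roughI y i - c * (v - u)| ≤ e * (v - u)) :
    ((n ^ 2 : ℕ) : ℝ) * ((c - e) * (1 - exp (-(1 / (n : ℝ))))) ≤
        ∑ i ∈ Ioc ⌊X * exp (-(n : ℝ))⌋₊ ⌊X⌋₊, lam2 i * roughI y i / i ∧
      ∑ i ∈ Ioc ⌊X * exp (-(n : ℝ))⌋₊ ⌊X⌋₊, lam2 i * roughI y i / i ≤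
        ((n ^ 2 : ℕ) : ℝ) * ((c + e) * (exp (1 / (n : ℝ)) - 1)) := by
  have hX0 : 0 < X := (exp_pos _).trans_le hXn
  have hτ : 0 < 1 / (n : ℝ) := by positivity
  have he1 : 0 < 1 - exp (-(1 / (n : ℝ))) := by
    have : exp (-(1 / (n : ℝ))) < 1 := by
      rw [exp_lt_one_iff]; linarith
    linarith
  have key := sum_div_geom_bounds (f := fun i => lam2 i * roughI (y) i)
    (fun i => mul_nonneg (lam2_nonneg i) (roughI_nonneg _ i)) (c := c) (e := e) hX0 hτ (n ^ 2)
    (fun j hj => by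
      have hj1 : ((j + 1 : ℕ) : ℝ) * (1 / n) ≤ n := by
        have : ((j + 1 : ℕ) : ℝ) ≤ ((n ^ 2 : ℕ) : ℝ) := by exact_mod_cast hj
        rw [mul_one_div, div_le_iff₀ hn']
        push_cast at this ⊢
        linarith
      have hj0 : (0 : ℝ) ≤ j * (1 / n) := by positivity
      have hs : ((j + 1 : ℕ) : ℝ) * (1 / n) = j * (1 / n) + 1 / n := by push_cast; ring
      have hexp : X * exp (-((j + 1 : ℕ) * (1 / (n : ℝ)))) =
          X * exp (-(j * (1 / (n : ℝ)))) * exp (-(1 / (n : ℝ))) := by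
        rw [hs, mul_assoc, ← exp_add]; congr 2; ring
      refine (hc _ _ ?_ ?_ ?_ ?_ ?_)
      · rw [← exp_log hX0, ← exp_add]
        refine one_le_exp ?_
        have : (n : ℝ) ≤ log X := (le_log_iff_exp_le hX0).2 hXn
        linarith
      · gcongr
        omega
      · exact mul_le_of_le_one_right hX0.le (exp_le_one_iff.2 (by linarith))
      · rw [log_mul hX0.ne' (exp_pos _).ne', log_exp]; linarith
      · rw [hexp, ← mul_one_sub]
        have h3 : exp (-(n : ℝ)) ≤ exp (-(j * (1 / (n : ℝ)))) := exp_le_exp.2 (by linarith)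
        calc X ^ (1 - κ) = X * exp (-(n : ℝ)) * (exp n / X ^ (κ)) := by
              rw [rpow_sub hX0, rpow_one, exp_neg]
              have := (exp_pos (n : ℝ)).ne'
              field_simp
          _ ≤ X * exp (-(j * (1 / (n : ℝ)))) * (1 - exp (-(1 / (n : ℝ)))) := by
              have : exp n / X ^ (κ) ≤ 1 - exp (-(1 / (n : ℝ))) := by
                have hp : 0 < X ^ (κ) := by positivity
                rw [div_le_iff₀ he1] at t1
                rw [div_le_iff₀ hp]
                linarith
              gcongr)
  have hNn : ((n ^ 2 : ℕ) : ℝ) * (1 / n) = n := by push_cast; field_simp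
  rwa [hNn] at key

lemma abs_sum_lam2_yOf_div_sub_le {ε X n : ℝ} {b : ℕ} (hε : 0 < ε) (hn' : 0 < n)
    (hXn : exp n ≤ X) (hx1 : 1 ≤ log X) (hδ : (1 / 2 : ℝ) ^ b ≤ 1 / 2)
    (hδ2 : (1 / 2 : ℝ) ^ b ≤ ε / (256 * (1 + 2 * mertensC)))
    (t2 : n ^ 2 + 2 * mertensC ^ 2 + 4 * mertensC * (n + 2 * mertensC) ≤ ε / 64 * n * log X)
    (t3 : 2 * exp n * (log X ^ 2 * exp (-(1 / 2 * log X))) ≤ ε / 64 * n)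
    (h2 : log 2 ≤ (1 / 2 : ℝ) ^ b * log X) (hn0 : 16 ≤ n) (hn2 : 256 * mertensC ≤ ε * n) :
    |∑ i ∈ Ioc ⌊X * exp (-n)⌋₊ ⌊X⌋₊, lam2 i * roughI (yOf b X) i / i - 2 * n * log X| ≤
      ε / 16 * n * log X := by
  have hmC := mertensC_pos
  obtain ⟨l1, l2⟩ := log_yOf_bounds h2
  have hy1 : 1 ≤ yOf b X := Nat.one_le_two_pow
  generalize yOf b X = y at *
  have hX0 : 0 < X := (exp_pos _).trans_le hXn
  have hT := abs_sum_lam2_rough_div_sub_le hy1 hn'.le hXn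
  set x := log X with hxdef
  have hXe : X = exp x := (exp_log hX0).symm
  have hy0 : (0 : ℝ) < y := by exact_mod_cast hy1
  have hl0 : 0 ≤ log (y : ℝ) := log_nonneg (by exact_mod_cast hy1)
  have hl1 : log (y : ℝ) ≤ 1 / 2 * x := l2.trans (by gcongr)
  have hye : (y : ℝ) ≤ exp (1 / 2 * x) := (log_le_iff_le_exp hy0).1 hl1
  have b1 : 2 * y * log y * x ^ 2 / (X * exp (-n)) ≤ ε / 64 * n * x := by
    calc 2 * y * log y * x ^ 2 / (X * exp (-n)) ≤
          2 * exp (1 / 2 * x) * (1 / 2 * x) * x ^ 2 / (X * exp (-n)) := by gcongr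
      _ = 1 / 2 * (2 * exp n * (x ^ 2 * exp (-(1 / 2 * x)))) * x := by
          have hx2 : X = exp (1 / 2 * x) * exp (1 / 2 * x) := by rw [hXe, ← exp_add]; congr 1; ring
          rw [exp_neg, exp_neg, hx2]
          have := (exp_pos n).ne'
          have := (exp_pos (1 / 2 * x)).ne'
          field_simp
      _ ≤ 1 / 2 * (ε / 64 * n) * x := by gcongr
      _ ≤ _ := by
          have : 0 ≤ ε / 64 * n * x := by positivity
          linarith
  have b2 : 4 * log y * (n + 2 * mertensC) ≤ ε / 64 * n * x := by
    have hd : (1 / 2 : ℝ) ^ b * (256 * (1 + 2 * mertensC)) ≤ ε :=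
      (le_div_iff₀ (by positivity)).1 hδ2
    calc 4 * log y * (n + 2 * mertensC) ≤ 4 * ((1 / 2 : ℝ) ^ b * x) * (n * (1 + 2 * mertensC)) := by
          gcongr
          nlinarith
      _ = (1 / 2 : ℝ) ^ b * (256 * (1 + 2 * mertensC)) * (n * x / 64) := by ring
      _ ≤ ε * (n * x / 64) := by gcongr
      _ = _ := by ring
  have b3 : 4 * mertensC * x ≤ ε / 64 * n * x := by nlinarith
  exact hT.trans (by nlinarith)

/-- `lam2` is equidistributed over rough numbers in short intervals. -/
theorem eventually_lam2_rough {ε : ℝ} (hε : 0 < ε) (hε1 : ε ≤ 1) : ∀ᶠ b : ℕ in atTop,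
    ∀ᶠ X : ℝ in atTop, ∀ u v : ℝ, 1 ≤ u → u ≤ v → v ≤ X → log X - log u ≤ 1 →
    X ^ (1 - kap b / 4) ≤ v - u →
    |∑ n ∈ Ioc ⌊u⌋₊ ⌊v⌋₊, lam2 n * roughI (yOf b X) n - 2 * log X * (v - u)| ≤
      ε * ((v - u) * log X) := by
  have hmC := mertensC_pos
  obtain ⟨n, hn⟩ := exists_nat_ge (16 / ε + 256 * mertensC / ε)
  have hn1 : 16 / ε ≤ n := le_trans (by linarith [show 0 ≤ 256 * mertensC / ε by positivity]) hn
  have hn2 : 256 * mertensC ≤ ε * n := by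
    have : 256 * mertensC / ε ≤ n := le_trans (by linarith [show 0 ≤ 16 / ε by positivity]) hn
    rw [div_le_iff₀ hε] at this
    linarith
  have hn0 : (16 : ℝ) ≤ n := le_trans (by rw [le_div_iff₀ hε]; linarith) hn1
  have hn' : 0 < (n : ℝ) := by linarith
  have hδ0 : Tendsto (fun b : ℕ => (1 / 2 : ℝ) ^ b) atTop (nhds 0) :=
    tendsto_pow_atTop_nhds_zero_of_lt_one (by norm_num) (by norm_num)
  filter_upwards [eventually_lam2_rough_dist (show 0 < ε / 4 by positivity),
    hδ0.eventually (eventually_le_nhds (b := 1 / 2) (by norm_num)),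
    hδ0.eventually (eventually_le_nhds (b := ε / (256 * (1 + 2 * mertensC))) (by positivity))]
    with b hb hδ hδ2
  have hlog := tendsto_log_atTop
  have hκ := kap_pos b
  have hlen : Tendsto (fun X : ℝ => X ^ (kap b / 4)) atTop atTop := tendsto_rpow_atTop (by positivity)
  have t1 : ∀ᶠ X : ℝ in atTop, exp n / (1 - exp (-(1 / (n : ℝ)))) ≤ X ^ (kap b / 4) :=
    hlen.eventually_ge_atTop _
  have t2 : ∀ᶠ X : ℝ in atTop, (n : ℝ) ^ 2 + 2 * mertensC ^ 2 + 4 * mertensC * (n + 2 * mertensC) ≤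
      ε / 64 * n * log X := (hlog.const_mul_atTop (by positivity)).eventually_ge_atTop _
  have t3 : ∀ᶠ X : ℝ in atTop, 2 * exp n * (log X ^ 2 * exp (-(1 / 2 * log X))) ≤ ε / 64 * n := by
    have h := ((tendsto_pow_mul_exp_neg_atTop_nhds_zero 2).comp
      (hlog.const_mul_atTop (show (0 : ℝ) < 1 / 2 by norm_num))).const_mul (8 * exp n)
    rw [mul_zero] at h
    filter_upwards [h.eventually (eventually_le_nhds (b := ε / 64 * n) (by positivity))] with X hX
    refine le_trans (le_of_eq ?_) hX
    simp only [Function.comp]; ring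
  have h2 : ∀ᶠ X : ℝ in atTop, log 2 ≤ (1 / 2 : ℝ) ^ b * log X :=
    (hlog.const_mul_atTop (show (0 : ℝ) < (1 / 2) ^ b by positivity)).eventually_ge_atTop _
  filter_upwards [hb n hn'.le, t1, t2, t3, h2, hlog.eventually_ge_atTop 1,
    eventually_ge_atTop (exp n)] with X hX t1 t2 t3 h2 hx1 hXn
  obtain ⟨c, hc⟩ := hX
  have hX0 : 0 < X := (exp_pos _).trans_le hXn
  set x := log X with hxdef
  have hXe : X = exp x := (exp_log hX0).symm
  have key := lam2_rough_geom_bounds (y := yOf b X) (c := c) (e := ε / 4 * x) (by linarith) hXn t1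
    fun u v h1 h2 h3 h4 h5 => (hc u v h1 h2 h3 h4 h5).trans (le_of_eq (by ring))
  have hfin := abs_sub_two_mul_le hε hε1 (by linarith) hn1 key.1 key.2
    (abs_sum_lam2_yOf_div_sub_le hε hn' hXn hx1 hδ hδ2 t2 t3 h2 hn0 hn2)
  set y := yOf b X
  intro u v hu huv hvX hlu hw
  have h9 := hc u v hu huv hvX (by linarith) hw
  have huv0 : 0 ≤ v - u := sub_nonneg.2 huv
  have h10 : |(c - 2 * x) * (v - u)| ≤ 3 / 4 * ε * x * (v - u) := by
    rw [abs_mul, abs_of_nonneg huv0]; gcongr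
  calc _ = |(∑ n ∈ Ioc ⌊u⌋₊ ⌊v⌋₊, lam2 n * roughI y n - c * (v - u)) + (c - 2 * x) * (v - u)| := by
        congr 1; ring
    _ ≤ ε / 4 * ((v - u) * x) + 3 / 4 * ε * x * (v - u) := (abs_add_le _ _).trans (add_le_add h9 h10)
    _ = _ := by ring

lemma lam2_nonneg_mul_roughI (y n : ℕ) : 0 ≤ lam2 n * roughI y n :=
  mul_nonneg (lam2_nonneg n) (roughI_nonneg _ n)

lemma vonMangoldt_window_of_rough {y : ℕ} {x r e : ℝ} (hy : 1 ≤ y) (hx : 1 < x) (hr : 0 < r) (hr1 : r ≤ 1)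
    (h : |∑ n ∈ Ioc ⌊exp (x - r)⌋₊ ⌊exp x⌋₊, lam2 n * roughI y n - 2 * x * (exp x - exp (x - r))| ≤
      e * x * (exp x - exp (x - r))) (he : 0 ≤ e) (he2 : e ≤ 2) :
    ∑ n ∈ Ioc ⌊exp (x - r)⌋₊ ⌊exp x⌋₊, Λ n / n ≤
        (2 + e) * x * (r + r ^ 2) / (x - r) + 2 * y * log y * x / exp (x - r) ∧
      (2 - e) * x * (r - r ^ 2) ≤ ∑ n ∈ Ioc ⌊exp (x - r)⌋₊ ⌊exp x⌋₊, (Λ * Λ) n / n +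
        x * ∑ n ∈ Ioc ⌊exp (x - r)⌋₊ ⌊exp x⌋₊, Λ n / n := by
  have huv : exp (x - r) ≤ exp x := exp_le_exp.2 (by linarith)
  have hev : exp (x - r) = exp x * exp (-r) := by rw [← exp_add]; congr 1
  have heu : exp x = exp (x - r) * exp r := by rw [← exp_add]; congr 1; ring
  obtain ⟨k1, k2⟩ := sum_div_piece_bounds (fun n => lam2_nonneg_mul_roughI y n) (exp_pos _) huv
    (c := 2 * x) (e := e * x) h
  have a1 := abs_le.1 (abs_exp_sub_one_sub_id_le (x := r) (by rwa [abs_of_pos hr]))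
  have a2 := abs_le.1 (abs_exp_sub_one_sub_id_le (x := -r) (by rwa [abs_neg, abs_of_pos hr]))
  have w1 : r - r ^ 2 ≤ (exp x - exp (x - r)) / exp x := by
    have : (exp x - exp (x - r)) / exp x = 1 - exp (-r) := by rw [hev]; field_simp
    rw [this]; nlinarith [a2.2]
  have w2 : (exp x - exp (x - r)) / exp (x - r) ≤ r + r ^ 2 := by
    have : (exp x - exp (x - r)) / exp (x - r) = exp r - 1 := by
      rw [heu]; field_simp
    rw [this]; linarith [a1.2]
  have hn : ∀ n ∈ Ioc ⌊exp (x - r)⌋₊ ⌊exp x⌋₊, 0 < (n : ℝ) ∧ exp (x - r) ≤ n ∧ x - r ≤ log n ∧ log n ≤ x :=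
    fun n hn => by
      have hn := mem_Ioc.1 hn
      have b1 := (Nat.floor_lt (exp_pos _).le).1 hn.1
      have b2 := (Nat.le_floor_iff (exp_pos _).le).1 hn.2
      have b3 : (0 : ℝ) < n := (exp_pos _).trans b1
      exact ⟨b3, b1.le, (le_log_iff_exp_le b3).2 b1.le, (log_le_iff_le_exp b3).2 b2⟩
  constructor
  · have hxr : 0 < x - r := by linarith
    have e1 : ∑ n ∈ Ioc ⌊exp (x - r)⌋₊ ⌊exp x⌋₊, Λ n / n =
        ∑ n ∈ (Ioc ⌊exp (x - r)⌋₊ ⌊exp x⌋₊).filter (Rough y), Λ n / n +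
        ∑ n ∈ (Ioc ⌊exp (x - r)⌋₊ ⌊exp x⌋₊).filter (¬ Rough y ·), Λ n / n :=
      (sum_filter_add_sum_filter_not _ _ _).symm
    rw [e1]
    refine add_le_add ?_ ?_
    · calc ∑ n ∈ (Ioc ⌊exp (x - r)⌋₊ ⌊exp x⌋₊).filter (Rough y), Λ n / n ≤
            ∑ n ∈ Ioc ⌊exp (x - r)⌋₊ ⌊exp x⌋₊, (lam2 n * roughI y n / n) / (x - r) := by
            rw [sum_filter]
            refine sum_le_sum fun n hn' => ?_
            obtain ⟨p0, p1, p2, p3⟩ := hn n hn'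
            unfold roughI
            split_ifs with hR
            · rw [mul_one, div_right_comm]
              gcongr
              rw [le_div_iff₀ hxr]
              refine le_trans ?_ (vonMangoldt_mul_log_le_lam2 n)
              gcongr
            · simp
        _ ≤ (2 * x + e * x) * ((exp x - exp (x - r)) / exp (x - r)) / (x - r) := by
            rw [← sum_div]; gcongr
        _ ≤ (2 * x + e * x) * (r + r ^ 2) / (x - r) := by gcongr
        _ = _ := by ring
    · have hN : ⌊exp x⌋₊ ≠ 0 := (Nat.floor_pos.2 (one_le_exp (by linarith))).ne'
      calc _ ≤ ∑ n ∈ (Ioc ⌊exp (x - r)⌋₊ ⌊exp x⌋₊).filter (¬ Rough y ·), Λ n / exp (x - r) := by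
            refine sum_le_sum fun n hn' => ?_
            obtain ⟨p0, p1, p2, p3⟩ := hn n (mem_filter.1 hn').1
            have := ArithmeticFunction.vonMangoldt_nonneg (n := n)
            gcongr
        _ ≤ (∑ n ∈ (Ioc 0 ⌊exp x⌋₊).filter (¬ Rough y ·), Λ n) / exp (x - r) := by
            rw [← sum_div]
            refine div_le_div_of_nonneg_right ?_ (exp_pos _).le
            refine sum_le_sum_of_subset_of_nonneg (filter_subset_filter _ (Ioc_subset_Ioc_left (Nat.zero_le _)))
              fun n _ _ => ArithmeticFunction.vonMangoldt_nonneg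
        _ ≤ (2 * y * log y * log (⌊exp x⌋₊ : ℝ)) / exp (x - r) := by
            gcongr
            exact sum_vonMangoldt_not_rough_le_log hN hy
        _ ≤ _ := by
            have h0 : (0 : ℝ) < ⌊exp x⌋₊ := by exact_mod_cast Nat.pos_of_ne_zero hN
            have : log (⌊exp x⌋₊ : ℝ) ≤ x := (log_le_iff_le_exp h0).2 (Nat.floor_le (exp_pos _).le)
            have : 0 ≤ log (y : ℝ) := log_nonneg (by exact_mod_cast hy)
            gcongr
  · calc (2 - e) * x * (r - r ^ 2) ≤ (2 * x - e * x) * ((exp x - exp (x - r)) / exp x) := by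
          have : 0 ≤ 2 - e := by linarith
          rw [← sub_mul]
          gcongr
      _ ≤ _ := k1
      _ ≤ _ := by
          rw [mul_sum, ← sum_add_distrib]
          refine sum_le_sum fun n hn' => ?_
          obtain ⟨p0, p1, p2, p3⟩ := hn n hn'
          have h1 : lam2 n * roughI y n ≤ lam2 n :=
            mul_le_of_le_one_right (lam2_nonneg n) (roughI_le_one _ n)
          have h2 : lam2 n = Λ n * log n + (Λ * Λ) n := lam2_apply n
          have h3 : Λ n * log n ≤ Λ n * x :=
            mul_le_mul_of_nonneg_left p3 ArithmeticFunction.vonMangoldt_nonneg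
          rw [← mul_div_assoc, ← add_div]
          gcongr
          linarith

/-- Upper bound for primes and Selberg-type lower bound in multiplicatively short windows. -/
theorem exists_vonMangoldt_window {ε : ℝ} (hε : 0 < ε) (hε1 : ε ≤ 1) : ∃ κ : ℝ, 0 < κ ∧ κ ≤ 1 / 4 ∧
    ∀ᶠ x : ℝ in atTop, ∀ r : ℝ, exp (-(κ * x)) ≤ r → r ≤ ε / 16 →
      ∑ n ∈ Ioc ⌊exp (x - r)⌋₊ ⌊exp x⌋₊, Λ n / n ≤ (2 + ε) * r ∧
      (2 - ε) * r * x ≤ ∑ n ∈ Ioc ⌊exp (x - r)⌋₊ ⌊exp x⌋₊, (Λ * Λ) n / n +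
        x * ∑ n ∈ Ioc ⌊exp (x - r)⌋₊ ⌊exp x⌋₊, Λ n / n := by
  have hδ0 : Tendsto (fun b : ℕ => (1 / 2 : ℝ) ^ b) atTop (nhds 0) :=
    tendsto_pow_atTop_nhds_zero_of_lt_one (by norm_num) (by norm_num)
  obtain ⟨b, hb, hδ⟩ := ((eventually_lam2_rough (show 0 < ε / 4 by positivity) (by linarith)).and
    (hδ0.eventually (eventually_le_nhds (b := 1 / 4) (by norm_num)))).exists
  have hk := kap_pos b
  refine ⟨min (kap b / 8) (1 / 4), by positivity, min_le_right _ _, ?_⟩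
  set κ := min (kap b / 8) (1 / 4) with hκdef
  have hκ1 : κ ≤ kap b / 8 := min_le_left _ _
  have hκ2 : κ ≤ 1 / 4 := min_le_right _ _
  have t1 := tendsto_exp_atTop.eventually hb
  have t2 : ∀ᶠ x : ℝ in atTop, 2 ≤ exp (kap b / 8 * x) :=
    (tendsto_exp_atTop.comp (tendsto_id.const_mul_atTop (by positivity))).eventually_ge_atTop 2
  have t3 : ∀ᶠ x : ℝ in atTop, 2 * (x ^ 2 * exp (-(1 / 4 * x))) ≤ ε / 16 := by
    have h := ((tendsto_pow_mul_exp_neg_atTop_nhds_zero 2).comp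
      (tendsto_id.const_mul_atTop (show (0 : ℝ) < 1 / 4 by norm_num))).const_mul (2 * 16)
    rw [mul_zero] at h
    filter_upwards [h.eventually (eventually_le_nhds (b := ε / 16) (by positivity))] with X hX
    refine le_trans (le_of_eq ?_) hX
    simp only [Function.comp, id]; ring
  have t4 : ∀ᶠ x : ℝ in atTop, log 2 ≤ (1 / 2 : ℝ) ^ b * x :=
    (tendsto_id.const_mul_atTop (show (0 : ℝ) < (1 / 2) ^ b by positivity)).eventually_ge_atTop _
  filter_upwards [t1, t2, t3, t4, eventually_gt_atTop 1, eventually_ge_atTop (16 / ε)]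
    with x t1 t2 t3 t4 hx hx2 r hr1 hr2
  have hr0 : 0 < r := (exp_pos _).trans_le hr1
  have hrl : r ≤ 1 := by linarith
  have hxε : 16 ≤ ε * x := by rwa [div_le_iff₀ hε, mul_comm] at hx2
  rw [show log 2 ≤ (1 / 2 : ℝ) ^ b * x ↔ log 2 ≤ (1 / 2 : ℝ) ^ b * log (exp x) by rw [log_exp]] at t4
  obtain ⟨l1, l2⟩ := log_yOf_bounds t4
  have hy1 : 1 ≤ yOf b (exp x) := Nat.one_le_two_pow
  have hw : exp x ^ (1 - kap b / 4) ≤ exp x - exp (x - r) := by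
    have e1 : exp x - exp (x - r) = exp x * (1 - exp (-r)) := by
      rw [sub_eq_add_neg x r, exp_add]; ring
    have a2 := abs_le.1 (abs_exp_sub_one_sub_id_le (x := -r) (by rwa [abs_neg, abs_of_pos hr0]))
    have e2 : r / 2 ≤ 1 - exp (-r) := by nlinarith [a2.2]
    rw [e1, ← exp_mul]
    calc exp (x * (1 - kap b / 4)) = exp x * (exp (-(kap b / 8 * x)) * exp (-(kap b / 8 * x))) := by
          rw [← exp_add, ← exp_add]; congr 1; ring
      _ ≤ exp x * (1 / 2 * exp (-(κ * x))) := by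
          gcongr
          rw [exp_neg, one_div]
          exact inv_anti₀ (by norm_num) t2
      _ ≤ exp x * (1 - exp (-r)) := by gcongr; linarith
  have hdist := t1 (exp (x - r)) (exp x) (one_le_exp (by linarith)) (exp_le_exp.2 (by linarith)) le_rfl
    (by rw [log_exp, log_exp]; linarith) hw
  rw [log_exp] at l1 l2 hdist
  generalize yOf b (exp x) = y at *
  obtain ⟨k1, k2⟩ := vonMangoldt_window_of_rough hy1 hx hr0 hrl (e := ε / 4)
    (hdist.trans (le_of_eq (by ring))) (by linarith) (by linarith)
  have hrx : r ≤ ε * x / 16 * r := by nlinarith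
  refine ⟨k1.trans ?_, le_trans ?_ k2⟩
  · have hy0 : (0 : ℝ) < y := by exact_mod_cast hy1
    have hl0 : 0 ≤ log (y : ℝ) := log_nonneg (by exact_mod_cast hy1)
    have hl1 : log (y : ℝ) ≤ 1 / 4 * x := l2.trans (by gcongr)
    have hye : (y : ℝ) ≤ exp (1 / 4 * x) := (log_le_iff_le_exp hy0).1 hl1
    have p1 : 2 * y * log y * x / exp (x - r) ≤ ε / 16 * r := by
      calc 2 * y * log y * x / exp (x - r) ≤ 2 * exp (1 / 4 * x) * (1 / 4 * x) * x / exp (x - 1) := by gcongr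
        _ = 1 / 4 * exp 1 * (2 * (x ^ 2 * exp (-(1 / 4 * x)))) * exp (-(1 / 2 * x)) := by
            have : exp (x - 1) = exp (1 / 4 * x) * exp (1 / 4 * x) * exp (1 / 2 * x) * (exp 1)⁻¹ := by
              rw [← exp_neg, ← exp_add, ← exp_add, ← exp_add]; congr 1; ring
            rw [this, exp_neg, exp_neg]
            field_simp
        _ ≤ 1 / 4 * exp 1 * (ε / 16) * exp (-(κ * x)) := by
            gcongr; linarith
        _ ≤ 1 / 4 * 4 * (ε / 16) * r := by
            have := exp_one_lt_d9
            gcongr; linarith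
        _ = _ := by ring
    have p2 : (2 + ε / 4) * x * (r + r ^ 2) / (x - r) ≤ (2 + 3 / 4 * ε) * r := by
      rw [div_le_iff₀ (by linarith)]
      have h1 : r ^ 2 ≤ ε / 16 * r := by nlinarith
      have h2 : (2 + ε / 4) * x * (r + r ^ 2) ≤ (2 + ε / 4) * x * (r + ε / 16 * r) := by gcongr
      have h3 : (2 + 3 / 4 * ε) * r * r ≤ 3 * r * (ε / 16) * x := by
        calc (2 + 3 / 4 * ε) * r * r ≤ 3 * r * 1 := by gcongr; linarith
          _ ≤ 3 * r * (ε * x / 16) := by gcongr; linarith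
          _ = _ := by ring
      have h4 : 0 ≤ x * r * ε := by positivity
      have h5 : x * r * ε * ε ≤ x * r * ε := mul_le_of_le_one_right h4 hε1
      nlinarith
    linarith [mul_pos hε hr0]
  · have h1 : r ^ 2 ≤ ε / 16 * r := by nlinarith
    have h4 : 0 ≤ x * r * ε := by positivity
    have : (2 - ε / 4) * x * (r - ε / 16 * r) ≤ (2 - ε / 4) * x * (r - r ^ 2) := by
      have : 0 ≤ 2 - ε / 4 := by linarith
      gcongr
    have h5 : 0 ≤ x * r * ε * ε := by positivity
    refine le_trans ?_ this
    linarith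

/-- The `ℓ¹` distance between `b` and its translate by `t`. -/
noncomputable def transDist (b : ℤ → ℝ) (t : ℤ) : ℝ := ∑' v, |b (v + t) - b v|

section Translation

variable {b : ℤ → ℝ}

lemma summable_shift (hb : Summable b) (t : ℤ) : Summable fun v => b (v + t) :=
  (Equiv.addRight t).summable_iff.2 hb

lemma summable_refl (hb : Summable b) (k : ℤ) : Summable fun v => b (k - v) :=
  (Equiv.subLeft k).summable_iff.2 hb

lemma tsum_shift (f : ℤ → ℝ) (t : ℤ) : ∑' v, f (v + t) = ∑' v, f v :=
  (Equiv.addRight t).tsum_eq f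

lemma tsum_refl (f : ℤ → ℝ) (k : ℤ) : ∑' v, f (k - v) = ∑' v, f v :=
  (Equiv.subLeft k).tsum_eq f

lemma transDist_zero : transDist b 0 = 0 := by simp [transDist]

lemma transDist_add_le (hb : Summable b) (s t : ℤ) :
    transDist b (s + t) ≤ transDist b s + transDist b t := by
  have h1 : Summable fun v => |b (v + s + t) - b (v + s)| :=
    summable_shift (((summable_shift hb t).sub hb).abs) s
  have h2 : Summable fun v => |b (v + s) - b v| := ((summable_shift hb s).sub hb).abs
  calc transDist b (s + t) ≤ ∑' v, (|b (v + s + t) - b (v + s)| + |b (v + s) - b v|) := by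
        refine Summable.tsum_le_tsum (fun v => ?_) ((summable_shift hb _).sub hb).abs (h1.add h2)
        rw [← add_assoc]
        exact abs_sub_le _ _ _
    _ = _ := by
        rw [h1.tsum_add h2, tsum_shift (fun v => |b (v + t) - b v|) s, add_comm]; rfl

lemma abs_sub_le_add_sub_mul {x y : ℝ} (hx : 0 ≤ x) (hx1 : x ≤ 1) (hy : 0 ≤ y) (hy1 : y ≤ 1) :
    |x - y| ≤ x + y - 2 * (x * y) := by
  rw [abs_le]; constructor <;> nlinarith [mul_nonneg hx (sub_nonneg.2 hy1), mul_nonneg hy (sub_nonneg.2 hx1)]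

lemma summable_mul_refl (hb : Summable b) (h0 : ∀ v, 0 ≤ b v) (h1 : ∀ v, b v ≤ 1) (k : ℤ) :
    Summable fun v => b v * b (k - v) :=
  Summable.of_nonneg_of_le (fun _ => mul_nonneg (h0 _) (h0 _))
    (fun v => mul_le_of_le_one_right (h0 v) (h1 _)) hb

lemma tsum_mul_refl_le (hb : Summable b) (h0 : ∀ v, 0 ≤ b v) (h1 : ∀ v, b v ≤ 1) (k : ℤ) :
    ∑' v, b v * b (k - v) ≤ ∑' v, b v :=
  (summable_mul_refl hb h0 h1 k).tsum_le_tsum (fun v => mul_le_of_le_one_right (h0 v) (h1 _)) hb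

lemma tsum_abs_sub_refl_le (hb : Summable b) (h0 : ∀ v, 0 ≤ b v) (h1 : ∀ v, b v ≤ 1) (k : ℤ) :
    ∑' v, |b v - b (k - v)| ≤ 2 * (∑' v, b v - ∑' v, b v * b (k - v)) := by
  have hs := summable_mul_refl hb h0 h1 k
  have hr := summable_refl hb k
  calc _ ≤ ∑' v, (b v + b (k - v) - 2 * (b v * b (k - v))) :=
        Summable.tsum_le_tsum (fun _ => abs_sub_le_add_sub_mul (h0 _) (h1 _) (h0 _) (h1 _))
          (hb.sub hr).abs ((hb.add hr).sub (hs.mul_left 2))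
    _ = _ := by
        rw [(hb.add hr).tsum_sub (hs.mul_left 2), hb.tsum_add hr, tsum_refl b k, tsum_mul_left]; ring

lemma transDist_sub_le (hb : Summable b) (h0 : ∀ v, 0 ≤ b v) (h1 : ∀ v, b v ≤ 1) (k l : ℤ) :
    transDist b (k - l) ≤
    2 * (∑' v, b v - ∑' v, b v * b (k - v)) + 2 * (∑' v, b v - ∑' v, b v * b (l - v)) := by
  refine le_trans ?_ (add_le_add (tsum_abs_sub_refl_le hb h0 h1 k) (tsum_abs_sub_refl_le hb h0 h1 l))
  have s1 : Summable fun v => |b v - b (k - v)| := (hb.sub (summable_refl hb k)).abs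
  have s2 : Summable fun v => |b v - b (l - v)| := (hb.sub (summable_refl hb l)).abs
  have s3 := summable_shift s1 (k - l)
  rw [← tsum_shift (fun v => |b v - b (k - v)|) (k - l), ← s3.tsum_add s2]
  refine Summable.tsum_le_tsum (fun v => ?_) ((summable_shift hb _).sub hb).abs (s3.add s2)
  have e : k - (v + (k - l)) = l - v := by ring
  rw [e, abs_sub_comm (b v)]
  exact abs_sub_le _ _ _

lemma tsum_mul_one_sub_le (hb : Summable b) (h0 : ∀ v, 0 ≤ b v) (h1 : ∀ v, b v ≤ 1) (k : ℤ) :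
    ∑' v, b v * (1 - b v) ≤ 3 * (∑' v, b v - ∑' v, b v * b (k - v)) := by
  have hs := summable_mul_refl hb h0 h1 k
  have hr : Summable fun v => |b v - b (k - v)| := (hb.sub (summable_refl hb k)).abs
  have hq : Summable fun v => b v * (1 - b v) :=
    Summable.of_nonneg_of_le (fun v => mul_nonneg (h0 _) (sub_nonneg.2 (h1 _)))
      (fun v => mul_le_of_le_one_right (h0 v) (by linarith [h0 v])) hb
  have := tsum_abs_sub_refl_le hb h0 h1 k
  calc _ ≤ ∑' v, (b v - b v * b (k - v) + |b v - b (k - v)|) := by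
        refine hq.tsum_le_tsum (fun v => ?_) ((hb.sub hs).add hr)
        have e1 : b v * (b (k - v) - b v) ≤ 1 * |b v - b (k - v)| := by
          rw [abs_sub_comm, one_mul]
          rcases le_total 0 (b (k - v) - b v) with h | h
          · exact (mul_le_of_le_one_left h (h1 v)).trans (le_abs_self _)
          · exact (mul_nonpos_of_nonneg_of_nonpos (h0 v) h).trans (abs_nonneg _)
        linarith
    _ ≤ _ := by
        rw [(hb.sub hs).tsum_add hr, hb.tsum_sub hs]; linarith

lemma transDist_le_of_dense (hb : Summable b) {E : Finset ℤ} {a ℓ : ℤ} {m K : ℕ} {Δ : ℝ} (hΔ : 0 ≤ Δ)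
    (hE : ∀ k ∈ E, a ≤ k ∧ k < a + ℓ) (hEE : ∀ k ∈ E, ∀ l ∈ E, transDist b (k - l) ≤ Δ)
    (hadj : ∃ k ∈ E, k + 1 ∈ E) (hK : m + ℓ ≤ K * E.card) (t : ℕ) (ht : t < m) :
    transDist b t ≤ 3 * (K + 1) * Δ := by
  classical
  by_contra hcon
  push Not at hcon
  have h1 : transDist b 1 ≤ Δ := by
    obtain ⟨k, hk, hk1⟩ := hadj
    simpa using hEE _ hk1 _ hk
  have hex : ∀ j : ℕ, j < K + 1 → ∃ s : ℕ, 3 * (j + 1) * Δ < transDist b s := fun j hj =>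
    ⟨t, lt_of_le_of_lt (by
      have : (j : ℝ) + 1 ≤ K + 1 := by exact_mod_cast hj
      gcongr) hcon⟩
  have hsel : ∀ j : ℕ, ∃ s : ℕ, j < K + 1 →
      s < m ∧ 3 * (j + 1) * Δ < transDist b s ∧ transDist b s ≤ (3 * (j + 1) + 1) * Δ := fun j => by
    by_cases hj : j < K + 1
    swap
    · exact ⟨0, fun h => absurd h hj⟩
    refine ⟨Nat.find (hex j hj), fun _ => ⟨?_, Nat.find_spec (hex j hj), ?_⟩⟩
    · refine lt_of_le_of_lt (Nat.find_min' (hex j hj) ?_) ht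
      refine lt_of_le_of_lt ?_ hcon
      have : (j : ℝ) + 1 ≤ K + 1 := by exact_mod_cast hj
      gcongr
    · have hpos : Nat.find (hex j hj) ≠ 0 := by
        intro h
        have := Nat.find_spec (hex j hj)
        rw [h, Nat.cast_zero, transDist_zero] at this
        have : 0 ≤ 3 * ((j : ℝ) + 1) * Δ := by positivity
        linarith
      obtain ⟨s, hs⟩ := Nat.exists_eq_succ_of_ne_zero hpos
      have hmin := Nat.find_min (hex j hj) (m := s) (by omega)
      push Not at hmin
      rw [hs]
      have := transDist_add_le hb s 1
      push_cast
      linarith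
  choose s hs using hsel
  have hdisj : ∀ i j, i < j → j < K + 1 → Disjoint (E.image (· + (s i : ℤ))) (E.image (· + (s j : ℤ))) := by
    intro i j hij hj
    rw [disjoint_left]
    rintro z hz1 hz2
    obtain ⟨k, hk, rfl⟩ := mem_image.1 hz1
    obtain ⟨l, hl, hkl⟩ := mem_image.1 hz2
    obtain ⟨-, -, c1⟩ := hs i (by omega)
    obtain ⟨-, c2, -⟩ := hs j hj
    have := transDist_add_le hb (s i) (k - l)
    rw [show (s i : ℤ) + (k - l) = s j by linarith] at this
    have h3 := hEE k hk l hl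
    have : (i : ℝ) + 1 ≤ j := by exact_mod_cast hij
    nlinarith
  have hcard : ((range (K + 1)).biUnion fun j => E.image (· + (s j : ℤ))).card = (K + 1) * E.card := by
    rw [card_biUnion]
    · rw [sum_congr rfl (g := fun _ => E.card)
        fun j _ => card_image_of_injective _ (add_left_injective _)]
      simp
    · intro i hi j hj hij
      rcases lt_or_gt_of_ne hij with h | h
      · exact hdisj i j h (by simpa using hj)
      · exact (hdisj j i h (by simpa using hi)).symm
  have hsub : ((range (K + 1)).biUnion fun j => E.image (· + (s j : ℤ))) ⊆ Ico a (a + ℓ + m) := by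
    intro z hz
    obtain ⟨j, hj, hz⟩ := mem_biUnion.1 hz
    obtain ⟨k, hk, rfl⟩ := mem_image.1 hz
    obtain ⟨c1, -, -⟩ := hs j (by simpa using hj)
    obtain ⟨d1, d2⟩ := hE k hk
    simp only [mem_Ico]
    omega
  have hle := card_le_card hsub
  rw [hcard, Int.card_Ico] at hle
  obtain ⟨k, hk, -⟩ := hadj
  have hpos : 0 < E.card := card_pos.2 ⟨k, hk⟩
  obtain ⟨d1, d2⟩ := hE k hk
  have : ((K + 1) * E.card : ℤ) ≤ ℓ + m := by
    have := Int.toNat_of_nonneg (show 0 ≤ a + ℓ + m - a by omega)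
    have h4 : (((K + 1) * E.card : ℕ) : ℤ) ≤ ((a + ℓ + m - a).toNat : ℤ) := by exact_mod_cast hle
    rw [this] at h4
    push_cast at h4
    linarith
  have : (0 : ℤ) < E.card := by exact_mod_cast hpos
  linarith

/-- A function with values in `[0, 1]` and with mean at most `3 / 4` on windows of length `m` cannot be nearly
symmetric about the points of a dense set. -/
theorem tsum_le_of_reflections (hb : Summable b) (h0 : ∀ v, 0 ≤ b v) (h1 : ∀ v, b v ≤ 1)
    {E : Finset ℤ} {a ℓ : ℤ} {m K : ℕ} {Δ : ℝ} (hm : 0 < m)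
    (hE : ∀ k ∈ E, a ≤ k ∧ k < a + ℓ) (hES : ∀ k ∈ E, ∑' v, b v - Δ ≤ ∑' v, b v * b (k - v))
    (hadj : ∃ k ∈ E, k + 1 ∈ E) (hK : m + ℓ ≤ K * E.card)
    (hwin : ∀ v, ∑ t ∈ range m, b (v + (t : ℕ)) ≤ 3 / 4 * m) :
    ∑' v, b v ≤ (60 + 48 * K) * Δ := by
  obtain ⟨k, hk, hk1⟩ := hadj
  have hΔ : 0 ≤ Δ := by linarith [hES k hk, tsum_mul_refl_le hb h0 h1 k]
  have hD : ∀ t : ℕ, t < m → transDist b t ≤ 3 * (K + 1) * (4 * Δ) :=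
    transDist_le_of_dense hb (by positivity) hE (fun i hi j hj => by
      have := transDist_sub_le hb h0 h1 i j
      linarith [hES i hi, hES j hj]) ⟨k, hk, hk1⟩ hK
  have hQ : ∑' v, b v * (1 - b v) ≤ 3 * Δ := by
    linarith [tsum_mul_one_sub_le hb h0 h1 k, hES k hk]
  have hq : Summable fun v => b v * (1 - b v) :=
    Summable.of_nonneg_of_le (fun v => mul_nonneg (h0 _) (sub_nonneg.2 (h1 _)))
      (fun v => mul_le_of_le_one_right (h0 v) (by linarith [h0 v])) hb
  have hst : ∀ t : ℤ, Summable fun v => b v * (1 - b (v + t)) := fun t =>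
    Summable.of_nonneg_of_le (fun v => mul_nonneg (h0 _) (sub_nonneg.2 (h1 _)))
      (fun v => mul_le_of_le_one_right (h0 v) (by linarith [h0 (v + t)])) hb
  have hup : ∀ t : ℕ, t < m → ∑' v, b v * (1 - b (v + t)) ≤ 3 * Δ + 3 * (K + 1) * (4 * Δ) := by
    intro t ht
    have hs : Summable fun v => |b (v + (t : ℤ)) - b v| := ((summable_shift hb t).sub hb).abs
    calc _ ≤ ∑' v, (b v * (1 - b v) + |b (v + t) - b v|) := by
          refine (hst t).tsum_le_tsum (fun v => ?_) (hq.add hs)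
          have : b v * (b v - b (v + t)) ≤ |b (v + t) - b v| := by
            rw [abs_sub_comm]
            rcases le_total 0 (b v - b (v + t)) with h | h
            · exact (mul_le_of_le_one_left h (h1 v)).trans (le_abs_self _)
            · exact (mul_nonpos_of_nonneg_of_nonpos (h0 v) h).trans (abs_nonneg _)
          linarith
      _ ≤ _ := by
          rw [hq.tsum_add hs]
          exact add_le_add hQ (hD t ht)
  have hlow : (∑' v, b v) * (m / 4) ≤ ∑ t ∈ range m, ∑' v, b v * (1 - b (v + (t : ℕ))) := by
    rw [← Summable.tsum_finsetSum fun (t : ℕ) _ => hst (t : ℤ), ← tsum_mul_right]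
    refine (hb.mul_right _).tsum_le_tsum (fun v => ?_) (summable_sum fun (t : ℕ) _ => hst (t : ℤ))
    rw [← mul_sum]
    refine mul_le_mul_of_nonneg_left ?_ (h0 v)
    rw [sum_sub_distrib]
    have := hwin v
    simp
    linarith
  have hsum : ∑ t ∈ range m, ∑' v, b v * (1 - b (v + (t : ℕ))) ≤
      m * (3 * Δ + 3 * (K + 1) * (4 * Δ)) := by
    refine (sum_le_card_nsmul _ _ _ fun t ht => hup t (mem_range.1 ht)).trans (le_of_eq ?_)
    rw [card_range, nsmul_eq_mul]
  have hm' : (0 : ℝ) < m := by exact_mod_cast hm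
  refine le_of_mul_le_mul_right ?_ (show (0 : ℝ) < m / 4 by positivity)
  refine (hlow.trans hsum).trans (le_of_eq (by ring))

end Translation

/-- Truncation of a sequence to height `1` and to indices below `N`. -/
noncomputable def trunc (a : ℤ → ℝ) (N : ℤ) (k : ℤ) : ℝ := if k < N then min (a k) 1 else 0

section Core

variable {a : ℤ → ℝ} {N : ℤ}

lemma trunc_nonneg (ha : ∀ k, 0 ≤ a k) (k : ℤ) : 0 ≤ trunc a N k := by
  unfold trunc; split_ifs
  · exact le_min (ha k) zero_le_one
  · exact le_rfl

lemma trunc_le_one (k : ℤ) : trunc a N k ≤ 1 := by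
  unfold trunc; split_ifs
  · exact min_le_right _ _
  · exact zero_le_one

lemma trunc_le (ha : ∀ k, 0 ≤ a k) (k : ℤ) : trunc a N k ≤ a k := by
  unfold trunc; split_ifs
  · exact min_le_left _ _
  · exact ha k

lemma trunc_eq_zero (ha0 : ∀ k < 0, a k = 0) {k : ℤ} (hk : k ∉ Ico 0 N) : trunc a N k = 0 := by
  unfold trunc
  split_ifs with h
  · rw [ha0 k (by by_contra hc; exact hk (mem_Ico.2 ⟨by omega, h⟩))]; simp
  · rfl

lemma summable_trunc (ha0 : ∀ k < 0, a k = 0) : Summable (trunc a N) :=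
  summable_of_ne_finset_zero (s := Ico 0 N) fun _ hk => trunc_eq_zero ha0 hk

lemma le_mul_trunc (ha : ∀ k, 0 ≤ a k) {e : ℝ} (he : 0 ≤ e) {k : ℤ} (hk : k < N) (h : a k ≤ 1 + e) :
    a k ≤ (1 + e) * trunc a N k := by
  unfold trunc
  rw [if_pos hk]
  rcases min_cases (a k) 1 with ⟨h1, h2⟩ | ⟨h1, h2⟩ <;> rw [h1] <;> nlinarith [ha k]

lemma tsum_trunc_eq (ha0 : ∀ k < 0, a k = 0) (hN : 0 ≤ N) : ∑' k, trunc a N k = ∑ t ∈ range N.toNat, trunc a N (0 + (t : ℕ)) := by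
  rw [tsum_eq_sum (s := Ico 0 N) fun _ hk => trunc_eq_zero ha0 hk]
  obtain ⟨n, rfl⟩ := Int.eq_ofNat_of_zero_le hN
  rw [Int.toNat_natCast]
  refine sum_nbij' (fun k => k.toNat) (fun t => (t : ℤ)) ?_ ?_ ?_ ?_ ?_
  · intro k hk; simp only [mem_Ico, mem_range] at *; omega
  · intro k hk; simp only [mem_Ico, mem_range] at *; omega
  · intro k hk; simp only [mem_Ico] at *; omega
  · intro k hk; simp
  · intro k hk
    simp only [mem_Ico] at hk
    rw [zero_add, Int.toNat_of_nonneg hk.1]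

lemma sum_range_int_eq (f : ℤ → ℝ) (n : ℕ) : ∑ k ∈ Ico (0 : ℤ) n, f k = ∑ t ∈ range n, f (0 + (t : ℕ)) := by
  refine sum_nbij' (fun k => k.toNat) (fun t => (t : ℤ)) ?_ ?_ ?_ ?_ ?_
  · intro k hk; simp only [mem_Ico, mem_range] at *; omega
  · intro k hk; simp only [mem_Ico, mem_range] at *; omega
  · intro k hk; simp only [mem_Ico] at *; omega
  · intro k hk; simp
  · intro k hk
    simp only [mem_Ico] at hk
    rw [zero_add, Int.toNat_of_nonneg hk.1]

/-- The convolution square of `a` is dominated by that of its truncation. -/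
lemma conv_le_tsum_trunc (ha : ∀ k, 0 ≤ a k) (ha0 : ∀ k < 0, a k = 0) {e c : ℝ} (he : 0 ≤ e) {j : ℕ}
    (hwin : ∀ v (m : ℕ), ∑ t ∈ range m, a (v + (t : ℕ)) ≤ (m + c) / 2)
    (hup : ∀ k, (j : ℤ) ≤ k → k < N → a k ≤ 1 + e) {k : ℤ} (hjk : 2 * (j : ℤ) ≤ k) (hkN : k < N) :
    ∑ i ∈ Ico 0 (k + 1), a i * a (k - i) ≤
      (1 + e) ^ 2 * ∑' i, trunc a N i * trunc a N (k - i) + (1 + e) * (j + c) := by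
  have hb := summable_mul_refl (summable_trunc (N := N) ha0) (trunc_nonneg ha) trunc_le_one k
  have hJ : ∑ i ∈ Ico (0 : ℤ) j, a i ≤ (j + c) / 2 := by
    rw [sum_range_int_eq]; exact hwin 0 j
  have hsplit : ∀ i ∈ Ico 0 (k + 1), a i * a (k - i) ≤
      (1 + e) ^ 2 * (trunc a N i * trunc a N (k - i)) +
      ((if i < j then (1 + e) * a i else 0) + if k - i < j then (1 + e) * a (k - i) else 0) := by
    intro i hi
    have hi := mem_Ico.1 hi
    have hb0 : 0 ≤ (1 + e) ^ 2 * (trunc a N i * trunc a N (k - i)) :=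
      mul_nonneg (by positivity) (mul_nonneg (trunc_nonneg ha _) (trunc_nonneg ha _))
    have g1 : ∀ i, 0 ≤ (1 + e) * a i := fun i => mul_nonneg (by linarith) (ha i)
    by_cases h1 : i < j
    · have h2 : ¬ k - i < j := by omega
      rw [if_pos h1, if_neg h2]
      have := mul_le_mul_of_nonneg_left (hup (k - i) (by omega) (by omega)) (ha i)
      linarith
    · by_cases h2 : k - i < j
      · rw [if_neg h1, if_pos h2]
        have := mul_le_mul_of_nonneg_right (hup i (by omega) (by omega)) (ha (k - i))
        linarith
      · rw [if_neg h1, if_neg h2]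
        have u1 := le_mul_trunc ha he (show i < N by omega) (hup i (by omega) (by omega))
        have u2 := le_mul_trunc ha he (show k - i < N by omega) (hup (k - i) (by omega) (by omega))
        have := mul_le_mul u1 u2 (ha _) (mul_nonneg (by linarith) (trunc_nonneg ha _))
        linarith
  refine (sum_le_sum hsplit).trans ?_
  rw [sum_add_distrib, sum_add_distrib, ← mul_sum]
  have r1 : ∑ i ∈ Ico 0 (k + 1), trunc a N i * trunc a N (k - i) ≤
      ∑' i, trunc a N i * trunc a N (k - i) :=
    hb.sum_le_tsum _ fun i _ => mul_nonneg (trunc_nonneg ha _) (trunc_nonneg ha _)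
  have r2 : ∑ i ∈ Ico 0 (k + 1), (if i < (j : ℤ) then (1 + e) * a i else 0) ≤ (1 + e) * ((j + c) / 2) := by
    rw [← sum_filter]
    have : (Ico 0 (k + 1)).filter (· < (j : ℤ)) = Ico (0 : ℤ) j := by
      ext i; simp only [mem_filter, mem_Ico]; omega
    rw [this, ← mul_sum]
    gcongr
  have r3 : ∑ i ∈ Ico 0 (k + 1), (if k - i < (j : ℤ) then (1 + e) * a (k - i) else 0) ≤
      (1 + e) * ((j + c) / 2) := by
    refine le_trans (le_of_eq ?_) r2
    refine sum_nbij' (fun i => k - i) (fun i => k - i) ?_ ?_ ?_ ?_ ?_ <;>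
      intro i hi <;> simp only [mem_Ico] at * <;> omega
  have : (1 + e) ^ 2 * ∑ i ∈ Ico 0 (k + 1), trunc a N i * trunc a N (k - i) ≤
      (1 + e) ^ 2 * ∑' i, trunc a N i * trunc a N (k - i) := by gcongr
  linarith

end Core

/-- If nonnegative deficits have average at most `D` over a block of length `q > 2`, then most of them are
at most `4 * D`. -/
lemma card_filter_le_of_sum_le {q : ℕ} {I : Finset ℤ} (hI : I.card = q) {d : ℤ → ℝ} (hd : ∀ k ∈ I, 0 ≤ d k)
    {D : ℝ} (hD : 0 < D) (h : ∑ k ∈ I, d k ≤ q * D) :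
    (3 / 4 : ℝ) * q ≤ (I.filter fun k => d k ≤ 4 * D).card := by
  have h1 : ((I.filter fun k => ¬ d k ≤ 4 * D).card : ℝ) * (4 * D) ≤ q * D := by
    refine le_trans ?_ h
    rw [← nsmul_eq_mul]
    refine (card_nsmul_le_sum _ d _ fun k hk => ?_).trans
      (sum_le_sum_of_subset_of_nonneg (filter_subset _ _) fun k hk _ => hd k hk)
    have := (mem_filter.1 hk).2
    push Not at this
    exact this.le
  have h2 : ((I.filter fun k => d k ≤ 4 * D).card : ℝ) + (I.filter fun k => ¬ d k ≤ 4 * D).card = q := by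
    rw [← hI]; exact_mod_cast card_filter_add_card_filter_not _
  have h3 : ((I.filter fun k => ¬ d k ≤ 4 * D).card : ℝ) * 4 ≤ q :=
    le_of_mul_le_mul_right (by linarith) hD
  linarith

theorem card_windows_le {a : ℤ → ℝ} (ha : ∀ k, 0 ≤ a k) (ha0 : ∀ k < 0, a k = 0)
    {C W q K j : ℕ} {N : ℤ} {ε e Y : ℝ} {T : Finset ℤ} (hC : 0 < C) (hW : 0 < W) (hq : 2 < q) (hε : 0 < ε)
    (he : 0 < e) (he1 : e * (10000 * (K + 1)) ≤ 1) (hK : (4 * C + 12) / ε ≤ K)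
    (hY : 1 ≤ Y)
    (hwin : ∀ v (m : ℕ), ∑ t ∈ range m, a (v + (t : ℕ)) ≤ (m + (C * (q * W) : ℕ)) / 2)
    (hup : ∀ k, (j : ℤ) ≤ k → k < N → a k ≤ 1 + e)
    (hj : (j : ℝ) + (C * (q * W) : ℕ) ≤ e * ((q * W : ℕ) * Y)) (hC2 : (C : ℝ) + 2 ≤ e * Y)
    (hN : (N : ℝ) ≤ (q * W : ℕ) * (Y + 2))
    (hT : ∀ m ∈ T, (q * W : ℕ) * (Y - 3) ≤ ((m * q : ℤ) : ℝ) ∧ (m + 1) * q ≤ N ∧ 2 * (j : ℤ) ≤ m * q)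
    (hbad : ∀ m ∈ T, ((q * W : ℕ) : ℝ) * Y / 2 * q * (1 - e) ≤
      ∑ k ∈ Ico (m * q) ((m + 1) * q), ∑ i ∈ Ico 0 (k + 1), a i * a (k - i)) :
    (T.card : ℝ) ≤ ε * W := by
  classical
  by_contra hcon
  push Not at hcon
  have hTne : T.Nonempty := by
    rw [← card_pos]
    have : (0 : ℝ) < T.card := lt_of_le_of_lt (by positivity) hcon
    exact_mod_cast this
  set L : ℝ := ((q * W : ℕ) : ℝ) with hL
  have hL1 : 1 ≤ L := by rw [hL]; exact_mod_cast Nat.one_le_iff_ne_zero.2 (by positivity)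
  have hLq : L = q * W := by rw [hL]; push_cast; rfl
  set b := trunc a N with hbdef
  have hb : Summable b := summable_trunc ha0
  have hb0 : ∀ v, 0 ≤ b v := trunc_nonneg ha
  have hb1 : ∀ v, b v ≤ 1 := trunc_le_one
  set B := ∑' v, b v with hB
  set S : ℤ → ℝ := fun k => ∑' v, b v * b (k - v) with hS
  have hSB : ∀ k, S k ≤ B := tsum_mul_refl_le hb hb0 hb1
  have hcL : ((C * (q * W) : ℕ) : ℝ) = C * L := by rw [hL]; push_cast; ring
  rw [hcL] at hj
  have hN0 : 0 ≤ N := by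
    obtain ⟨m, hm⟩ := hTne
    obtain ⟨-, h2, h3⟩ := hT m hm
    have : (m + 1) * (q : ℤ) = m * q + q := by ring
    omega
  have he2 : e ≤ 1 / 10000 := by
    have : e * (10000 * 1) ≤ e * (10000 * (K + 1)) := by gcongr; linarith [Nat.cast_nonneg (α := ℝ) K]
    linarith
  have hBle : B ≤ L * Y / 2 * (1 + e) := by
    rw [hB, hbdef, tsum_trunc_eq ha0 hN0]
    have h1 := hwin 0 N.toNat
    rw [hcL] at h1
    have h2 : (N.toNat : ℝ) = N := by exact_mod_cast Int.toNat_of_nonneg hN0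
    rw [h2] at h1
    have h3 : ∑ t ∈ range N.toNat, trunc a N (0 + (t : ℕ)) ≤ ∑ t ∈ range N.toNat, a (0 + (t : ℕ)) :=
      sum_le_sum fun t _ => trunc_le ha _
    have h4 : L * (C + 2) ≤ L * (e * Y) := by gcongr
    linarith
  have hLY : 0 < L * Y := by positivity
  have hconv : ∀ m ∈ T, ∀ k ∈ Ico (m * q) ((m + 1) * (q : ℤ)),
      ∑ i ∈ Ico 0 (k + 1), a i * a (k - i) ≤ S k + 5 * e * (L * Y) := by
    intro m hm k hk
    obtain ⟨-, h2, h3⟩ := hT m hm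
    have hk := mem_Ico.1 hk
    have := conv_le_tsum_trunc ha ha0 he.le hwin hup (k := k) (by omega) (by omega)
    rw [hcL] at this
    refine this.trans ?_
    have s1 : S k ≤ L * Y := (hSB k).trans (hBle.trans (by nlinarith))
    have s2 : (1 + e) ^ 2 * S k ≤ S k + 3 * e * (L * Y) := by
      have : (2 * e + e ^ 2) * S k ≤ (2 * e + e ^ 2) * (L * Y) := by gcongr
      nlinarith [mul_pos he hLY]
    have s3 : (1 + e) * (j + C * L) ≤ 2 * (e * (L * Y)) := by
      have : (0 : ℝ) ≤ j + C * L := by positivity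
      nlinarith
    change (1 + e) ^ 2 * S k + _ ≤ _
    linarith
  have hdef : ∀ m ∈ T, ∑ k ∈ Ico (m * q) ((m + 1) * (q : ℤ)), (B - S k) ≤ q * (6 * e * (L * Y)) := by
    intro m hm
    have hcard : (Ico (m * q) ((m + 1) * (q : ℤ))).card = q := by
      rw [Int.card_Ico]
      have : (m + 1) * (q : ℤ) = m * q + q := by ring
      omega
    have h1 := (hbad m hm).trans (sum_le_sum (hconv m hm))
    rw [sum_add_distrib, sum_const, hcard, nsmul_eq_mul] at h1
    rw [sum_sub_distrib, sum_const, hcard, nsmul_eq_mul]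
    have hq0 : (0 : ℝ) ≤ q := Nat.cast_nonneg q
    have := mul_le_mul_of_nonneg_left hBle hq0
    nlinarith
  set Δ := 4 * (6 * e * (L * Y)) with hΔ
  have hgood : ∀ m ∈ T, (3 / 4 : ℝ) * q ≤
      ((Ico (m * q) ((m + 1) * (q : ℤ))).filter fun k => B - S k ≤ Δ).card := by
    intro m hm
    refine card_filter_le_of_sum_le ?_ (fun k _ => sub_nonneg.2 (hSB k)) (by positivity) (hdef m hm)
    rw [Int.card_Ico]
    have : (m + 1) * (q : ℤ) = m * q + q := by ring
    omega
  set E := T.biUnion fun m => (Ico (m * q) ((m + 1) * (q : ℤ))).filter fun k => B - S k ≤ Δ with hE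
  have hEcard : ε * W * (3 / 4 * q) ≤ (E.card : ℝ) := by
    rw [hE, card_biUnion]
    · push_cast
      calc ε * W * (3 / 4 * q) ≤ T.card * (3 / 4 * q) := by gcongr
        _ = ∑ m ∈ T, (3 / 4 : ℝ) * q := by rw [sum_const, nsmul_eq_mul]
        _ ≤ _ := sum_le_sum hgood
    · intro m hm m' hm' hne
      rw [Function.onFun, disjoint_left]
      intro k hk hk'
      have h1 := mem_Ico.1 (mem_filter.1 hk).1
      have h2 := mem_Ico.1 (mem_filter.1 hk').1
      have hq0 : (0 : ℤ) < q := by omega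
      have h3 : m < m' + 1 := lt_of_mul_lt_mul_right (h1.1.trans_lt h2.2) hq0.le
      have h4 : m' < m + 1 := lt_of_mul_lt_mul_right (h2.1.trans_lt h1.2) hq0.le
      omega
  have hES : ∀ k ∈ E, B - Δ ≤ S k := by
    intro k hk
    obtain ⟨m, hm, hk⟩ := mem_biUnion.1 hk
    linarith [(mem_filter.1 hk).2]
  have hEr : ∀ k ∈ E, ⌊L * (Y - 3)⌋ ≤ k ∧ k < ⌊L * (Y - 3)⌋ + (N - ⌊L * (Y - 3)⌋) := by
    intro k hk
    obtain ⟨m, hm, hk⟩ := mem_biUnion.1 hk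
    have hk := mem_Ico.1 (mem_filter.1 hk).1
    obtain ⟨h1, h2, h3⟩ := hT m hm
    have : ⌊L * (Y - 3)⌋ ≤ m * q := Int.floor_le_iff.2 (by linarith)
    omega
  have hadj : ∃ k ∈ E, k + 1 ∈ E := by
    obtain ⟨m, hm⟩ := hTne
    set F := (Ico (m * q) ((m + 1) * (q : ℤ))).filter fun k => B - S k ≤ Δ with hF
    have hFc := hgood m hm
    have hinj : (F.image (· + 1)).card = F.card := card_image_of_injective _ (add_left_injective 1)
    have hme : (m + 1) * (q : ℤ) = m * q + q := by ring
    have hlt : (Ico (m * q) ((m + 1) * (q : ℤ) + 1)).card < F.card + (F.image (· + 1)).card := by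
      rw [hinj, Int.card_Ico]
      have h3 : ((m + 1) * (q : ℤ) + 1 - m * q).toNat = q + 1 := by omega
      rw [h3]
      have hq3 : (3 : ℝ) ≤ q := by exact_mod_cast hq
      have : ((q + 1 : ℕ) : ℝ) < ((F.card + F.card : ℕ) : ℝ) := by push_cast; linarith
      exact_mod_cast this
    obtain ⟨k, hk⟩ := inter_nonempty_of_card_lt_card_add_card (s := Ico (m * q) ((m + 1) * (q : ℤ) + 1))
      (fun k hk => by
        have := mem_Ico.1 (mem_filter.1 hk).1
        exact mem_Ico.2 ⟨by omega, by omega⟩)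
      (fun k hk => by
        obtain ⟨l, hl, rfl⟩ := mem_image.1 hk
        have := mem_Ico.1 (mem_filter.1 hl).1
        exact mem_Ico.2 ⟨by omega, by omega⟩) hlt
    obtain ⟨hk1, hk2⟩ := mem_inter.1 hk
    obtain ⟨l, hl, rfl⟩ := mem_image.1 hk2
    exact ⟨l, mem_biUnion.2 ⟨m, hm, hl⟩, mem_biUnion.2 ⟨m, hm, hk1⟩⟩
  have hmw : ∀ v, ∑ t ∈ range (2 * (C * (q * W))), b (v + (t : ℕ)) ≤ 3 / 4 * (2 * (C * (q * W)) : ℕ) := by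
    intro v
    have h1 := hwin v (2 * (C * (q * W)))
    have h2 : ∑ t ∈ range (2 * (C * (q * W))), b (v + (t : ℕ)) ≤
        ∑ t ∈ range (2 * (C * (q * W))), a (v + (t : ℕ)) := sum_le_sum fun t _ => trunc_le ha _
    rw [hcL] at h1
    push_cast at h1 ⊢
    rw [hLq] at h1
    linarith
  have hfin := tsum_le_of_reflections hb hb0 hb1 (E := E) (K := K) (Δ := Δ) (m := 2 * (C * (q * W)))
    (by positivity) hEr hES hadj (by
      have hfl := Int.lt_floor_add_one (L * (Y - 3))
      have h1 : (4 * C + 12 : ℝ) ≤ K * ε := by rwa [div_le_iff₀ hε] at hK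
      have h2 : (((2 * (C * (q * W)) : ℕ) : ℤ) + (N - ⌊L * (Y - 3)⌋) : ℝ) ≤ K * E.card := by
        calc (((2 * (C * (q * W)) : ℕ) : ℤ) + (N - ⌊L * (Y - 3)⌋) : ℝ) ≤ (2 * C + 6) * L := by
              have : (((2 * (C * (q * W)) : ℕ) : ℤ) : ℝ) = 2 * (C * L) := by rw [hLq]; push_cast; ring
              rw [this]
              linarith
          _ ≤ K * ε / 2 * L := by gcongr; linarith
          _ ≤ K * (ε * W * (3 / 4 * q)) := by
              rw [hLq]
              have : 0 ≤ (K : ℝ) * ε * q * W := by positivity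
              linarith
          _ ≤ _ := by gcongr
      exact_mod_cast h2) hmw
  have hBge : L * Y / 4 ≤ B := by
    obtain ⟨m, hm⟩ := hTne
    have hcard : (Ico (m * q) ((m + 1) * (q : ℤ))).card = q := by
      rw [Int.card_Ico]
      have : (m + 1) * (q : ℤ) = m * q + q := by ring
      omega
    have h1 := (hbad m hm).trans (sum_le_sum (hconv m hm))
    have h2 : ∑ k ∈ Ico (m * q) ((m + 1) * (q : ℤ)), (S k + 5 * e * (L * Y)) ≤
        q * (B + 5 * e * (L * Y)) := by
      refine (sum_le_card_nsmul _ _ (B + 5 * e * (L * Y)) fun k _ => by linarith [hSB k]).trans ?_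
      rw [hcard, nsmul_eq_mul]
    have hq0 : (0 : ℝ) < q := by exact_mod_cast (by omega : 0 < q)
    have h3 : L * Y / 2 * (1 - e) ≤ B + 5 * e * (L * Y) :=
      le_of_mul_le_mul_left (by linarith) hq0
    nlinarith
  have hKk : (60 + 48 * (K : ℝ)) * Δ ≤ (L * Y) * (1440 * e * (K + 1)) := by
    rw [hΔ]
    have : 0 ≤ e * (L * Y) * K := by positivity
    linarith
  have : (L * Y) * (1440 * e * (K + 1)) ≤ (L * Y) * (1440 / 10000) := by
    gcongr
    linarith
  linarith

/-- The integers whose logarithm lies in the `k`-th interval of length `1 / L`. -/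
noncomputable def cell (L : ℕ) (k : ℤ) : Finset ℕ := Ioc ⌊exp ((k : ℝ) / L)⌋₊ ⌊exp (((k + 1 : ℤ) : ℝ) / L)⌋₊

/-- The logarithmic prime mass of a cell. -/
noncomputable def cellMass (L : ℕ) (k : ℤ) : ℝ := ∑ n ∈ cell L k, Λ n / n

lemma vonMangoldt_div_nonneg (n : ℕ) : 0 ≤ Λ n / (n : ℝ) :=
  div_nonneg ArithmeticFunction.vonMangoldt_nonneg (Nat.cast_nonneg n)

lemma cellMass_nonneg (L : ℕ) (k : ℤ) : 0 ≤ cellMass L k :=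
  sum_nonneg fun n _ => vonMangoldt_div_nonneg n

lemma lamSum_sub_eq {u v : ℝ} (huv : u ≤ v) :
    lamSum v - lamSum u = ∑ n ∈ Ioc ⌊u⌋₊ ⌊v⌋₊, Λ n / n := by
  unfold lamSum
  rw [← sum_Ioc_consecutive _ (Nat.zero_le _) (Nat.floor_mono huv)]; ring

lemma cellMass_eq (L : ℕ) (k : ℤ) :
    cellMass L k = lamSum (exp (((k + 1 : ℤ) : ℝ) / L)) - lamSum (exp ((k : ℝ) / L)) := by
  rw [lamSum_sub_eq]
  · rfl
  · gcongr; linarith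

lemma cellMass_of_neg {L : ℕ} {k : ℤ} (hk : k < 0) : cellMass L k = 0 := by
  refine sum_eq_zero fun n hn => ?_
  have hn := (mem_Ioc.1 hn).2
  have hk1 : (((k + 1 : ℤ) : ℝ)) ≤ 0 := by exact_mod_cast (by omega : k + 1 ≤ 0)
  have h1 : exp (((k + 1 : ℤ) : ℝ) / L) ≤ 1 :=
    exp_le_one_iff.2 (div_nonpos_of_nonpos_of_nonneg hk1 (Nat.cast_nonneg L))
  have h2 : ⌊exp (((k + 1 : ℤ) : ℝ) / L)⌋₊ ≤ 1 := Nat.floor_le_one_of_le_one h1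
  rcases (by omega : n = 0 ∨ n = 1) with rfl | rfl <;> simp

lemma sum_cellMass_le {L : ℕ} (hL : 0 < L) (v : ℤ) (m : ℕ) :
    ∑ t ∈ range m, cellMass L (v + (t : ℕ)) ≤ m / L + 2 * mertensC := by
  have htel : ∑ t ∈ range m, cellMass L (v + (t : ℕ)) =
      lamSum (exp (((v + m : ℤ) : ℝ) / L)) - lamSum (exp ((v : ℝ) / L)) := by
    induction m with
    | zero => simp
    | succ m ih =>
      rw [sum_range_succ, ih, cellMass_eq]
      push_cast
      rw [show (v : ℝ) + m + 1 = v + (m + 1) by ring]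
      ring
  rw [htel]
  refine lamSum_sub_le (exp_pos _) (by positivity) (le_of_eq ?_)
  rw [← exp_add, ← add_div]; push_cast; rfl

/-- The index of the cell containing `n`. -/
noncomputable def cellIdx (L n : ℕ) : ℤ := ⌈L * log n⌉ - 1

lemma mem_cell_cellIdx {L n : ℕ} (hL : 0 < L) (hn : 0 < n) : n ∈ cell L (cellIdx L n) := by
  have hn' : (0 : ℝ) < n := by exact_mod_cast hn
  have hL' : (0 : ℝ) < L := by exact_mod_cast hL
  have h1 := Int.le_ceil (L * log n)
  have h2 := Int.ceil_lt_add_one (L * log n)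
  unfold cell cellIdx
  rw [mem_Ioc, Nat.floor_lt (exp_pos _).le, Nat.le_floor_iff (exp_pos _).le, ← lt_log_iff_exp_lt hn',
    ← log_le_iff_le_exp hn', div_lt_iff₀ hL', le_div_iff₀ hL']
  push_cast
  constructor <;> linarith

lemma cellIdx_bounds (L n : ℕ) : (cellIdx L n : ℝ) < L * log n ∧ L * log n ≤ cellIdx L n + 1 := by
  have h1 := Int.le_ceil (L * log n)
  have h2 := Int.ceil_lt_add_one (L * log n)
  unfold cellIdx
  push_cast
  constructor <;> linarith

lemma sum_vonMangoldt_sq_le {L : ℕ} (hL : 0 < L) (k₁ k₂ : ℤ) :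
    ∑ n ∈ Ioc ⌊exp (((k₁ + 1 : ℤ) : ℝ) / L)⌋₊ ⌊exp ((k₂ : ℝ) / L)⌋₊, (Λ * Λ) n / n ≤
      ∑ k ∈ Ico k₁ k₂, ∑ i ∈ Ico 0 (k + 1), cellMass L i * cellMass L (k - i) := by
  classical
  have hL' : (0 : ℝ) < L := by exact_mod_cast hL
  set I := Ioc ⌊exp (((k₁ + 1 : ℤ) : ℝ) / L)⌋₊ ⌊exp ((k₂ : ℝ) / L)⌋₊ with hI
  set G : ℕ × ℕ → ℝ := fun p => Λ p.1 / p.1 * (Λ p.2 / p.2) with hG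
  have hG0 : ∀ p, 0 ≤ G p := fun p => mul_nonneg (vonMangoldt_div_nonneg _) (vonMangoldt_div_nonneg _)
  set P := (I.biUnion Nat.divisorsAntidiagonal).filter (fun p => G p ≠ 0) with hP
  have hPmem : ∀ p ∈ P, 1 < p.1 ∧ 1 < p.2 ∧ p.1 * p.2 ∈ I := by
    intro p hp
    obtain ⟨h1, h2⟩ := mem_filter.1 hp
    obtain ⟨n, hn, hpn⟩ := mem_biUnion.1 h1
    obtain ⟨h3, h4⟩ := Nat.mem_divisorsAntidiagonal.1 hpn
    rw [h3]
    have hp1 : p.1 ≠ 1 := by rintro h; simp [hG, h] at h2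
    have hp2 : p.2 ≠ 1 := by rintro h; simp [hG, h] at h2
    have : p.1 ≠ 0 := by rintro h; rw [h] at h3; simp at h3; exact h4 h3.symm
    have : p.2 ≠ 0 := by rintro h; rw [h] at h3; simp at h3; exact h4 h3.symm
    exact ⟨by omega, by omega, hn⟩
  have hsum : ∑ n ∈ I, (Λ * Λ) n / n = ∑ p ∈ P, G p := by
    rw [hP, sum_filter_ne_zero, sum_biUnion]
    · refine sum_congr rfl fun n _ => ?_
      rw [ArithmeticFunction.mul_apply, sum_div]
      refine sum_congr rfl fun p hp => ?_
      obtain ⟨h3, h4⟩ := Nat.mem_divisorsAntidiagonal.1 hp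
      simp only [hG]
      rw [← h3]; push_cast
      rw [div_mul_div_comm]
    · intro m _ n _ hmn
      rw [Function.onFun, disjoint_left]
      intro p hp hq
      exact hmn ((Nat.mem_divisorsAntidiagonal.1 hp).1.symm.trans (Nat.mem_divisorsAntidiagonal.1 hq).1)
  have hidx : ∀ p ∈ P, 0 ≤ cellIdx L p.1 ∧ 0 ≤ cellIdx L p.2 ∧ k₁ ≤ cellIdx L p.1 + cellIdx L p.2 ∧
      cellIdx L p.1 + cellIdx L p.2 < k₂ := by
    intro p hp
    obtain ⟨h1, h2, h3⟩ := hPmem p hp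
    have c1 := cellIdx_bounds L p.1
    have c2 := cellIdx_bounds L p.2
    have p1 : (0 : ℝ) < p.1 := by exact_mod_cast (by omega : 0 < p.1)
    have p2 : (0 : ℝ) < p.2 := by exact_mod_cast (by omega : 0 < p.2)
    have l1 : 0 < L * log (p.1 : ℝ) := mul_pos hL' (log_pos (by exact_mod_cast h1))
    have l2 : 0 < L * log (p.2 : ℝ) := mul_pos hL' (log_pos (by exact_mod_cast h2))
    have hlm : log ((p.1 * p.2 : ℕ) : ℝ) = log p.1 + log p.2 := by
      push_cast; rw [log_mul p1.ne' p2.ne']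
    have hpp : (0 : ℝ) < ((p.1 * p.2 : ℕ) : ℝ) := by push_cast; positivity
    rw [hI, mem_Ioc, Nat.floor_lt (exp_pos _).le, Nat.le_floor_iff (exp_pos _).le, ← lt_log_iff_exp_lt hpp,
      ← log_le_iff_le_exp hpp, div_lt_iff₀ hL', le_div_iff₀ hL', hlm] at h3
    push_cast at h3
    refine ⟨?_, ?_, ?_, ?_⟩
    · have : (-1 : ℝ) < cellIdx L p.1 := by linarith
      have : (-1 : ℤ) < cellIdx L p.1 := by exact_mod_cast this
      omega
    · have : (-1 : ℝ) < cellIdx L p.2 := by linarith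
      have : (-1 : ℤ) < cellIdx L p.2 := by exact_mod_cast this
      omega
    · have : (k₁ : ℝ) < cellIdx L p.1 + cellIdx L p.2 + 1 := by linarith
      have : k₁ < cellIdx L p.1 + cellIdx L p.2 + 1 := by exact_mod_cast this
      omega
    · have : (cellIdx L p.1 + cellIdx L p.2 : ℝ) < k₂ := by linarith
      exact_mod_cast this
  rw [hsum, ← sum_fiberwise_of_maps_to (s := P) (t := Ico k₁ k₂)
    (g := fun p => cellIdx L p.1 + cellIdx L p.2)
    (fun p hp => mem_Ico.2 ⟨(hidx p hp).2.2.1, (hidx p hp).2.2.2⟩)]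
  refine sum_le_sum fun k _ => ?_
  rw [← sum_fiberwise_of_maps_to (t := Ico 0 (k + 1)) (g := fun p : ℕ × ℕ => cellIdx L p.1)
    (fun p hp => by
      obtain ⟨hp1, hp2⟩ := mem_filter.1 hp
      obtain ⟨h1, h2, -, -⟩ := hidx p hp1
      exact mem_Ico.2 ⟨h1, by omega⟩)]
  refine sum_le_sum fun i _ => ?_
  unfold cellMass
  rw [sum_mul_sum, ← sum_product']
  refine sum_le_sum_of_subset_of_nonneg (fun p hp => ?_) fun p _ _ => hG0 p
  obtain ⟨hp, hi⟩ := mem_filter.1 hp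
  obtain ⟨hp, hk⟩ := mem_filter.1 hp
  obtain ⟨h1, h2, -⟩ := hPmem p hp
  rw [mem_product]
  subst hi hk
  rw [add_sub_cancel_left]
  exact ⟨mem_cell_cellIdx hL (by omega), mem_cell_cellIdx hL (by omega)⟩

set_option maxHeartbeats 1000000 in
theorem exists_window_bound {ε : ℝ} (hε : 0 < ε) : ∃ η : ℝ, 0 < η ∧ ∃ δ : ℝ, 0 < δ ∧
    ∀ᶠ Y : ℝ in atTop, ∀ W : ℕ, Y ≤ W → (W : ℝ) ≤ exp (δ * Y) → ∀ T : Finset ℤ,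
      (∀ m ∈ T, Y - 2 ≤ ((m + 1 : ℤ) : ℝ) / W ∧ ((m + 1 : ℤ) : ℝ) / W ≤ Y + 1 ∧
        ∑ n ∈ Ioc ⌊exp ((m : ℝ) / W)⌋₊ ⌊exp (((m + 1 : ℤ) : ℝ) / W)⌋₊, Λ n / n ≤ η / W) →
      (T.card : ℝ) ≤ ε * W := by
  set C : ℕ := ⌈2 * mertensC⌉₊ with hCdef
  have hC0 : 0 < C := Nat.ceil_pos.2 (by linarith [mertensC_pos])
  have hCle : 2 * mertensC ≤ C := Nat.le_ceil _
  set K : ℕ := ⌈(4 * (C : ℝ) + 12) / ε⌉₊ with hKdef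
  have hK : (4 * (C : ℝ) + 12) / ε ≤ K := Nat.le_ceil _
  set e : ℝ := 1 / (10000 * ((K : ℝ) + 1)) with hedef
  have he : 0 < e := by positivity
  have he1 : e * (10000 * ((K : ℝ) + 1)) ≤ 1 := le_of_eq (by rw [hedef]; field_simp)
  have he2 : e ≤ 1 / 10000 := by nlinarith [(Nat.cast_nonneg K : (0 : ℝ) ≤ K)]
  set q : ℕ := ⌈8 / e⌉₊ with hqdef
  have hq8 : 8 / e ≤ q := Nat.le_ceil _
  have hqe : 8 ≤ e * q := by rw [div_le_iff₀ he] at hq8; linarith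
  have hq2 : 2 < q := by
    have : (2 : ℝ) < q := by nlinarith
    exact_mod_cast this
  clear_value q e K C
  obtain ⟨κ, hκ, hκ1, hev⟩ := exists_vonMangoldt_window (ε := e / 8) (by positivity) (by linarith)
  obtain ⟨X₀, hX₀⟩ := eventually_atTop.1 hev
  have hδ : 0 < κ * e / 8 := by positivity
  refine ⟨e / 8, by positivity, κ * e / 8, hδ, ?_⟩
  have hYq : ∀ᶠ Y : ℝ in atTop, (q : ℝ) ≤ exp (κ * e / 8 * Y) :=
    (tendsto_exp_atTop.comp (tendsto_id.const_mul_atTop hδ)).eventually_ge_atTop _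
  filter_upwards [hYq, eventually_ge_atTop (4 * X₀ / e), eventually_ge_atTop (2 * ((C : ℝ) + 2) / e),
    eventually_ge_atTop (256 / e)] with Y hY1 hY2 hY3 hY4 W hYW hWexp T hT
  rw [div_le_iff₀ he] at hY2 hY3 hY4
  have hYbig : (2560000 : ℝ) ≤ Y := by nlinarith
  have hWR : (0 : ℝ) < W := by linarith
  have hW : 0 < W := by exact_mod_cast hWR
  have hqR : (2 : ℝ) < q := by exact_mod_cast hq2
  set L : ℕ := q * W with hLdef
  have hL : 0 < L := Nat.mul_pos (by omega) hW
  have hLR : (L : ℝ) = q * W := by rw [hLdef]; push_cast; rfl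
  have hLpos : (0 : ℝ) < L := by exact_mod_cast hL
  have hL1 : (1 : ℝ) ≤ L := by exact_mod_cast hL
  have hqL : (q : ℝ) ≤ L := by rw [hLR]; nlinarith
  set j : ℕ := ⌈e / 4 * L * Y⌉₊ with hjdef
  have hj1 : e / 4 * L * Y ≤ j := Nat.le_ceil _
  have hj2 : (j : ℝ) < e / 4 * L * Y + 1 := Nat.ceil_lt_add_one (by positivity)
  set N : ℤ := ⌈(Y + 1) * L⌉ with hNdef
  have hN1 : (Y + 1) * L ≤ N := Int.le_ceil _
  have hN2 : (N : ℝ) < (Y + 1) * L + 1 := Int.ceil_lt_add_one _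
  clear_value L j N
  have hexpL : ∀ x : ℝ, e * Y / 4 ≤ x → exp (-(κ * x)) ≤ 1 / L := by
    intro x hx
    rw [exp_neg, ← one_div]
    refine one_div_le_one_div_of_le hLpos ?_
    calc (L : ℝ) = q * W := hLR
      _ ≤ exp (κ * e / 8 * Y) * exp (κ * e / 8 * Y) := mul_le_mul hY1 hWexp hWR.le (exp_pos _).le
      _ = exp (κ * (e * Y / 4)) := by rw [← exp_add]; ring_nf
      _ ≤ exp (κ * x) := exp_le_exp.2 (mul_le_mul_of_nonneg_left hx hκ.le)
  have hW16 : 1 / (W : ℝ) ≤ e / 8 / 16 := by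
    rw [div_le_iff₀ hWR]; nlinarith
  have hL16 : 1 / (L : ℝ) ≤ e / 8 / 16 :=
    (one_div_le_one_div_of_le hWR (by rw [hLR]; nlinarith)).trans hW16
  have hmq : ∀ m ∈ T, (L : ℝ) * (Y - 2) ≤ ((m : ℝ) + 1) * q ∧ ((m : ℝ) + 1) * q ≤ L * (Y + 1) := by
    intro m hm
    obtain ⟨h1, h2, -⟩ := hT m hm
    rw [le_div_iff₀ hWR] at h1
    rw [div_le_iff₀ hWR] at h2
    push_cast at h1 h2
    rw [hLR]
    constructor <;> nlinarith
  refine card_windows_le (a := fun k => L / 2 * cellMass L k) (N := N) (Y := Y) (j := j) (e := e)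
    (K := K) (C := C) (q := q) (W := W)
    (fun k => mul_nonneg (by positivity) (cellMass_nonneg L k))
    (fun k hk => by simp only [cellMass_of_neg hk, mul_zero]) hC0 hW hq2 hε he he1 hK (by linarith)
    ?_ ?_ ?_ (by linarith) ?_ ?_ ?_
  · intro v m
    rw [← mul_sum]
    calc (L : ℝ) / 2 * ∑ t ∈ range m, cellMass L (v + (t : ℕ)) ≤ L / 2 * (m / L + 2 * mertensC) :=
          mul_le_mul_of_nonneg_left (sum_cellMass_le hL v m) (by positivity)
      _ = (m + 2 * mertensC * L) / 2 := by field_simp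
      _ ≤ (m + C * L) / 2 := by nlinarith
      _ = _ := by rw [hLR]; push_cast; ring
  · intro k hk _
    have hkR : (j : ℝ) ≤ k := by exact_mod_cast hk
    have hx : e * Y / 4 ≤ ((k + 1 : ℤ) : ℝ) / L := by
      rw [le_div_iff₀ hLpos]; push_cast; linarith
    have := (hX₀ (((k + 1 : ℤ) : ℝ) / L) (by linarith) (1 / L) (hexpL _ hx) hL16).1
    rw [show ((k + 1 : ℤ) : ℝ) / L - 1 / L = (k : ℝ) / L by push_cast; ring] at this
    calc (L : ℝ) / 2 * cellMass L k ≤ L / 2 * ((2 + e / 8) * (1 / L)) :=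
          mul_le_mul_of_nonneg_left this (by positivity)
      _ = 1 + e / 16 := by field_simp; ring
      _ ≤ 1 + e := by linarith
  · rw [← hLdef]
    push_cast
    have : (C : ℝ) + 1 ≤ e * Y / 2 := by linarith
    nlinarith
  · rw [← hLdef]; nlinarith
  · intro m hm
    obtain ⟨h1, h2⟩ := hmq m hm
    rw [← hLdef]
    have h3 : (L : ℝ) * (Y - 3) ≤ (m : ℝ) * q := by linarith
    refine ⟨by push_cast; exact h3, ?_, ?_⟩
    · have : ((m : ℝ) + 1) * q ≤ N := by linarith
      exact_mod_cast this
    · have : 2 * (j : ℝ) ≤ (m : ℝ) * q := by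
        have : e * Y / 2 + 2 ≤ Y - 3 := by nlinarith
        nlinarith
      exact_mod_cast this
  · intro m hm
    obtain ⟨h1, h2⟩ := hmq m hm
    obtain ⟨g1, g2, g3⟩ := hT m hm
    rw [← hLdef]
    set x : ℝ := ((m + 1 : ℤ) : ℝ) / W with hxdef
    set r : ℝ := ((q : ℝ) - 1) / L with hrdef
    have hxe : e * Y / 4 ≤ x := by nlinarith
    have hr1 : 1 / (L : ℝ) ≤ r := div_le_div_of_nonneg_right (by linarith) hLpos.le
    have hr2 : r ≤ 1 / W := by
      rw [hrdef, hLR, div_le_div_iff₀ (by positivity) hWR]; nlinarith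
    have hqW : (1 : ℝ) / W = q / L := by rw [hLR]; field_simp
    have key := (hX₀ x (by linarith) r ((hexpL _ hxe).trans hr1) (hr2.trans hW16)).2
    have hxr : x - r = ((m * q + 1 : ℤ) : ℝ) / L := by
      rw [hxdef, hrdef, hLR]; push_cast; field_simp; ring
    have hxx : x = (((m + 1) * q : ℤ) : ℝ) / L := by
      rw [hxdef, hLR]; push_cast; field_simp
    have hS1 : ∑ n ∈ Ioc ⌊exp (x - r)⌋₊ ⌊exp x⌋₊, Λ n / n ≤ e / 8 / W := by
      refine le_trans (sum_le_sum_of_subset_of_nonneg (Ioc_subset_Ioc_left (Nat.floor_mono ?_))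
        fun n _ _ => vonMangoldt_div_nonneg n) g3
      refine exp_le_exp.2 ?_
      have : x - 1 / W = m / W := by rw [hxdef]; push_cast; ring
      linarith
    have hS2 := sum_vonMangoldt_sq_le hL (m * q) ((m + 1) * q)
    rw [← hxr, ← hxx] at hS2
    have hxpos : 0 < x := by linarith
    have h5 : x * ∑ n ∈ Ioc ⌊exp (x - r)⌋₊ ⌊exp x⌋₊, Λ n / n ≤ x * (e / 8 / W) :=
      mul_le_mul_of_nonneg_left hS1 hxpos.le
    have h6 : (2 - e / 8) * r * x - x * (e / 8 / W) ≤
        ∑ k ∈ Ico (m * q) ((m + 1) * q), ∑ i ∈ Ico 0 (k + 1), cellMass L i * cellMass L (k - i) := by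
      linarith
    have h7 : (∑ k ∈ Ico (m * q) ((m + 1) * q), ∑ i ∈ Ico 0 (k + 1),
        L / 2 * cellMass L i * (L / 2 * cellMass L (k - i))) = (L : ℝ) * L / 4 *
        ∑ k ∈ Ico (m * q) ((m + 1) * q), ∑ i ∈ Ico 0 (k + 1), cellMass L i * cellMass L (k - i) := by
      rw [mul_sum]
      refine sum_congr rfl fun k _ => ?_
      rw [mul_sum]
      refine sum_congr rfl fun i _ => ?_
      ring
    rw [h7]
    refine le_trans ?_ (mul_le_mul_of_nonneg_left h6 (by positivity))
    have h8 : (L : ℝ) * L / 4 * ((2 - e / 8) * r * x - x * (e / 8 / W)) =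
        L / 4 * x * ((2 - e / 8) * (q - 1) - e / 8 * q) := by
      rw [hrdef, hLR]; field_simp
    rw [h8]
    have h9 : 2 * (q : ℝ) * (1 - e / 4) ≤ (2 - e / 8) * (q - 1) - e / 8 * q := by linarith
    have h10 : Y * (1 - e / 4) ≤ x := by linarith
    have hY0 : 0 ≤ Y := by linarith
    calc (L : ℝ) * Y / 2 * q * (1 - e) ≤ L / 4 * (2 * q * Y) * ((1 - e / 4) * (1 - e / 4)) := by
          have : 1 - e ≤ (1 - e / 4) * (1 - e / 4) := by linarith [sq_nonneg e]
          have := mul_le_mul_of_nonneg_left this (by positivity : 0 ≤ (L : ℝ) * Y / 2 * q)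
          linarith
      _ = L / 4 * (Y * (1 - e / 4)) * (2 * q * (1 - e / 4)) := by ring
      _ ≤ _ := mul_le_mul (mul_le_mul_of_nonneg_left h10 (by positivity)) h9
          (mul_nonneg (by positivity) (by linarith)) (by positivity)

lemma sum_vonMangoldt_div_le {M u v : ℕ} (hM : 1 ≤ M) (hu : M ≤ 2 * u) (hv : v ≤ 2 * M) :
    ∑ k ∈ Ioc u v, Λ k / k ≤
      2 * log (2 * M) / M * (((Ioc u v).filter Nat.Prime).card + 2 * √(2 * M)) := by
  have hMR : (1 : ℝ) ≤ M := by exact_mod_cast hM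
  have huR : (M : ℝ) ≤ 2 * u := by exact_mod_cast hu
  have h1 : ∑ k ∈ Ioc u v, Λ k / k ≤ 2 / M * ∑ k ∈ Ioc u v, Λ k := by
    rw [mul_sum]
    refine sum_le_sum fun k hk => ?_
    have hk1 : (u : ℝ) < k := by exact_mod_cast (mem_Ioc.1 hk).1
    rw [div_mul_eq_mul_div, div_le_div_iff₀ (by linarith) (by linarith)]
    nlinarith [ArithmeticFunction.vonMangoldt_nonneg (n := k)]
  have h2 : ∑ k ∈ (Ioc u v).filter Nat.Prime, Λ k ≤
      ((Ioc u v).filter Nat.Prime).card * log (2 * M) := by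
    rw [← nsmul_eq_mul]
    refine sum_le_card_nsmul _ _ _ fun k hk => ?_
    obtain ⟨hk1, hk2⟩ := mem_filter.1 hk
    refine ArithmeticFunction.vonMangoldt_le_log.trans (log_le_log (by exact_mod_cast hk2.pos) ?_)
    exact_mod_cast (mem_Ioc.1 hk1).2.trans hv
  have h3 : ∑ k ∈ (Ioc u v).filter (fun k => ¬ k.Prime), Λ k ≤ 2 * √(2 * M) * log (2 * M) := by
    refine le_trans ?_ (Chebyshev.psi_sub_theta_le (x := 2 * M) (by linarith))
    rw [Chebyshev.psi_sub_theta_eq_sum_not_prime]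
    refine sum_le_sum_of_subset_of_nonneg (fun k hk => ?_)
      fun _ _ _ => ArithmeticFunction.vonMangoldt_nonneg
    obtain ⟨hk1, hk2⟩ := mem_filter.1 hk
    rw [show ⌊(2 * M : ℝ)⌋₊ = 2 * M by exact_mod_cast Nat.floor_natCast (2 * M)]
    have := mem_Ioc.1 hk1
    exact mem_filter.2 ⟨mem_Ioc.2 ⟨by omega, by omega⟩, hk2⟩
  have h4 := sum_filter_add_sum_filter_not (Ioc u v) Nat.Prime (fun k => Λ k)
  calc _ ≤ 2 / M * ∑ k ∈ Ioc u v, Λ k := h1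
    _ ≤ 2 / M * (((Ioc u v).filter Nat.Prime).card * log (2 * M) + 2 * √(2 * M) * log (2 * M)) :=
        mul_le_mul_of_nonneg_left (by linarith) (by positivity)
    _ = _ := by ring

/-- The number of shifts `b` in `(h, 2h]` for which `n - b` is prime. -/
def hits (h n : ℕ) : Finset ℕ := (Ioc h (2 * h)).filter fun b => (n - b).Prime

lemma card_prime_window_le {h n u v : ℕ} (hu : n ≤ u + 2 * h) (hv : v + h < n) :
    ((Ioc u v).filter Nat.Prime).card ≤ (hits h n).card := by
  refine card_le_card_of_injOn (fun k => n - k) (fun k hk => ?_) fun k hk l hl hkl => ?_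
  · obtain ⟨hk1, hk2⟩ := mem_filter.1 hk
    have := mem_Ioc.1 hk1
    refine mem_coe.2 (mem_filter.2 ⟨mem_Ioc.2 ⟨?_, ?_⟩, ?_⟩)
    · show h < n - k; omega
    · show n - k ≤ 2 * h; omega
    · show (n - (n - k)).Prime
      rwa [Nat.sub_sub_self (by omega)]
  · have h1 := mem_Ioc.1 (mem_filter.1 (mem_coe.1 hk)).1
    have h2 := mem_Ioc.1 (mem_filter.1 (mem_coe.1 hl)).1
    simp only at hkl
    omega

lemma window_index_spec {M h n W : ℕ} (hM : 1 ≤ M) (h8 : 8 * h ≤ M) (hh : 0 < h) (hW : 4 * M ≤ W * h)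
    (hW2 : 10 ≤ W) (hn1 : M < n) (hn2 : n ≤ 2 * M) {m : ℤ} (hm : m = ⌈W * log ((n : ℝ) - h)⌉ - 2) :
    (log M - 2 ≤ ((m + 1 : ℤ) : ℝ) / W ∧ ((m + 1 : ℤ) : ℝ) / W ≤ log M + 1) ∧
    (n : ℝ) - 2 * h ≤ exp ((m : ℝ) / W) ∧ exp (((m + 1 : ℤ) : ℝ) / W) < n - h := by
  have hMR : (1 : ℝ) ≤ M := by exact_mod_cast hM
  have h8R : 8 * (h : ℝ) ≤ M := by exact_mod_cast h8
  have hhR : (0 : ℝ) < h := by exact_mod_cast hh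
  have hWhR : 4 * (M : ℝ) ≤ W * h := by exact_mod_cast hW
  have hWR : (10 : ℝ) ≤ W := by exact_mod_cast hW2
  have hW0 : (0 : ℝ) < W := by linarith
  have hn1R : (M : ℝ) < n := by exact_mod_cast hn1
  have hn2R : (n : ℝ) ≤ 2 * M := by exact_mod_cast hn2
  have hpos : (0 : ℝ) < n - h := by linarith
  have c1 := Int.le_ceil (W * log ((n : ℝ) - h))
  have c2 := Int.ceil_lt_add_one (W * log ((n : ℝ) - h))
  have hm1 : ((m + 1 : ℤ) : ℝ) < W * log ((n : ℝ) - h) := by rw [hm]; push_cast; linarith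
  have hm2 : W * log ((n : ℝ) - h) - 2 ≤ m := by rw [hm]; push_cast; linarith
  have hup : ((m + 1 : ℤ) : ℝ) / W < log ((n : ℝ) - h) := by
    rw [div_lt_iff₀ hW0]; linarith
  have hlow : log ((n : ℝ) - h) - 2 / W ≤ (m : ℝ) / W := by
    rw [le_div_iff₀ hW0, sub_mul, div_mul_cancel₀ _ hW0.ne']; linarith
  have h2W : 2 / (W : ℝ) ≤ 1 / 5 := by rw [div_le_div_iff₀ hW0 (by norm_num)]; linarith
  have hl2 : log 2 < 0.7 := by linarith [log_two_lt_d9]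
  refine ⟨⟨?_, ?_⟩, ?_, ?_⟩
  · have h1 : log (M / 2) ≤ log ((n : ℝ) - h) := log_le_log (by linarith) (by linarith)
    rw [log_div (by linarith) (by norm_num)] at h1
    have h2 : (m : ℝ) / W ≤ ((m + 1 : ℤ) : ℝ) / W :=
      div_le_div_of_nonneg_right (by push_cast; linarith) hW0.le
    linarith
  · have h1 : log ((n : ℝ) - h) ≤ log (2 * M) := log_le_log hpos (by linarith)
    rw [log_mul (by norm_num) (by linarith)] at h1
    linarith
  · have h1 : (1 - 2 / (W : ℝ)) * (n - h) ≤ exp ((m : ℝ) / W) := by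
      calc (1 - 2 / (W : ℝ)) * (n - h) ≤ exp (-(2 / (W : ℝ))) * (n - h) :=
            mul_le_mul_of_nonneg_right (one_sub_le_exp_neg _) hpos.le
        _ = exp (log ((n : ℝ) - h) - 2 / W) := by
            rw [sub_eq_add_neg (log _), exp_add, exp_log hpos]; ring
        _ ≤ _ := exp_le_exp.2 hlow
    have h2 : 2 / (W : ℝ) * (n - h) ≤ h := by
      rw [div_mul_eq_mul_div, div_le_iff₀ hW0]; nlinarith
    linarith
  · calc _ < exp (log ((n : ℝ) - h)) := exp_lt_exp.2 hup
      _ = _ := exp_log hpos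

lemma card_window_fiber_le {M h W : ℕ} (h8 : 8 * h ≤ M) (hh : 0 < h) (hW : 4 * M ≤ W * h)
    (hW0 : 0 < W) {S : Finset ℕ} (hS : ∀ n ∈ S, M < n ∧ n ≤ 2 * M) {m : ℤ}
    (hSm : ∀ n ∈ S, m = ⌈W * log ((n : ℝ) - h)⌉ - 2) : S.card ≤ h := by
  have hWR : (0 : ℝ) < W := by exact_mod_cast hW0
  have h8R : 8 * (h : ℝ) ≤ M := by exact_mod_cast h8
  have hhR : (0 : ℝ) < h := by exact_mod_cast hh
  have hWhR : 4 * (M : ℝ) ≤ W * h := by exact_mod_cast hW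
  have key : ∀ n ∈ S, ∀ l ∈ S, l < n + h := by
    intro n hn l hl
    have n1 : (M : ℝ) < n := by exact_mod_cast (hS n hn).1
    have l1 : (M : ℝ) < l := by exact_mod_cast (hS l hl).1
    have l2 : (l : ℝ) ≤ 2 * M := by exact_mod_cast (hS l hl).2
    have hc : ⌈W * log ((n : ℝ) - h)⌉ = ⌈W * log ((l : ℝ) - h)⌉ := by
      have := hSm n hn; have := hSm l hl; omega
    have c1 := Int.ceil_lt_add_one (W * log ((n : ℝ) - h))
    have c2 := Int.le_ceil (W * log ((l : ℝ) - h))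
    rw [← hc] at c2
    have hnp : (0 : ℝ) < n - h := by linarith
    have hlp : (0 : ℝ) < l - h := by linarith
    have h1 : log ((l : ℝ) - h) - 1 / W < log ((n : ℝ) - h) := by
      rw [sub_lt_iff_lt_add, ← sub_lt_iff_lt_add', lt_div_iff₀ hWR]; nlinarith
    have h2 : (1 - 1 / (W : ℝ)) * (l - h) < n - h := by
      calc (1 - 1 / (W : ℝ)) * (l - h) ≤ exp (-(1 / (W : ℝ))) * (l - h) :=
            mul_le_mul_of_nonneg_right (one_sub_le_exp_neg _) hlp.le
        _ = exp (log ((l : ℝ) - h) - 1 / W) := by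
            rw [sub_eq_add_neg (log _), exp_add, exp_log hlp]; ring
        _ < exp (log ((n : ℝ) - h)) := exp_lt_exp.2 h1
        _ = _ := exp_log hnp
    have h3 : 1 / (W : ℝ) * (l - h) ≤ h := by
      rw [div_mul_eq_mul_div, div_le_iff₀ hWR]; nlinarith
    have : (l : ℝ) < n + h := by linarith
    exact_mod_cast this
  rcases S.eq_empty_or_nonempty with rfl | hne
  · simp
  · have hsub : S ⊆ Ico (S.min' hne) (S.min' hne + h) := fun l hl =>
      mem_Ico.2 ⟨S.min'_le l hl, key _ (S.min'_mem hne) l hl⟩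
    simpa using card_le_card hsub

theorem exists_hits_bound {ε : ℝ} (hε : 0 < ε) : ∃ δ : ℝ, 0 < δ ∧ δ ≤ 1 / 4 ∧ ∃ η : ℝ, 0 < η ∧
    ∀ᶠ M : ℕ in atTop, ∀ h : ℕ, (M : ℝ) ^ (1 - δ) ≤ h → h * log M ≤ M →
      ((((Ioc M (2 * M)).filter fun n => ((hits h n).card : ℝ) < η * h / log M).card : ℕ) : ℝ) ≤
        ε * M := by
  obtain ⟨η, hη, δ₀, hδ₀, hev⟩ := exists_window_bound (ε := ε / 5) (by positivity)
  set δ : ℝ := min (δ₀ / 2) (1 / 4) with hδdef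
  have hδ : 0 < δ := lt_min (by positivity) (by norm_num)
  have hδ1 : δ ≤ δ₀ / 2 := min_le_left _ _
  have hδ2 : δ ≤ 1 / 4 := min_le_right _ _
  clear_value δ
  refine ⟨δ, hδ, hδ2, η / 40, by positivity, ?_⟩
  have hlogt : Tendsto (fun M : ℕ => log (M : ℝ)) atTop atTop :=
    tendsto_log_atTop.comp tendsto_natCast_atTop_atTop
  have hA : ∀ᶠ M : ℕ in atTop, 5 ≤ (M : ℝ) ^ δ :=
    ((tendsto_rpow_atTop hδ).comp tendsto_natCast_atTop_atTop).eventually_ge_atTop 5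
  have hB : ∀ᶠ M : ℕ in atTop, 160 * log (M : ℝ) ≤ η * (M : ℝ) ^ (1 / 4 : ℝ) := by
    have h1 := (isLittleO_log_rpow_atTop (r := 1 / 4) (by norm_num)).bound
      (c := η / 160) (by positivity)
    filter_upwards [tendsto_natCast_atTop_atTop.eventually h1,
      tendsto_natCast_atTop_atTop.eventually (eventually_ge_atTop (1 : ℝ))] with M hM hM1
    rw [norm_of_nonneg (log_nonneg hM1), norm_of_nonneg (by positivity)] at hM
    linarith
  filter_upwards [hlogt.eventually hev, hlogt.eventually_ge_atTop 8, hA, hB,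
    eventually_ge_atTop 1] with M hwin hlog8 h5 h160 hM1 h hh1 hh2
  have hMR : (1 : ℝ) ≤ M := by exact_mod_cast hM1
  have hM0 : (0 : ℝ) < M := by linarith
  have hhR : (0 : ℝ) < h := lt_of_lt_of_le (by positivity) hh1
  have hh : 0 < h := by exact_mod_cast hhR
  have h8R : 8 * (h : ℝ) ≤ M := by nlinarith
  have h8 : 8 * h ≤ M := by exact_mod_cast h8R
  set W : ℕ := ⌈4 * (M : ℝ) / h⌉₊ with hWdef
  have hW1 : 4 * (M : ℝ) / h ≤ W := Nat.le_ceil _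
  have hW2 : (W : ℝ) < 4 * (M : ℝ) / h + 1 := Nat.ceil_lt_add_one (by positivity)
  clear_value W
  have hMh1 : 1 ≤ (M : ℝ) / h := by rw [le_div_iff₀ hhR]; linarith
  have hW3 : (W : ℝ) ≤ 5 * (M / h) := by rw [mul_div_assoc] at hW2; linarith
  have hWhR : 4 * (M : ℝ) ≤ W * h := by rwa [div_le_iff₀ hhR] at hW1
  have hWh : 4 * M ≤ W * h := by exact_mod_cast hWhR
  have hWlog : log M ≤ W := by
    refine le_trans ?_ hW1
    rw [le_div_iff₀ hhR]; nlinarith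
  have hW10R : (10 : ℝ) ≤ W := by
    refine le_trans ?_ hW1
    rw [le_div_iff₀ hhR]; nlinarith
  have hW10 : 10 ≤ W := by exact_mod_cast hW10R
  have hW0 : (0 : ℝ) < W := by linarith
  have hMδ : (M : ℝ) / h ≤ (M : ℝ) ^ δ := by
    rw [div_le_iff₀ hhR]
    calc (M : ℝ) = (M : ℝ) ^ δ * (M : ℝ) ^ (1 - δ) := by rw [← rpow_add hM0]; simp
      _ ≤ _ := mul_le_mul_of_nonneg_left hh1 (by positivity)
  have hWexp : (W : ℝ) ≤ exp (δ₀ * log M) := by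
    calc (W : ℝ) ≤ 5 * (M / h) := hW3
      _ ≤ (M : ℝ) ^ δ * (M : ℝ) ^ δ := mul_le_mul h5 hMδ (by positivity) (by positivity)
      _ = (M : ℝ) ^ (δ + δ) := (rpow_add hM0 _ _).symm
      _ ≤ (M : ℝ) ^ δ₀ := rpow_le_rpow_of_exponent_le hMR (by linarith)
      _ = _ := by rw [rpow_def_of_pos hM0, mul_comm]
  set Bad := (Ioc M (2 * M)).filter fun n => ((hits h n).card : ℝ) < η / 40 * h / log M with hBad
  set idx : ℕ → ℤ := fun n => ⌈W * log ((n : ℝ) - h)⌉ - 2 with hidx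
  have hBadmem : ∀ n ∈ Bad, M < n ∧ n ≤ 2 * M := fun n hn => mem_Ioc.1 (mem_filter.1 hn).1
  have hcard : Bad.card ≤ h * (Bad.image idx).card := by
    refine card_le_mul_card_image _ _ fun m _ => ?_
    refine card_window_fiber_le h8 hh hWh (by omega)
      (fun n hn => hBadmem n (mem_filter.1 hn).1) (m := m) fun n hn => (mem_filter.1 hn).2.symm
  have hT := hwin W hWlog hWexp (Bad.image idx) (by
    intro m hm
    obtain ⟨n, hn, hnm⟩ := mem_image.1 hm
    obtain ⟨hn1, hn2⟩ := hBadmem n hn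
    obtain ⟨⟨a1, a2⟩, a3, a4⟩ := window_index_spec hM1 h8 hh hWh hW10 hn1 hn2 hnm.symm
    refine ⟨a1, a2, ?_⟩
    have hn1R : (M : ℝ) < n := by exact_mod_cast hn1
    have hn2R : (n : ℝ) ≤ 2 * M := by exact_mod_cast hn2
    set u := ⌊exp ((m : ℝ) / W)⌋₊ with hu
    set v := ⌊exp (((m + 1 : ℤ) : ℝ) / W)⌋₊ with hv
    have hu2 : n - 2 * h ≤ u := by
      refine Nat.le_floor ?_
      rw [Nat.cast_sub (by omega)]; push_cast; exact a3
    have hv2 : v + h < n := by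
      have : (v : ℝ) ≤ exp (((m + 1 : ℤ) : ℝ) / W) := Nat.floor_le (exp_pos _).le
      have : (v : ℝ) + h < n := by linarith
      exact_mod_cast this
    have b1 := sum_vonMangoldt_div_le (M := M) (u := u) (v := v) hM1 (by omega) (by omega)
    have b2 : (((Ioc u v).filter Nat.Prime).card : ℝ) ≤ (hits h n).card := by
      exact_mod_cast card_prime_window_le (by omega) hv2
    have b3 : ((hits h n).card : ℝ) < η / 40 * h / log M := (mem_filter.1 hn).2
    have hl2 : log (2 * (M : ℝ)) ≤ 2 * log M := by
      rw [log_mul (by norm_num) hM0.ne']; linarith [log_two_lt_d9]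
    have hl0 : 0 < log (M : ℝ) := by linarith
    have hsq : √(2 * (M : ℝ)) ≤ 2 * (M : ℝ) ^ (1 / 2 : ℝ) := by
      rw [sqrt_mul (by norm_num), sqrt_eq_rpow (M : ℝ)]
      refine mul_le_mul_of_nonneg_right ?_ (by positivity)
      rw [sqrt_le_left (by norm_num)]; norm_num
    have hpp : 160 * log M * (M : ℝ) ^ (1 / 2 : ℝ) ≤ η * h := by
      calc 160 * log M * (M : ℝ) ^ (1 / 2 : ℝ)
          ≤ η * (M : ℝ) ^ (1 / 4 : ℝ) * (M : ℝ) ^ (1 / 2 : ℝ) :=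
            mul_le_mul_of_nonneg_right h160 (by positivity)
        _ = η * (M : ℝ) ^ (3 / 4 : ℝ) := by rw [mul_assoc, ← rpow_add hM0]; norm_num
        _ ≤ η * h := by
            refine mul_le_mul_of_nonneg_left (le_trans ?_ hh1) hη.le
            exact rpow_le_rpow_of_exponent_le hMR (by linarith)
    calc ∑ k ∈ Ioc u v, Λ k / k
        ≤ 2 * log (2 * M) / M * (((Ioc u v).filter Nat.Prime).card + 2 * √(2 * M)) := b1
      _ ≤ 2 * (2 * log M) / M * (η / 40 * h / log M + 2 * (2 * (M : ℝ) ^ (1 / 2 : ℝ))) := by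
          refine mul_le_mul ?_ (by linarith) (by positivity) (by positivity)
          exact div_le_div_of_nonneg_right (by linarith) hM0.le
      _ = (η * h / 10 + 16 * log M * (M : ℝ) ^ (1 / 2 : ℝ)) / M := by field_simp; ring
      _ ≤ (η * h / 5) / M := div_le_div_of_nonneg_right (by linarith) hM0.le
      _ ≤ η / W := by
          rw [div_le_div_iff₀ hM0 hW0]
          have : (W : ℝ) * h ≤ 5 * M := by
            calc (W : ℝ) * h ≤ 5 * (M / h) * h := mul_le_mul_of_nonneg_right hW3 hhR.le
              _ = _ := by field_simp
          nlinarith)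
  calc (Bad.card : ℝ) ≤ h * (Bad.image idx).card := by exact_mod_cast hcard
    _ ≤ h * (ε / 5 * W) := mul_le_mul_of_nonneg_left hT hhR.le
    _ ≤ h * (ε / 5 * (5 * (M / h))) := by
        refine mul_le_mul_of_nonneg_left (mul_le_mul_of_nonneg_left hW3 (by positivity)) hhR.le
    _ = _ := by field_simp

section Greedy

variable {ι β : Type*} (cov : β → ℕ → Prop)

open Classical in
/-- The elements of `G` covered by no element of `T`. -/
noncomputable def uncovered (G : Finset ℕ) (T : Finset β) : Finset ℕ :=
  G.filter fun n => ∀ b ∈ T, ¬ cov b n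

lemma exp_neg_le_of_le_one {x : ℝ} (h0 : 0 ≤ x) (h1 : x ≤ 1) : exp (-x) ≤ 1 - x / 2 := by
  rw [exp_neg, inv_le_comm₀ (exp_pos _) (by linarith)]
  refine le_trans ?_ (quadratic_le_exp_of_nonneg h0)
  rw [inv_le_iff_one_le_mul₀ (by linarith)]
  nlinarith [mul_nonneg h0 (sub_nonneg.2 h1)]

open Classical in
lemma card_uncovered_insert (G : Finset ℕ) (T : Finset β) (b : β) :
    ((uncovered cov G (insert b T)).card : ℝ) =
      (uncovered cov G T).card - ((uncovered cov G T).filter (cov b)).card := by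
  have h := card_filter_add_card_filter_not (s := uncovered cov G T) (cov b)
  have h2 : uncovered cov G (insert b T) = (uncovered cov G T).filter fun n => ¬ cov b n := by
    ext n
    simp only [uncovered, mem_filter, mem_insert, forall_eq_or_imp]
    tauto
  rw [h2, ← h]; push_cast; ring

open Classical in
lemma exists_greedy_cover (S : Finset ι) (A : Finset β) (hA : A.Nonempty) (G : ι → Finset ℕ)
    (g : ι → ℝ) (hg : ∀ m ∈ S, 0 < g m) (hG : ∀ m ∈ S, ((G m).card : ℝ) ≤ g m) {s γ ε : ℝ}
    (hs : 0 ≤ s) (hγ : 0 ≤ γ)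
    (h1 : ∀ m ∈ S, ∀ b ∈ A, s * ((G m).filter (cov b)).card ≤ g m)
    (h2 : ∀ m ∈ S, ∀ U ⊆ G m, ε * g m ≤ U.card →
      γ * g m * A.card ≤ ∑ b ∈ A, ((U.filter (cov b)).card : ℝ)) (t : ℕ) :
    ∃ T ⊆ A, T.card ≤ t ∧ ∑ m ∈ S, exp (s * ((uncovered cov (G m) T).card / g m)) ≤
      exp (-(s * γ / 2)) ^ t * (S.card * exp s) + S.card * exp (s * ε) := by
  set ρ := exp (-(s * γ / 2)) with hρ
  have hρ0 : 0 < ρ := exp_pos _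
  have hρ1 : ρ ≤ 1 := exp_le_one_iff.2 (by nlinarith)
  induction t with
  | zero =>
    refine ⟨∅, empty_subset _, by simp, ?_⟩
    have : ∑ m ∈ S, exp (s * ((uncovered cov (G m) (∅ : Finset β)).card / g m)) ≤ S.card * exp s := by
      rw [← nsmul_eq_mul]
      refine sum_le_card_nsmul _ _ _ fun m hm => exp_le_exp.2 ?_
      refine mul_le_of_le_one_right hs ((div_le_one (hg m hm)).2 (le_trans ?_ (hG m hm)))
      exact_mod_cast card_le_card (filter_subset _ _)
    have h0 : (0 : ℝ) ≤ S.card * exp (s * ε) := by positivity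
    linarith
  | succ t ih =>
    obtain ⟨T, hTA, hTt, hT⟩ := ih
    set u : ι → ℝ := fun m => (uncovered cov (G m) T).card / g m with hu
    set c : β → ι → ℝ := fun b m => ((uncovered cov (G m) T).filter (cov b)).card / g m with hc
    have hA0 : (0 : ℝ) < A.card := by exact_mod_cast hA.card_pos
    have hstep : ∀ m ∈ S, ∑ b ∈ A, exp (s * (u m - c b m)) ≤
        A.card * (ρ * exp (s * u m) + (1 - ρ) * exp (s * ε)) := by
      intro m hm
      have hgm := hg m hm
      have hc0 : ∀ b, 0 ≤ c b m := fun b => by positivity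
      have hle : ∀ b ∈ A, exp (s * (u m - c b m)) ≤ exp (s * u m) * (1 - s * c b m / 2) := by
        intro b hb
        rw [mul_sub, sub_eq_add_neg, exp_add]
        refine mul_le_mul_of_nonneg_left (exp_neg_le_of_le_one (mul_nonneg hs (hc0 b)) ?_) (exp_pos _).le
        rw [hc]
        simp only
        rw [← mul_div_assoc, div_le_one hgm]
        refine le_trans (mul_le_mul_of_nonneg_left ?_ hs) (h1 m hm b hb)
        exact_mod_cast card_le_card (filter_subset_filter _ (filter_subset _ _))
      rcases le_or_gt ε (u m) with hε | hε
      · have hsum : γ * A.card ≤ ∑ b ∈ A, c b m := by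
          rw [hc, ← sum_div, le_div_iff₀ hgm]
          have := h2 m hm (uncovered cov (G m) T) (filter_subset _ _) ((le_div_iff₀ hgm).1 hε)
          linarith
        calc ∑ b ∈ A, exp (s * (u m - c b m))
            ≤ ∑ b ∈ A, exp (s * u m) * (1 - s * c b m / 2) := sum_le_sum hle
          _ = exp (s * u m) * (A.card - s / 2 * ∑ b ∈ A, c b m) := by
              rw [← mul_sum, sum_sub_distrib, mul_sum]
              simp only [sum_const, nsmul_eq_mul, mul_one]
              congr 2
              exact sum_congr rfl fun b _ => by ring
          _ ≤ exp (s * u m) * (A.card * ρ) := by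
              refine mul_le_mul_of_nonneg_left ?_ (exp_pos _).le
              have e1 : 1 - s * γ / 2 ≤ ρ := one_sub_le_exp_neg _
              have e2 := mul_le_mul_of_nonneg_left hsum (by linarith : 0 ≤ s / 2)
              nlinarith
          _ ≤ _ := by
              have : 0 ≤ A.card * ((1 - ρ) * exp (s * ε)) :=
                mul_nonneg hA0.le (mul_nonneg (by linarith) (exp_pos _).le)
              nlinarith
      · calc ∑ b ∈ A, exp (s * (u m - c b m)) ≤ A.card * exp (s * u m) := by
              rw [← nsmul_eq_mul]
              refine sum_le_card_nsmul _ _ _ fun b hb => exp_le_exp.2 ?_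
              nlinarith [mul_nonneg hs (hc0 b)]
          _ ≤ _ := by
              refine mul_le_mul_of_nonneg_left ?_ hA0.le
              have : exp (s * u m) ≤ exp (s * ε) := exp_le_exp.2 (mul_le_mul_of_nonneg_left hε.le hs)
              nlinarith
    have havg : ∑ b ∈ A, ∑ m ∈ S, exp (s * (u m - c b m)) ≤
        ∑ b ∈ A, (ρ * (∑ m ∈ S, exp (s * u m)) + (1 - ρ) * (S.card * exp (s * ε))) := by
      rw [sum_comm, sum_const, nsmul_eq_mul]
      refine (sum_le_sum hstep).trans (le_of_eq ?_)
      rw [← mul_sum, sum_add_distrib, mul_sum]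
      simp only [sum_const, nsmul_eq_mul]
      ring
    obtain ⟨b, hb, hbb⟩ := exists_le_of_sum_le hA havg
    refine ⟨insert b T, insert_subset hb hTA, (card_insert_le _ _).trans (by omega), ?_⟩
    calc ∑ m ∈ S, exp (s * ((uncovered cov (G m) (insert b T)).card / g m))
        = ∑ m ∈ S, exp (s * (u m - c b m)) := by
          refine sum_congr rfl fun m _ => ?_
          rw [card_uncovered_insert, sub_div]
      _ ≤ ρ * (∑ m ∈ S, exp (s * u m)) + (1 - ρ) * (S.card * exp (s * ε)) := hbb
      _ ≤ ρ * (ρ ^ t * (S.card * exp s) + S.card * exp (s * ε)) + (1 - ρ) * (S.card * exp (s * ε)) :=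
          add_le_add_left (mul_le_mul_of_nonneg_left hT hρ0.le) _
      _ = _ := by ring

open Classical in
/-- A greedy cover leaves only a small proportion of every ground set uncovered. -/
theorem exists_cover (S : Finset ι) (A : Finset β) (hA : A.Nonempty) (G : ι → Finset ℕ)
    (g : ι → ℝ) (hg : ∀ m ∈ S, 0 < g m) (hG : ∀ m ∈ S, ((G m).card : ℝ) ≤ g m) {s γ ε : ℝ}
    (hs : 0 < s) (hγ : 0 < γ) (hε : 0 ≤ ε)
    (h1 : ∀ m ∈ S, ∀ b ∈ A, s * ((G m).filter (cov b)).card ≤ g m)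
    (h2 : ∀ m ∈ S, ∀ U ⊆ G m, ε * g m ≤ U.card →
      γ * g m * A.card ≤ ∑ b ∈ A, ((U.filter (cov b)).card : ℝ)) :
    ∃ T ⊆ A, (T.card : ℝ) ≤ 2 / γ + 1 ∧
      ∀ m ∈ S, ((uncovered cov (G m) T).card : ℝ) ≤ (ε + log (2 * S.card) / s) * g m := by
  obtain ⟨T, hTA, hTt, hT⟩ := exists_greedy_cover cov S A hA G g hg hG hs.le hγ.le h1 h2 ⌈2 / γ⌉₊
  refine ⟨T, hTA, ?_, fun m hm => ?_⟩
  · have := Nat.ceil_lt_add_one (by positivity : 0 ≤ 2 / γ)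
    have : (T.card : ℝ) ≤ ⌈2 / γ⌉₊ := by exact_mod_cast hTt
    linarith
  · have hS : (0 : ℝ) < S.card := by exact_mod_cast card_pos.2 ⟨m, hm⟩
    have hpow : exp (-(s * γ / 2)) ^ ⌈2 / γ⌉₊ * exp s ≤ 1 := by
      rw [← exp_nat_mul, ← exp_add, exp_le_one_iff]
      have h3 : 2 / γ ≤ ⌈2 / γ⌉₊ := Nat.le_ceil _
      have h4 : 2 ≤ ⌈2 / γ⌉₊ * γ := by rwa [div_le_iff₀ hγ] at h3
      nlinarith
    have h5 : exp (s * ((uncovered cov (G m) T).card / g m)) ≤ 2 * S.card * exp (s * ε) := by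
      have h6 := single_le_sum (f := fun m => exp (s * ((uncovered cov (G m) T).card / g m)))
        (fun i _ => (exp_pos _).le) hm
      have h7 : (1 : ℝ) ≤ exp (s * ε) := one_le_exp (by positivity)
      have h8 : exp (-(s * γ / 2)) ^ ⌈2 / γ⌉₊ * (S.card * exp s) ≤ S.card * exp (s * ε) := by
        calc _ = S.card * (exp (-(s * γ / 2)) ^ ⌈2 / γ⌉₊ * exp s) := by ring
          _ ≤ S.card * exp (s * ε) := mul_le_mul_of_nonneg_left (hpow.trans h7) hS.le
      linarith
    have h9 := log_le_log (exp_pos _) h5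
    rw [log_exp, log_mul (by positivity) (exp_pos _).ne', log_exp] at h9
    have hgm := hg m hm
    rw [← div_le_iff₀ hgm]
    have : s * (ε + log (2 * S.card) / s) = log (2 * S.card) + s * ε := by field_simp; ring
    rw [← this] at h9
    exact le_of_mul_le_mul_left h9 hs

end Greedy

/-- The integer `n` is a prime shifted by `b`. -/
def PrimeShift (b n : ℕ) : Prop := (n - b).Prime

open Classical in
lemma card_filter_primeShift_le {S : Finset ℕ} {N : ℕ} (hS : ∀ n ∈ S, n ≤ N) (b : ℕ) :
    (S.filter (PrimeShift b)).card ≤ Nat.primeCounting N := by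
  rw [Nat.primeCounting, Nat.primeCounting', Nat.count_eq_card_filter_range]
  refine card_le_card_of_injOn (fun n => n - b) (fun n hn => ?_) fun n hn l hl hnl => ?_
  · obtain ⟨h1, h2⟩ := mem_filter.1 hn
    have := hS n h1
    refine mem_coe.2 (mem_filter.2 ⟨mem_range.2 ?_, h2⟩)
    show n - b < N + 1
    omega
  · have h1 : (n - b).Prime := (mem_filter.1 (mem_coe.1 hn)).2
    have h2 : (l - b).Prime := (mem_filter.1 (mem_coe.1 hl)).2
    have := h1.two_le
    have := h2.two_le
    simp only at hnl
    omega

open Classical in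
lemma sum_card_filter_primeShift (h : ℕ) (U : Finset ℕ) :
    ∑ b ∈ Ioc h (2 * h), ((U.filter (PrimeShift b)).card : ℝ) = ∑ n ∈ U, ((hits h n).card : ℝ) := by
  have := sum_card_bipartiteAbove_eq_sum_card_bipartiteBelow (s := Ioc h (2 * h)) (t := U) PrimeShift
  have h2 : ∀ n, bipartiteBelow PrimeShift (Ioc h (2 * h)) n = hits h n := fun n => by
    unfold bipartiteBelow hits PrimeShift
    exact filter_congr_decidable _ _ _
  simp only [h2] at this
  exact_mod_cast this

lemma eventually_primeCounting_two_pow_le :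
    ∀ᶠ m : ℕ in atTop, (m : ℝ) * Nat.primeCounting (2 * 2 ^ m) ≤ 9 * 2 ^ m := by
  have ht : Tendsto (fun m : ℕ => ((2 * 2 ^ m : ℕ) : ℝ)) atTop atTop := by
    refine tendsto_natCast_atTop_atTop.comp (tendsto_atTop_mono (fun m => ?_) tendsto_id)
    have : m < 2 ^ m := Nat.lt_two_pow_self
    simp only [id]; omega
  filter_upwards [ht.eventually (Chebyshev.eventually_primeCounting_le (ε := 1) one_pos)] with m hm
  rw [Nat.floor_natCast] at hm
  have hl : log ((2 * 2 ^ m : ℕ) : ℝ) = (m + 1) * log 2 := by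
    rw [← pow_succ']; push_cast; rw [log_pow]; push_cast; ring
  have hl2 := log_two_gt_d9
  have hl4 : log 4 ≤ 1.4 := by
    rw [show (4 : ℝ) = 2 ^ 2 by norm_num, log_pow]; push_cast; linarith [log_two_lt_d9]
  rw [hl, le_div_iff₀ (by positivity)] at hm
  push_cast at hm
  have h2m : (0 : ℝ) < 2 ^ m := by positivity
  have hpi : (0 : ℝ) ≤ (Nat.primeCounting (2 * 2 ^ m) : ℝ) := Nat.cast_nonneg _
  have hm' : (Nat.primeCounting (2 * 2 ^ m) : ℝ) * ((m + 1) * log 2) ≤ 2.4 * (2 * 2 ^ m) :=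
    hm.trans (mul_le_mul_of_nonneg_right (by linarith) (by positivity))
  have h3 : (Nat.primeCounting (2 * 2 ^ m) : ℝ) * m * 0.69 ≤
      Nat.primeCounting (2 * 2 ^ m) * ((m + 1) * log 2) := by
    rw [mul_assoc]
    refine mul_le_mul_of_nonneg_left ?_ hpi
    have : (0 : ℝ) ≤ m := Nat.cast_nonneg m
    nlinarith
  linarith

theorem exists_stage {ε : ℝ} (hε : 0 < ε) : ∃ r : ℝ, 1 < r ∧ r ≤ 2 ∧ ∃ K : ℝ, 0 < K ∧
    ∀ᶠ R : ℝ in atTop, ∃ T : Finset ℕ, (T.card : ℝ) ≤ K * R ∧ (∀ b ∈ T, R ≤ 4 * log b) ∧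
      ∀ m : ℕ, R ≤ m → m < r * R →
        ((uncovered PrimeShift (Ioc (2 ^ m) (2 * 2 ^ m)) T).card : ℝ) ≤ ε * 2 ^ m := by
  classical
  obtain ⟨δ, hδ, hδ1, η, hη, hev⟩ := exists_hits_bound (ε := ε / 4) (by positivity)
  obtain ⟨M₀, hM₀⟩ := eventually_atTop.1 hev
  obtain ⟨m₁, hm₁⟩ := eventually_atTop.1 eventually_primeCounting_two_pow_le
  refine ⟨1 + δ / 4, by linarith, by linarith, 16 / (ε * η) + 1, by positivity, ?_⟩
  have hc : 0 < δ / 2 * log 2 := mul_pos (by linarith) (log_pos (by norm_num))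
  have hE1 : ∀ᶠ R : ℝ in atTop, 2 * R ≤ exp (δ / 2 * log 2 * R) := by
    have h1 := (isLittleO_pow_exp_pos_mul_atTop (k := 1) hc).bound (c := 1 / 2) (by norm_num)
    filter_upwards [h1, eventually_ge_atTop 0] with R hR hR0
    rw [pow_one, norm_of_nonneg hR0, norm_of_nonneg (exp_pos _).le] at hR
    linarith
  have hE2 : ∀ᶠ R : ℝ in atTop, 9 * log (6 * R) ≤ ε / 2 * R := by
    have h1 := isLittleO_log_id_atTop.bound (c := ε / 108) (by positivity)
    have ht : Tendsto (fun R : ℝ => 6 * R) atTop atTop := tendsto_id.const_mul_atTop (by norm_num)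
    filter_upwards [ht.eventually h1, eventually_ge_atTop 1] with R hR hR0
    rw [norm_of_nonneg (log_nonneg (by linarith)), id, norm_of_nonneg (by linarith)] at hR
    linarith
  filter_upwards [hE1, hE2, eventually_ge_atTop (4 / δ), eventually_ge_atTop (M₀ : ℝ),
    eventually_ge_atTop (m₁ : ℝ)] with R hR1 hR2 hRδ hRM hRm
  rw [div_le_iff₀ hδ] at hRδ
  have hR16 : 16 ≤ R := by nlinarith
  have hR0 : 0 < R := by linarith
  set a : ℕ := ⌊(1 - δ / 2) * R⌋₊ with ha
  have ha1 : (a : ℝ) ≤ (1 - δ / 2) * R := Nat.floor_le (by nlinarith)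
  have ha2 : (1 - δ / 2) * R - 1 < a := Nat.sub_one_lt_floor _
  have ha3 : (1 - 3 * δ / 4) * R ≤ a := by nlinarith
  set S : Finset ℕ := (range ⌈(1 + δ / 4) * R⌉₊).filter fun m => R ≤ (m : ℝ) with hS
  have hSmem : ∀ m, m ∈ S ↔ R ≤ m ∧ (m : ℝ) < (1 + δ / 4) * R := by
    intro m
    rw [hS, mem_filter, mem_range, Nat.lt_ceil, and_comm]
  have hScard : (S.card : ℝ) ≤ 3 * R := by
    have h1 : S.card ≤ ⌈(1 + δ / 4) * R⌉₊ := (card_filter_le _ _).trans (by simp)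
    have h2 : (⌈(1 + δ / 4) * R⌉₊ : ℝ) < (1 + δ / 4) * R + 1 := Nat.ceil_lt_add_one (by positivity)
    have h3 : (S.card : ℝ) ≤ ⌈(1 + δ / 4) * R⌉₊ := by exact_mod_cast h1
    nlinarith
  have h2r : ∀ k : ℕ, (2 : ℝ) ^ k = exp (k * log 2) := fun k => by
    rw [mul_comm, exp_mul, exp_log (by norm_num), rpow_natCast]
  have hl2 : 0 < log 2 := log_pos (by norm_num)
  have hl2' : log 2 ≤ 1 := by linarith [log_two_lt_d9]
  have hbad : ∀ m ∈ S, ((((Ioc (2 ^ m) (2 * 2 ^ m)).filter fun n =>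
      ((hits (2 ^ a) n).card : ℝ) < η * 2 ^ a / log (2 ^ m)).card : ℕ) : ℝ) ≤ ε / 4 * 2 ^ m := by
    intro m hm
    obtain ⟨hm1, hm2⟩ := (hSmem m).1 hm
    have hMm : M₀ ≤ 2 ^ m := by
      have : (M₀ : ℝ) ≤ m := hRM.trans hm1
      have : M₀ ≤ m := by exact_mod_cast this
      exact this.trans Nat.lt_two_pow_self.le
    have := hM₀ (2 ^ m) hMm (2 ^ a) ?_ ?_
    · push_cast at this; exact this
    · push_cast
      rw [h2r m, ← exp_mul, h2r a]
      refine exp_le_exp.2 ?_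
      have : (m : ℝ) * (1 - δ) ≤ a := by nlinarith
      nlinarith
    · push_cast
      rw [log_pow]
      have h1 : (m : ℝ) * log 2 ≤ exp (δ / 2 * log 2 * R) := by nlinarith
      calc (2 : ℝ) ^ a * (m * log 2) ≤ exp ((1 - δ / 2) * R * log 2) * exp (δ / 2 * log 2 * R) := by
            refine mul_le_mul ?_ h1 (by positivity) (exp_pos _).le
            rw [h2r]
            exact exp_le_exp.2 (mul_le_mul_of_nonneg_right ha1 hl2.le)
        _ = exp (R * log 2) := by rw [← exp_add]; ring_nf
        _ ≤ 2 ^ m := by rw [h2r]; exact exp_le_exp.2 (mul_le_mul_of_nonneg_right hm1 hl2.le)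
  obtain ⟨T, hTA, hTc, hTu⟩ := exists_cover PrimeShift S (Ioc (2 ^ a) (2 * 2 ^ a))
    ⟨2 ^ a + 1, mem_Ioc.2 ⟨by omega, by have := Nat.one_le_two_pow (n := a); omega⟩⟩
    (fun m => Ioc (2 ^ m) (2 * 2 ^ m)) (fun m => (2 : ℝ) ^ m) (fun m _ => by positivity)
    (fun m _ => by
      rw [Nat.card_Ioc, show 2 * 2 ^ m - 2 ^ m = 2 ^ m by omega]; push_cast; exact le_rfl)
    (s := R / 9) (γ := ε / 4 * η / (2 * R)) (ε := ε / 2) (by positivity) (by positivity) (by positivity)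
    (fun m hm b _ => by
      obtain ⟨hm1, hm2⟩ := (hSmem m).1 hm
      have h1 : m₁ ≤ m := by exact_mod_cast hRm.trans hm1
      have h2 := hm₁ m h1
      have h3 : (((Ioc (2 ^ m) (2 * 2 ^ m)).filter (PrimeShift b)).card : ℝ) ≤
        Nat.primeCounting (2 * 2 ^ m) := by
        exact_mod_cast card_filter_primeShift_le (fun n hn => (mem_Ioc.1 hn).2) b
      have h4 := mul_le_mul hm1 h3 (Nat.cast_nonneg _) (Nat.cast_nonneg m)
      linarith)
    (fun m hm U hU hUc => by
      obtain ⟨hm1, hm2⟩ := (hSmem m).1 hm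
      have hb := hbad m hm
      set Bad := (Ioc (2 ^ m) (2 * 2 ^ m)).filter fun n =>
        ((hits (2 ^ a) n).card : ℝ) < η * 2 ^ a / log (2 ^ m) with hBad
      have hlog : log ((2 : ℝ) ^ m) ≤ 2 * R := by rw [log_pow]; nlinarith
      have hlog0 : 0 < log ((2 : ℝ) ^ m) := by
        rw [log_pow]; exact mul_pos (by linarith) hl2
      have hsub : U.card ≤ (U \ Bad).card + Bad.card := by
        have := le_card_sdiff Bad U; omega
      have hsubR : (U.card : ℝ) ≤ (U \ Bad).card + Bad.card := by exact_mod_cast hsub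
      rw [sum_card_filter_primeShift, Nat.card_Ioc, show 2 * 2 ^ a - 2 ^ a = 2 ^ a by omega]
      push_cast
      calc ε / 4 * η / (2 * R) * 2 ^ m * 2 ^ a = ε / 4 * 2 ^ m * (η * 2 ^ a / (2 * R)) := by ring
        _ ≤ (U \ Bad).card * (η * 2 ^ a / log (2 ^ m)) := by
            refine mul_le_mul (by linarith) ?_ (by positivity) (by positivity)
            exact div_le_div_of_nonneg_left (by positivity) hlog0 hlog
        _ ≤ ∑ n ∈ U \ Bad, ((hits (2 ^ a) n).card : ℝ) := by
            rw [← nsmul_eq_mul]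
            refine card_nsmul_le_sum _ _ _ fun n hn => ?_
            obtain ⟨hn1, hn2⟩ := mem_sdiff.1 hn
            by_contra hlt
            exact hn2 (mem_filter.2 ⟨hU hn1, not_le.1 hlt⟩)
        _ ≤ _ := sum_le_sum_of_subset_of_nonneg sdiff_subset fun _ _ _ => Nat.cast_nonneg _)
  refine ⟨T, ?_, fun b hb => ?_, fun m hm1 hm2 => ?_⟩
  · refine hTc.trans ?_
    have : 2 / (ε / 4 * η / (2 * R)) = 16 / (ε * η) * R := by field_simp; norm_num
    rw [this]; linarith
  · have hb1 : 2 ^ a < b := (mem_Ioc.1 (hTA hb)).1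
    have hb2 : (2 : ℝ) ^ a ≤ b := by exact_mod_cast hb1.le
    have hb3 := log_le_log (by positivity) hb2
    rw [log_pow] at hb3
    have h1 : R / 2 ≤ a := by nlinarith
    have h2 := log_two_gt_d9
    nlinarith
  · refine (hTu m ((hSmem m).2 ⟨hm1, hm2⟩)).trans ?_
    refine mul_le_mul_of_nonneg_right ?_ (by positivity)
    have hS0 : (0 : ℝ) < S.card := by
      exact_mod_cast card_pos.2 ⟨m, (hSmem m).2 ⟨hm1, hm2⟩⟩
    have h1 : log (2 * S.card) ≤ log (6 * R) := log_le_log (by positivity) (by linarith)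
    have h2 : log (2 * S.card) / (R / 9) ≤ ε / 2 := by
      rw [div_le_iff₀ (by positivity)]; linarith
    linarith

lemma sum_pow_le_of_le {r y : ℝ} (hr : 1 < r) (hy : 0 ≤ y) {J : Finset ℕ} (hJ : ∀ j ∈ J, r ^ j ≤ y) :
    ∑ j ∈ J, r ^ j ≤ r / (r - 1) * y := by
  have hr1 : 0 < r - 1 := by linarith
  rcases J.eq_empty_or_nonempty with rfl | hne
  · simp only [sum_empty]; positivity
  · have hsub : J ⊆ range (J.max' hne + 1) := fun j hj =>
      mem_range.2 (Nat.lt_succ_of_le (J.le_max' j hj))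
    calc ∑ j ∈ J, r ^ j ≤ ∑ j ∈ range (J.max' hne + 1), r ^ j :=
          sum_le_sum_of_subset_of_nonneg hsub fun _ _ _ => by positivity
      _ = (r ^ (J.max' hne + 1) - 1) / (r - 1) := geom_sum_eq hr.ne' _
      _ ≤ (r * y) / (r - 1) := by
          refine div_le_div_of_nonneg_right ?_ hr1.le
          rw [pow_succ']
          have := mul_le_mul_of_nonneg_left (hJ _ (J.max'_mem hne)) (by linarith : 0 ≤ r)
          linarith
      _ = _ := by ring

open Classical in
/-- The positive integers up to `x` outside `B + 𝒫`. -/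
noncomputable def missed (B : Set ℕ) (x : ℕ) : Finset ℕ :=
  (Icc 1 x).filter fun n => ∀ b ∈ B, ¬ PrimeShift b n

theorem exists_log_sparse_set {ε : ℝ} (hε : 0 < ε) : ∃ (B : Set ℕ) (K : ℝ), 0 < K ∧
    (∀ x : ℕ, 1 ≤ x → ∃ F : Finset ℕ, (F.card : ℝ) ≤ K * log x ∧ ∀ b ∈ B, b ≤ x → b ∈ F) ∧
    ∀ᶠ x : ℕ in atTop, ((missed B x).card : ℝ) ≤ ε * x := by
  classical
  obtain ⟨r, hr, hr2, K, hK, hev⟩ := exists_stage (ε := ε / 4) (by positivity)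
  obtain ⟨R₀, hR₀⟩ := eventually_atTop.1 hev
  choose! T hTc hTl hTu using hR₀
  obtain ⟨j₀, hj₀⟩ := pow_unbounded_of_one_lt (max R₀ 1) hr
  have hj : ∀ j, j₀ ≤ j → R₀ ≤ r ^ j := fun j hj =>
    (le_max_left _ _).trans (hj₀.le.trans (pow_le_pow_right₀ hr.le hj))
  have hr1 : 0 < r - 1 := by linarith
  refine ⟨{b | ∃ j, j₀ ≤ j ∧ b ∈ T (r ^ j)}, K * (r / (r - 1) * 4), by positivity, fun x hx => ?_, ?_⟩
  · have hlx : 0 ≤ log (x : ℝ) := log_nonneg (by exact_mod_cast hx)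
    obtain ⟨N, hN⟩ := pow_unbounded_of_one_lt (4 * log x) hr
    set J := (range N).filter fun j => j₀ ≤ j ∧ r ^ j ≤ 4 * log x with hJ
    refine ⟨J.biUnion fun j => T (r ^ j), ?_, ?_⟩
    · calc ((J.biUnion fun j => T (r ^ j)).card : ℝ) ≤ ∑ j ∈ J, ((T (r ^ j)).card : ℝ) := by
            exact_mod_cast card_biUnion_le
        _ ≤ ∑ j ∈ J, K * r ^ j := sum_le_sum fun j hjJ => hTc _ (hj j (mem_filter.1 hjJ).2.1)
        _ = K * ∑ j ∈ J, r ^ j := by rw [mul_sum]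
        _ ≤ K * (r / (r - 1) * (4 * log x)) :=
            mul_le_mul_of_nonneg_left (sum_pow_le_of_le hr (by linarith)
              fun j hjJ => (mem_filter.1 hjJ).2.2) hK.le
        _ = _ := by ring
    · rintro b ⟨j, hj1, hb⟩ hbx
      have h1 := hTl _ (hj j hj1) b hb
      have h2 : (1 : ℝ) ≤ r ^ j := one_le_pow₀ hr.le
      have hb0 : 0 < b := by
        rcases Nat.eq_zero_or_pos b with rfl | h
        · rw [Nat.cast_zero, log_zero] at h1; linarith
        · exact h
      have h3 : log (b : ℝ) ≤ log x := log_le_log (by exact_mod_cast hb0) (by exact_mod_cast hbx)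
      have h4 : r ^ j ≤ 4 * log x := by linarith
      exact mem_biUnion.2 ⟨j, mem_filter.2 ⟨mem_range.2 ((pow_lt_pow_iff_right₀ hr).1
        (h4.trans_lt hN)), hj1, h4⟩, hb⟩
  · set B : Set ℕ := {b | ∃ j, j₀ ≤ j ∧ b ∈ T (r ^ j)} with hB
    set m₀ : ℕ := ⌈r ^ j₀⌉₊ with hm₀
    have hblock : ∀ m : ℕ, m₀ ≤ m → (((Ioc (2 ^ m) (2 * 2 ^ m)).filter
        fun n => ∀ b ∈ B, ¬ PrimeShift b n).card : ℝ) ≤ ε / 4 * 2 ^ m := by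
      intro m hm
      have hmR : r ^ j₀ ≤ m := (Nat.le_ceil _).trans (by exact_mod_cast hm)
      obtain ⟨j, hj1, hj2⟩ := exists_nat_pow_near
        ((one_le_pow₀ hr.le).trans hmR : (1 : ℝ) ≤ m) hr
      have hjj : j₀ ≤ j := Nat.lt_succ_iff.1 ((pow_lt_pow_iff_right₀ hr).1 (hmR.trans_lt hj2))
      refine le_trans ?_ (hTu _ (hj j hjj) m hj1 (by rwa [pow_succ'] at hj2))
      norm_cast
      refine card_le_card fun n hn => ?_
      obtain ⟨h1, h2⟩ := mem_filter.1 hn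
      exact mem_filter.2 ⟨h1, fun b hb => h2 b ⟨j, hjj, hb⟩⟩
    have ht : ∀ᶠ x : ℕ in atTop, (2 : ℝ) ^ m₀ ≤ ε / 2 * x :=
      (tendsto_natCast_atTop_atTop.const_mul_atTop (by positivity)).eventually_ge_atTop _
    filter_upwards [ht, eventually_ge_atTop 1] with x hx hx1
    have hsub : missed B x ⊆ Icc 1 (2 ^ m₀) ∪ (Ico m₀ (Nat.log 2 x + 1)).biUnion fun m =>
        (Ioc (2 ^ m) (2 * 2 ^ m)).filter fun n => ∀ b ∈ B, ¬ PrimeShift b n := by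
      intro n hn
      obtain ⟨h1, h2⟩ := mem_filter.1 hn
      obtain ⟨h3, h4⟩ := mem_Icc.1 h1
      rw [mem_union]
      rcases le_or_gt n (2 ^ m₀) with h5 | h5
      · exact Or.inl (mem_Icc.2 ⟨h3, h5⟩)
      · right
        have hp : 0 < 2 ^ m₀ := by positivity
        have h6 : n - 1 ≠ 0 := by omega
        have a1 := Nat.pow_log_le_self 2 h6
        have a2 := Nat.lt_pow_succ_log_self (b := 2) (by norm_num) (n - 1)
        rw [pow_succ'] at a2
        refine mem_biUnion.2 ⟨Nat.log 2 (n - 1), mem_Ico.2 ⟨?_, ?_⟩, mem_filter.2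
          ⟨mem_Ioc.2 ⟨by omega, by omega⟩, h2⟩⟩
        · exact Nat.le_log_of_pow_le (by norm_num) (by omega)
        · exact Nat.lt_succ_of_le (Nat.log_mono_right (by omega))
    have hgeom : ∑ m ∈ Ico m₀ (Nat.log 2 x + 1), (2 : ℝ) ^ m ≤ 2 * x := by
      calc ∑ m ∈ Ico m₀ (Nat.log 2 x + 1), (2 : ℝ) ^ m ≤ ∑ m ∈ range (Nat.log 2 x + 1), (2 : ℝ) ^ m :=
            sum_le_sum_of_subset_of_nonneg
              (fun m hm => mem_range.2 (mem_Ico.1 hm).2) fun _ _ _ => by positivity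
        _ = (2 ^ (Nat.log 2 x + 1) - 1) / (2 - 1) := geom_sum_eq (by norm_num) _
        _ ≤ 2 * 2 ^ Nat.log 2 x := by rw [pow_succ']; linarith
        _ ≤ 2 * x := by
            have : 2 ^ Nat.log 2 x ≤ x := Nat.pow_log_le_self 2 (by omega)
            exact_mod_cast Nat.mul_le_mul_left 2 this
    have hcard := (card_le_card hsub).trans ((card_union_le _ _).trans
      (Nat.add_le_add_left card_biUnion_le _))
    have hcardR : ((missed B x).card : ℝ) ≤ 2 ^ m₀ + ∑ m ∈ Ico m₀ (Nat.log 2 x + 1),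
        (((Ioc (2 ^ m) (2 * 2 ^ m)).filter fun n => ∀ b ∈ B, ¬ PrimeShift b n).card : ℝ) := by
      rw [Nat.card_Icc, Nat.add_sub_cancel] at hcard
      exact_mod_cast hcard
    have hsum : ∑ m ∈ Ico m₀ (Nat.log 2 x + 1),
        (((Ioc (2 ^ m) (2 * 2 ^ m)).filter fun n => ∀ b ∈ B, ¬ PrimeShift b n).card : ℝ) ≤
        ε / 4 * (2 * x) := by
      refine (sum_le_sum fun m hm => hblock m (mem_Ico.1 hm).1).trans ?_
      rw [← mul_sum]
      exact mul_le_mul_of_nonneg_left hgeom (by positivity)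
    linarith

lemma tendsto_primeCounting_div :
    Tendsto (fun x : ℕ => (Nat.primeCounting x : ℝ) / x) atTop (nhds 0) := by
  have hlog : Tendsto (fun x : ℕ => 3 / log (x : ℝ)) atTop (nhds 0) :=
    tendsto_const_nhds.div_atTop (tendsto_log_atTop.comp tendsto_natCast_atTop_atTop)
  refine squeeze_zero' (Eventually.of_forall fun x => by positivity) ?_ hlog
  filter_upwards [tendsto_natCast_atTop_atTop.eventually
    (Chebyshev.eventually_primeCounting_le (ε := 1) one_pos), eventually_ge_atTop 2] with x hx hx2
  have hxR : (2 : ℝ) ≤ x := by exact_mod_cast hx2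
  have hl : 0 < log (x : ℝ) := log_pos (by linarith)
  have hl4 : log 4 ≤ 2 := by
    rw [show (4 : ℝ) = 2 ^ 2 by norm_num, log_pow]; push_cast; linarith [log_two_lt_d9]
  rw [Nat.floor_natCast] at hx
  rw [div_le_iff₀ (by linarith)]
  refine hx.trans ?_
  rw [div_mul_eq_mul_div]
  exact div_le_div_of_nonneg_right (by nlinarith) hl.le

lemma card_missed_le {A B : Set ℕ} {t : ℕ} (h : ∀ b ∈ A, t < b → b ∈ B) (x : ℕ) :
    (missed B x).card ≤ (missed A x).card + (t + 1) * Nat.primeCounting x := by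
  classical
  have hsub : missed B x ⊆ missed A x ∪
      (range (t + 1)).biUnion fun b => (Icc 1 x).filter (PrimeShift b) := by
    intro n hn
    obtain ⟨h1, h2⟩ := mem_filter.1 hn
    rw [mem_union]
    by_cases h3 : ∀ b ∈ A, ¬ PrimeShift b n
    · exact Or.inl (mem_filter.2 ⟨h1, h3⟩)
    · push Not at h3
      obtain ⟨b, hb, hbn⟩ := h3
      refine Or.inr (mem_biUnion.2 ⟨b, mem_range.2 ?_, mem_filter.2 ⟨h1, hbn⟩⟩)
      by_contra hlt
      exact h2 b (h b hb (by omega)) hbn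
  refine (card_le_card hsub).trans ((card_union_le _ _).trans (Nat.add_le_add_left ?_ _))
  refine (card_biUnion_le_card_mul _ _ (Nat.primeCounting x) fun b _ =>
    card_filter_primeShift_le (fun n hn => (mem_Icc.1 hn).2) b).trans ?_
  rw [card_range]

lemma ncard_add_card_missed (B : Set ℕ) (x : ℕ) :
    Set.ncard {n : ℕ | 1 ≤ n ∧ n ≤ x ∧ ∃ b ∈ B, ∃ p : ℕ, Nat.Prime p ∧ n = b + p} +
      (missed B x).card = x := by
  classical
  have h1 : {n : ℕ | 1 ≤ n ∧ n ≤ x ∧ ∃ b ∈ B, ∃ p : ℕ, Nat.Prime p ∧ n = b + p} =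
      ((Icc 1 x).filter fun n => ¬ ∀ b ∈ B, ¬ PrimeShift b n : Finset ℕ) := by
    ext n
    simp only [Set.mem_ofPred_eq, coe_filter, mem_Icc, and_assoc]
    refine and_congr_right fun _ => and_congr_right fun _ => ?_
    push Not
    refine exists_congr fun b => and_congr_right fun _ => ⟨?_, fun hp => ?_⟩
    · rintro ⟨p, hp, rfl⟩
      simpa [PrimeShift] using hp
    · have h2 : (n - b).Prime := hp
      exact ⟨n - b, h2, by have := h2.two_le; omega⟩
  rw [h1, Set.ncard_coe_finset]
  have := card_filter_add_card_filter_not (s := Icc 1 x) (fun n => ∀ b ∈ B, ¬ PrimeShift b n)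
  rw [Nat.card_Icc] at this
  unfold missed
  omega

lemma sum_le_of_antitone_cutoff {K : ℕ → ℝ} (hK : ∀ i, 0 ≤ K i) {I : Finset ℕ} {y : ℝ} (hy : 0 ≤ y)
    (h : ∀ i ∈ I, ∑ j ∈ range (i + 1), K j ≤ y) : ∑ i ∈ I, K i ≤ y := by
  rcases I.eq_empty_or_nonempty with rfl | hne
  · simpa using hy
  · refine le_trans (sum_le_sum_of_subset_of_nonneg (fun i hi => ?_) fun i _ _ => hK i)
      (h _ (I.max'_mem hne))
    exact mem_range.2 (Nat.lt_succ_of_le (I.le_max' i hi))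

end PrimeComplement

/-- For every `w → ∞` there exist a set `B ⊆ ℕ` and `C > 0` with
`B(x) ≤ C·w(x)·log x` for all large `x`, such that the sumset `B + 𝒫` has
lower asymptotic density `1`. -/
theorem almost_additive_complement_of_primes
    (w : ℕ → ℝ) (hw : Tendsto w atTop atTop) :
    ∃ (B : Set ℕ) (C : ℝ), 0 < C ∧
      (∀ᶠ x : ℕ in atTop, (countFn B x : ℝ) ≤ C * w x * Real.log x) ∧
      liminf (fun x : ℕ =>
        (Set.ncard {n : ℕ | 1 ≤ n ∧ n ≤ x ∧
            ∃ b ∈ B, ∃ p : ℕ, Nat.Prime p ∧ n = b + p} : ℝ) / (x : ℝ))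
        atTop = 1 := by
  classical
  have hex : ∀ i : ℕ, _ := fun i : ℕ =>
    PrimeComplement.exists_log_sparse_set (ε := 1 / ((i : ℝ) + 1)) (by positivity)
  choose A K hK hF hU using hex
  have hT : ∀ i : ℕ, ∃ t : ℕ, i ≤ t ∧ ∀ x, t ≤ x → ∑ j ∈ Finset.range (i + 1), K j ≤ w x := by
    intro i
    obtain ⟨t, ht⟩ := eventually_atTop.1 (hw.eventually_ge_atTop (∑ j ∈ Finset.range (i + 1), K j))
    exact ⟨max t i, le_max_right _ _, fun x hx => ht x ((le_max_left _ _).trans hx)⟩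
  choose t hti htw using hT
  set B : Set ℕ := {b | ∃ i, b ∈ A i ∧ t i < b} with hB
  refine ⟨B, 1, one_pos, ?_, ?_⟩
  · filter_upwards [hw.eventually_ge_atTop 0, eventually_ge_atTop 1] with x hx0 hx1
    have hlog : 0 ≤ log (x : ℝ) := log_nonneg (by exact_mod_cast hx1)
    choose F hFc hFm using fun i => hF i x hx1
    set I := (Finset.range x).filter fun i => t i < x with hI
    have hsub : {a : ℕ | a ∈ B ∧ 1 ≤ a ∧ (a : ℝ) ≤ (x : ℝ)} ⊆ (I.biUnion F : Finset ℕ) := by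
      rintro b ⟨⟨i, hbi, htb⟩, -, hbx⟩
      have hbx : b ≤ x := by exact_mod_cast hbx
      have := hti i
      exact Finset.mem_coe.2 (Finset.mem_biUnion.2 ⟨i, Finset.mem_filter.2
        ⟨Finset.mem_range.2 (by omega), by omega⟩, hFm i b hbi hbx⟩)
    have h1 : countFn B x ≤ (I.biUnion F).card := by
      have := Set.ncard_le_ncard hsub (Finset.finite_toSet _)
      rwa [Set.ncard_coe_finset] at this
    calc (countFn B x : ℝ) ≤ (I.biUnion F).card := by exact_mod_cast h1
      _ ≤ ∑ i ∈ I, ((F i).card : ℝ) := by exact_mod_cast Finset.card_biUnion_le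
      _ ≤ ∑ i ∈ I, K i * log x := Finset.sum_le_sum fun i _ => hFc i
      _ = (∑ i ∈ I, K i) * log x := by rw [Finset.sum_mul]
      _ ≤ w x * log x := by
          refine mul_le_mul_of_nonneg_right ?_ hlog
          exact PrimeComplement.sum_le_of_antitone_cutoff (fun i => (hK i).le) hx0
            fun i hi => htw i x (Finset.mem_filter.1 hi).2.le
      _ = _ := by ring
  · have hmiss : Tendsto (fun x : ℕ => ((PrimeComplement.missed B x).card : ℝ) / x) atTop
        (nhds 0) := by
      refine tendsto_order.2 ⟨fun a ha => Eventually.of_forall fun x => ha.trans_le (by positivity),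
        fun a ha => ?_⟩
      obtain ⟨i, hi⟩ := exists_nat_one_div_lt (half_pos ha)
      have hpi := (PrimeComplement.tendsto_primeCounting_div.const_mul
        ((t i + 1 : ℕ) : ℝ)).eventually_lt_const (u := a / 2) (by simpa using half_pos ha)
      filter_upwards [hU i, hpi, eventually_ge_atTop 1] with x hx1 hx2 hx3
      have hx : (0 : ℝ) < x := by exact_mod_cast hx3
      have h1 : ((PrimeComplement.missed B x).card : ℝ) ≤
          (PrimeComplement.missed (A i) x).card + ((t i + 1 : ℕ) : ℝ) * Nat.primeCounting x := by
        have h0 := PrimeComplement.card_missed_le (A := A i) (B := B) (t := t i)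
          (fun b hb htb => ⟨i, hb, htb⟩) x
        exact_mod_cast h0
      rw [div_lt_iff₀ hx]
      rw [← mul_div_assoc, div_lt_iff₀ hx] at hx2
      have h2 : 1 / ((i : ℝ) + 1) * x ≤ a / 2 * x := mul_le_mul_of_nonneg_right hi.le hx.le
      linarith
    have hlim : Tendsto (fun x : ℕ => (1 : ℝ) - ((PrimeComplement.missed B x).card : ℝ) / x) atTop
        (nhds 1) := by simpa using hmiss.const_sub 1
    refine (hlim.congr' ?_).liminf_eq
    filter_upwards [eventually_ge_atTop 1] with x hx1
    have hx : (x : ℝ) ≠ 0 := by positivity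
    have h1 : (Set.ncard {n : ℕ | 1 ≤ n ∧ n ≤ x ∧ ∃ b ∈ B, ∃ p : ℕ, Nat.Prime p ∧ n = b + p} : ℝ) +
        (PrimeComplement.missed B x).card = x := by
      exact_mod_cast PrimeComplement.ncard_add_card_missed B x
    rw [eq_div_iff hx, sub_mul, div_mul_cancel₀ _ hx]
    linarith
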